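/- There exist universal constants c, c', C > 0 with the following property. Let n ≥ 1 and let S ⊆ ℝ^n be a Borel set with S ∩ (−S) = ∅ and 0 < Vol_n(S) < c·n, and write λ = Vol_n(S). Let μ be any SL_n(ℝ)-invariant Borel probability measure on the space 𝒳_n of covolume-one lattices in ℝ^n. Then for every Borel collection 𝒜 of finite subsets of S, |μ({L ∈ 𝒳_n : L ∩ S is finite and L ∩ S ∈ 𝒜}) − P_λ(𝒜)| ≤ C·e^{−c'·n}. In particular, the total variation distance between the law of L ∩ S under μ and the law of the restriction to S of the Poisson point process of intensity one is at most C·e^{−c'·n}. -/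

import Mathlib

open MeasureTheory Pointwise
open scoped ENNReal

noncomputable section

/-- `SL(n, ℝ)`, the special linear group of `n × n` real matrices of determinant one. -/
abbrev SLR (n : ℕ) := Matrix.SpecialLinearGroup (Fin n) ℝ

/-- The topology on `SL(n, ℝ)` induced from the space of matrices. -/
instance (n : ℕ) : TopologicalSpace (SLR n) :=
  TopologicalSpace.induced (fun g => (g : Matrix (Fin n) (Fin n) ℝ)) inferInstance

/-- The subgroup `SL(n, ℤ)` of `SL(n, ℝ)` (the range of the coefficient-wise
integer-to-real map on special linear groups). -/
def SLZ (n : ℕ) : Subgroup (SLR n) :=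
  MonoidHom.range (Matrix.SpecialLinearGroup.map (n := Fin n) (Int.castRingHom ℝ))

/-- The space `𝒳ₙ = SL(n, ℝ) / SL(n, ℤ)` of lattices of covolume one in `ℝⁿ`. -/
def LatticeSpace (n : ℕ) := SLR n ⧸ SLZ n

instance (n : ℕ) : TopologicalSpace (LatticeSpace n) :=
  inferInstanceAs (TopologicalSpace (SLR n ⧸ SLZ n))

/-- The Borel σ-algebra on the space of lattices. -/
instance (n : ℕ) : MeasurableSpace (LatticeSpace n) := borel _

/-- The action of `SL(n, ℝ)` on the space of lattices, `g.L = {g x : x ∈ L}`. -/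
instance (n : ℕ) : MulAction (SLR n) (LatticeSpace n) :=
  inferInstanceAs (MulAction (SLR n) (SLR n ⧸ SLZ n))

/-- The lattice `{g v : v ∈ ℤⁿ} ⊆ ℝⁿ` associated to a point of `LatticeSpace n`,
computed via a representative `g` of the coset (the resulting set of vectors does not
depend on the choice of representative, since `SL(n, ℤ)` preserves `ℤⁿ`). -/
def latticeOf {n : ℕ} (L : LatticeSpace n) : Set (Fin n → ℝ) :=
  {y | ∃ v : Fin n → ℤ,
    y = (Quotient.out (α := SLR n) L).1.mulVec (fun i => (v i : ℝ))}

/-- The law of the restriction to `S` of the Poisson point process of intensity one: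
the probability that the (finite) point configuration in `S` belongs to the
collection `𝒜` of finite subsets of `S`. -/
def poissonLaw (n : ℕ) (S : Set (Fin n → ℝ)) (𝒜 : Set (Set (Fin n → ℝ))) : ℝ :=
  ∑' m : ℕ,
    (Real.exp (-(volume S).toReal) * (volume S).toReal ^ m / (Nat.factorial m) *
      ((volume S).toReal ^ m)⁻¹) *
    ∫ x in Set.univ.pi (fun _ : Fin m => S),
      Set.indicator 𝒜 (fun _ => (1 : ℝ)) (Set.range x)

section LatticeSpaceTopology

variable {n : ℕ}

instance : IsTopologicalGroup (SLR n) :=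
  Matrix.SpecialLinearGroup.topologicalGroup (n := Fin n) (R := ℝ)

lemma SLR.isClosedEmbedding_val :
    Topology.IsClosedEmbedding (fun g : SLR n => (g : Matrix (Fin n) (Fin n) ℝ)) :=
  Matrix.SpecialLinearGroup.isClosedEmbedding_val

instance : PolishSpace (SLR n) :=
  haveI : PolishSpace (Matrix (Fin n) (Fin n) ℝ) :=
    inferInstanceAs (PolishSpace (Fin n → Fin n → ℝ))
  SLR.isClosedEmbedding_val.polishSpace

instance : MeasurableSpace (SLR n) := borel _

instance : BorelSpace (SLR n) := ⟨rfl⟩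

instance : BorelSpace (LatticeSpace n) := ⟨rfl⟩

lemma isClosed_SLZ (n : ℕ) : IsClosed (SLZ n : Set (SLR n)) := by
  have h := Topology.IsClosedEmbedding.specialLinearGroup_map (n := Fin n)
    (f := Int.castRingHom ℝ) Int.isClosedEmbedding_coe_real
  have := h.isClosed_range
  rwa [← MonoidHom.coe_range] at this

instance : T1Space (LatticeSpace n) :=
  haveI := isClosed_SLZ n
  inferInstanceAs (T1Space (SLR n ⧸ SLZ n))

instance : SecondCountableTopology (LatticeSpace n) :=
  inferInstanceAs (SecondCountableTopology (SLR n ⧸ SLZ n))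

instance : ContinuousSMul (SLR n) (LatticeSpace n) :=
  inferInstanceAs (ContinuousSMul (SLR n) (SLR n ⧸ SLZ n))

/-- The lattice `g ℤⁿ` as a point of the space of lattices. -/
def latMk (g : SLR n) : LatticeSpace n := (QuotientGroup.mk g : SLR n ⧸ SLZ n)

lemma latMk_surjective : Function.Surjective (latMk : SLR n → LatticeSpace n) :=
  Quotient.mk_surjective

lemma continuous_latMk : Continuous (latMk : SLR n → LatticeSpace n) :=
  QuotientGroup.continuous_mk

lemma latMk_out (L : LatticeSpace n) : latMk (Quotient.out (α := SLR n) L) = L :=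
  Quotient.out_eq (s := QuotientGroup.leftRel (SLZ n)) L

lemma smul_latMk (g h : SLR n) : g • latMk h = latMk (g * h) := rfl

lemma measurable_of_comp_latMk {β : Type*} [MeasurableSpace β] {F : LatticeSpace n → β}
    (h : Measurable (F ∘ latMk)) : Measurable F := by
  intro s hs
  have key := (continuous_latMk (n := n)).map_borel_eq latMk_surjective
  change @MeasurableSet _ (borel _) _
  rw [← key]
  exact h hs

lemma latMk_eq_iff (g h : SLR n) :
    latMk g = latMk h ↔ ∃ γ : Matrix.SpecialLinearGroup (Fin n) ℤ,
      h = g * Matrix.SpecialLinearGroup.map (Int.castRingHom ℝ) γ := by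
  change ((g : SLR n ⧸ SLZ n) = (h : SLR n ⧸ SLZ n)) ↔ _
  rw [QuotientGroup.eq]
  constructor
  · rintro ⟨γ, hγ⟩
    exact ⟨γ, by rw [hγ]; group⟩
  · rintro ⟨γ, rfl⟩
    exact ⟨γ, by group⟩

end LatticeSpaceTopology

section SiegelTransform

variable {n : ℕ} {ι : Type*}

/-- The diagonal action of `SL(n, ℝ)` on tuples of vectors. -/
def tupleAct (g : SLR n) (x : ι → Fin n → ℝ) : ι → Fin n → ℝ := fun i => g.1.mulVec (x i)

/-- A tuple of integer vectors as a tuple of real vectors. -/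
def tupleCast (v : ι → Fin n → ℤ) : ι → Fin n → ℝ := fun i j => (v i j : ℝ)

/-- The sum of `f` over the images under `g` of the integer tuples in `W`. -/
def latSum (W : Set (ι → Fin n → ℤ)) (f : (ι → Fin n → ℝ) → ℝ≥0∞) (g : SLR n) : ℝ≥0∞ :=
  ∑' v : W, f (tupleAct g (tupleCast v.1))

/-- The Siegel transform: the sum of `f` over the tuples of lattice vectors whose coordinates
with respect to a basis lie in `W`. -/
def siegel (W : Set (ι → Fin n → ℤ)) (f : (ι → Fin n → ℝ) → ℝ≥0∞) (L : LatticeSpace n) : ℝ≥0∞ :=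
  latSum W f (Quotient.out (α := SLR n) L)

/-- Invariance of a set of integer tuples under `SL(n, ℤ)`. -/
def IsSLZInvariant (W : Set (ι → Fin n → ℤ)) : Prop :=
  ∀ γ : Matrix.SpecialLinearGroup (Fin n) ℤ, ∀ v ∈ W, (fun i => γ.1.mulVec (v i)) ∈ W

lemma tupleAct_mul (g h : SLR n) (x : ι → Fin n → ℝ) :
    tupleAct (g * h) x = tupleAct g (tupleAct h x) := by
  funext i
  simp [tupleAct, Matrix.mulVec_mulVec]

lemma tupleAct_tupleCast (γ : Matrix.SpecialLinearGroup (Fin n) ℤ) (v : ι → Fin n → ℤ) :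
    tupleAct (Matrix.SpecialLinearGroup.map (Int.castRingHom ℝ) γ) (tupleCast v) =
      tupleCast (fun i => γ.1.mulVec (v i)) := by
  funext i j
  simp [tupleAct, tupleCast, Matrix.mulVec, dotProduct]

lemma continuous_tupleAct :
    Continuous (fun p : SLR n × (ι → Fin n → ℝ) => tupleAct p.1 p.2) := by
  refine continuous_pi fun i => ?_
  exact Continuous.matrix_mulVec (SLR.isClosedEmbedding_val.continuous.comp continuous_fst)
    ((continuous_apply i).comp continuous_snd)

lemma continuous_tupleAct_left (x : ι → Fin n → ℝ) :
    Continuous (fun g : SLR n => tupleAct g x) :=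
  continuous_tupleAct.comp (by fun_prop : Continuous fun g : SLR n => (g, x))

lemma continuous_tupleAct_right (g : SLR n) :
    Continuous (fun x : ι → Fin n → ℝ => tupleAct g x) :=
  continuous_tupleAct.comp (by fun_prop : Continuous fun x : ι → Fin n → ℝ => (g, x))

lemma latSum_mul_map {W : Set (ι → Fin n → ℤ)} (hW : IsSLZInvariant W)
    (f : (ι → Fin n → ℝ) → ℝ≥0∞) (g : SLR n) (γ : Matrix.SpecialLinearGroup (Fin n) ℤ) :
    latSum W f (g * Matrix.SpecialLinearGroup.map (Int.castRingHom ℝ) γ) = latSum W f g := by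
  let e : W ≃ W :=
    { toFun := fun v => ⟨fun i => γ.1.mulVec (v.1 i), hW γ v.1 v.2⟩
      invFun := fun v => ⟨fun i => (γ⁻¹).1.mulVec (v.1 i), hW γ⁻¹ v.1 v.2⟩
      left_inv := fun v => by
        ext i : 2
        simp only [Matrix.mulVec_mulVec]
        rw [← Matrix.SpecialLinearGroup.coe_mul]; simp
      right_inv := fun v => by
        ext i : 2
        simp only [Matrix.mulVec_mulVec]
        rw [← Matrix.SpecialLinearGroup.coe_mul]; simp }
  unfold latSum
  rw [← e.tsum_eq (fun v : W => f (tupleAct g (tupleCast v.1)))]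
  refine tsum_congr fun v => ?_
  rw [tupleAct_mul, tupleAct_tupleCast]
  rfl

lemma siegel_latMk {W : Set (ι → Fin n → ℤ)} (hW : IsSLZInvariant W)
    (f : (ι → Fin n → ℝ) → ℝ≥0∞) (g : SLR n) : siegel W f (latMk g) = latSum W f g := by
  obtain ⟨γ, hγ⟩ := (latMk_eq_iff g _).1 (latMk_out (latMk g)).symm
  unfold siegel
  rw [hγ, latSum_mul_map hW]

lemma siegel_smul {W : Set (ι → Fin n → ℤ)} (hW : IsSLZInvariant W)
    (f : (ι → Fin n → ℝ) → ℝ≥0∞) (h : SLR n) (L : LatticeSpace n) :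
    siegel W f (h • L) = siegel W (fun x => f (tupleAct h x)) L := by
  obtain ⟨g, rfl⟩ := latMk_surjective L
  rw [smul_latMk, siegel_latMk hW, siegel_latMk hW]
  simp only [latSum, tupleAct_mul]

lemma measurable_latSum [Finite ι] (W : Set (ι → Fin n → ℤ)) {f : (ι → Fin n → ℝ) → ℝ≥0∞}
    (hf : Measurable f) : Measurable (latSum W f) :=
  Measurable.tsum fun _ => hf.comp (continuous_tupleAct_left _).measurable

lemma measurable_siegel [Finite ι] {W : Set (ι → Fin n → ℤ)} (hW : IsSLZInvariant W)
    {f : (ι → Fin n → ℝ) → ℝ≥0∞} (hf : Measurable f) : Measurable (siegel W f) := by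
  refine measurable_of_comp_latMk ?_
  have : siegel W f ∘ latMk = latSum W f := funext fun g => siegel_latMk hW f g
  rw [this]
  exact measurable_latSum W hf

end SiegelTransform

section Averaging

open Filter

variable {n : ℕ} {Θ : Type*} [TopologicalSpace Θ] [MeasurableSpace Θ]
  [OpensMeasurableSpace Θ]

lemma measurable_smul_comp {F : LatticeSpace n → ℝ≥0∞} (hF : Measurable F) {g : Θ → SLR n}
    (hg : Continuous g) : Measurable (fun p : Θ × LatticeSpace n => F (g p.1 • p.2)) := by
  have : Continuous (fun p : Θ × LatticeSpace n => g p.1 • p.2) :=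
    (hg.comp continuous_fst).smul continuous_snd
  exact hF.comp this.measurable

lemma lintegral_average {μ : Measure (LatticeSpace n)} [IsProbabilityMeasure μ]
    (hμ : ∀ g : SLR n, Measure.map (fun x => g • x) μ = μ)
    (η : Measure Θ) [IsProbabilityMeasure η] {F : LatticeSpace n → ℝ≥0∞} (hF : Measurable F)
    {g : Θ → SLR n} (hg : Continuous g) :
    ∫⁻ L, ∫⁻ θ, F (g θ • L) ∂η ∂μ = ∫⁻ L, F L ∂μ := by
  rw [lintegral_lintegral_swap]
  · have : ∀ θ, ∫⁻ L, F (g θ • L) ∂μ = ∫⁻ L, F L ∂μ := fun θ => by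
      conv_rhs => rw [← hμ (g θ)]
      rw [lintegral_map hF (continuous_const_smul _).measurable]
    simp [this]
  · exact ((measurable_smul_comp hF hg).comp measurable_swap).aemeasurable

lemma le_lintegral_of_le_liminf_average {μ : Measure (LatticeSpace n)} [IsProbabilityMeasure μ]
    (hμ : ∀ g : SLR n, Measure.map (fun x => g • x) μ = μ)
    (η : Measure Θ) [IsProbabilityMeasure η] {F : LatticeSpace n → ℝ≥0∞} (hF : Measurable F)
    {g : ℕ → Θ → SLR n} (hg : ∀ N, Continuous (g N)) {c : ℝ≥0∞}
    (hc : ∀ L, c ≤ liminf (fun N => ∫⁻ θ, F (g N θ • L) ∂η) atTop) :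
    c ≤ ∫⁻ L, F L ∂μ := by
  calc c = ∫⁻ _, c ∂μ := by simp
    _ ≤ ∫⁻ L, liminf (fun N => ∫⁻ θ, F (g N θ • L) ∂η) atTop ∂μ := lintegral_mono hc
    _ ≤ liminf (fun N => ∫⁻ L, ∫⁻ θ, F (g N θ • L) ∂η ∂μ) atTop :=
        lintegral_liminf_le fun N =>
          ((measurable_smul_comp hF (hg N)).comp measurable_swap).lintegral_prod_right'
    _ = ∫⁻ L, F L ∂μ := by
        simp_rw [fun N => lintegral_average hμ η hF (hg N)]
        exact liminf_const _

lemma lintegral_le_of_limsup_average_le {μ : Measure (LatticeSpace n)} [IsProbabilityMeasure μ]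
    (hμ : ∀ g : SLR n, Measure.map (fun x => g • x) μ = μ)
    (η : Measure Θ) [IsProbabilityMeasure η] {F : LatticeSpace n → ℝ≥0∞} (hF : Measurable F)
    {g : ℕ → Θ → SLR n} (hg : ∀ N, Continuous (g N)) {c : ℝ≥0∞}
    (hc : ∀ L, limsup (fun N => ∫⁻ θ, F (g N θ • L) ∂η) atTop ≤ c) :
    ∫⁻ L, F L ∂μ ≤ c := by
  have key : ∀ b : ℕ, ∫⁻ L, min (F L) b ∂μ ≤ c := by
    intro b
    have hFb : Measurable (fun L => min (F L) b) := hF.min measurable_const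
    have hm : ∀ N, Measurable fun L => ∫⁻ θ, min (F (g N θ • L)) b ∂η := fun N =>
      ((measurable_smul_comp hFb (hg N)).comp measurable_swap).lintegral_prod_right'
    calc ∫⁻ L, min (F L) b ∂μ
        = limsup (fun N => ∫⁻ L, ∫⁻ θ, min (F (g N θ • L)) b ∂η ∂μ) atTop := by
          simp only [lintegral_average hμ η hFb (hg _)]
          exact (limsup_const _).symm
      _ ≤ ∫⁻ L, limsup (fun N => ∫⁻ θ, min (F (g N θ • L)) b ∂η) atTop ∂μ := by
          refine limsup_lintegral_le (g := fun _ => (b : ℝ≥0∞)) hm (fun N => ?_) (by simp)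
          refine Eventually.of_forall fun L => ?_
          calc ∫⁻ θ, min (F (g N θ • L)) b ∂η ≤ ∫⁻ _, (b : ℝ≥0∞) ∂η :=
                lintegral_mono fun _ => min_le_right _ _
            _ = b := by simp
      _ ≤ ∫⁻ _, c ∂μ := by
          refine lintegral_mono fun L => le_trans ?_ (hc L)
          exact limsup_le_limsup (Eventually.of_forall fun N =>
            lintegral_mono fun _ => min_le_left _ _)
      _ = c := by simp
  have hsup : ∀ L, F L = ⨆ b : ℕ, min (F L) b := by
    intro L
    refine le_antisymm ?_ (iSup_le fun b => min_le_left _ _)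
    have : (⨆ b : ℕ, min (F L) b) = min (F L) (⨆ b : ℕ, (b : ℝ≥0∞)) := by
      simpa using (inf_iSup_eq (F L) fun b : ℕ => (b : ℝ≥0∞)).symm
    rw [this, ENNReal.iSup_natCast, min_eq_left le_top]
  rw [lintegral_congr hsup, lintegral_iSup (fun b => hF.min measurable_const)]
  · exact iSup_le key
  · intro a b hab L
    exact min_le_min_left _ (by exact_mod_cast hab)

end Averaging

section RiemannSums

open Filter Topology

lemma volume_preserving_uncurry (ι κ : Type*) [Fintype ι] [Fintype κ] :
    MeasurePreserving (MeasurableEquiv.curry ι κ ℝ).symm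
      (volume : Measure (ι → κ → ℝ)) (volume : Measure (ι × κ → ℝ)) := by
  refine ⟨(MeasurableEquiv.curry ι κ ℝ).symm.measurable, ?_⟩
  refine (Measure.pi_eq fun s _ => ?_).symm
  rw [MeasurableEquiv.map_apply]
  have : (MeasurableEquiv.curry ι κ ℝ).symm ⁻¹' (Set.univ.pi s) =
      Set.univ.pi (fun i => Set.univ.pi fun j => s (i, j)) := by
    ext x
    simp [Set.mem_pi, MeasurableEquiv.coe_curry_symm, Function.uncurry]
  rw [this, volume_pi_pi]
  simp_rw [volume_pi_pi]
  rw [Fintype.prod_prod_type]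

/-- Lattice Riemann sums of a compactly supported continuous function converge to its integral. -/
lemma tendsto_tsum_int_div_pow {κ : Type*} [Fintype κ] {F : (κ → ℝ) → ℝ} (hF : Continuous F)
    (hFc : HasCompactSupport F) :
    Tendsto (fun N : ℕ => (∑' v : κ → ℤ, F ((N : ℝ)⁻¹ • fun k => (v k : ℝ))) /
      (N : ℝ) ^ Fintype.card κ) atTop (𝓝 (∫ x, F x)) := by
  obtain ⟨R, hR⟩ := hFc.isCompact.isBounded.subset_closedBall (0 : κ → ℝ)
  set s := Metric.closedBall (0 : κ → ℝ) R
  have hFs : ∀ x, x ∉ s → F x = 0 := fun x hx => image_eq_zero_of_notMem_tsupport fun h => hx (hR h)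
  have h := tendsto_tsum_div_pow_atTop_integral F (s := s) hF Metric.isBounded_closedBall
    Metric.isClosed_closedBall.measurableSet ((convex_closedBall _ _).addHaar_frontier volume)
  rw [setIntegral_eq_integral_of_forall_compl_eq_zero hFs] at h
  refine h.congr' ?_
  filter_upwards [eventually_ge_atTop 1] with N hN
  congr 1
  have hN0 : (N : ℝ) ≠ 0 := by positivity
  let e : (κ → ℤ) → (κ → ℝ) := fun v => (N : ℝ)⁻¹ • fun k => (v k : ℝ)
  have hinj : Function.Injective e := by
    intro v w hvw
    funext k
    have := congrFun hvw k
    simpa [e, hN0] using this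
  have hrange : Set.range e = (N : ℝ)⁻¹ • ((Submodule.span ℤ (Set.range (Pi.basisFun ℝ κ)) :
      Submodule ℤ (κ → ℝ)) : Set (κ → ℝ)) := by
    ext x
    constructor
    · rintro ⟨v, rfl⟩
      refine Set.smul_mem_smul_set ?_
      rw [SetLike.mem_coe, Module.Basis.mem_span_iff_repr_mem]
      intro i
      exact ⟨v i, by simp⟩
    · rintro ⟨y, hy, rfl⟩
      rw [SetLike.mem_coe, Module.Basis.mem_span_iff_repr_mem] at hy
      choose v hv using hy
      refine ⟨v, ?_⟩
      simp only [e]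
      congr 1
      funext i
      simpa using hv i
  rw [← hrange]
  have h1 : ∑' x : ↑(s ∩ Set.range e), F x = ∑' x : Set.range e, F x := by
    rw [tsum_subtype (s ∩ Set.range e) F, tsum_subtype (Set.range e) F]
    refine tsum_congr fun x => ?_
    by_cases hx : x ∈ s
    · by_cases hx' : x ∈ Set.range e <;> simp [Set.indicator, hx, hx']
    · simp [Set.indicator, hx, hFs x hx]
  rw [h1]
  exact (tsum_range F hinj)

variable {n : ℕ} {ι : Type*} [Fintype ι]

/-- The normalized sum of `G` over the points `v / N`, `v ∈ W`. -/
def riemannSum (W : Set (ι → Fin n → ℤ)) (G : (ι → Fin n → ℝ) → ℝ) (N : ℕ) : ℝ≥0∞ :=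
  ((N : ℝ≥0∞) ^ (Fintype.card ι * n))⁻¹ *
    ∑' v : W, ENNReal.ofReal (G ((N : ℝ)⁻¹ • tupleCast v.1))

lemma finite_setOf_smul_tupleCast_mem {K : Set (ι → Fin n → ℝ)} (hK : Bornology.IsBounded K)
    {N : ℕ} (hN : N ≠ 0) :
    {v : ι → Fin n → ℤ | (N : ℝ)⁻¹ • tupleCast v ∈ K}.Finite := by
  obtain ⟨R, hR⟩ := hK.subset_closedBall (0 : ι → Fin n → ℝ)
  refine (Set.Finite.pi' fun _ : ι => Set.Finite.pi' fun _ : Fin n =>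
    Set.finite_Icc (-⌈R * N⌉) ⌈R * N⌉).subset ?_
  intro v hv
  have hv' := hR hv
  rw [mem_closedBall_zero_iff] at hv'
  have hNpos : (0 : ℝ) < N := by positivity
  have key : ∀ i j, |(v i j : ℝ)| ≤ R * N := by
    intro i j
    have h1 : ‖((N : ℝ)⁻¹ • tupleCast v) i j‖ ≤ R :=
      (norm_le_pi_norm _ j).trans ((norm_le_pi_norm _ i).trans hv')
    simp only [Pi.smul_apply, tupleCast, smul_eq_mul, norm_mul, norm_inv, Real.norm_eq_abs,
      abs_of_pos hNpos] at h1
    rwa [inv_mul_le_iff₀ hNpos, mul_comm] at h1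
  intro i j
  rw [Set.mem_Icc]
  constructor
  · have := (abs_le.1 (key i j)).1
    have h2 : (-(⌈R * N⌉ : ℝ)) ≤ v i j := by linarith [Int.le_ceil (R * N)]
    exact_mod_cast h2
  · have := (abs_le.1 (key i j)).2
    have h2 : (v i j : ℝ) ≤ ⌈R * N⌉ := by linarith [Int.le_ceil (R * N)]
    exact_mod_cast h2

lemma summable_smul_tupleCast {G : (ι → Fin n → ℝ) → ℝ} (hGc : HasCompactSupport G)
    {N : ℕ} (hN : N ≠ 0) :
    Summable fun v : ι → Fin n → ℤ => G ((N : ℝ)⁻¹ • tupleCast v) := by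
  refine summable_of_hasFiniteSupport
    ((finite_setOf_smul_tupleCast_mem hGc.isCompact.isBounded hN).subset ?_)
  intro v hv
  exact subset_tsupport _ hv

lemma tendsto_riemannSum_univ {G : (ι → Fin n → ℝ) → ℝ} (hG : Continuous G)
    (hGc : HasCompactSupport G) (hG0 : ∀ x, 0 ≤ G x) :
    Tendsto (riemannSum Set.univ G) atTop (𝓝 (∫⁻ x, ENNReal.ofReal (G x))) := by
  let e : (ι × Fin n → ℝ) ≃ₜ (ι → Fin n → ℝ) :=
    { toEquiv := Equiv.curry ι (Fin n) ℝ
      continuous_toFun := by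
        refine continuous_pi fun i => continuous_pi fun j => continuous_apply (i, j)
      continuous_invFun := by
        refine continuous_pi fun p => ?_
        exact (continuous_apply p.2).comp (continuous_apply p.1) }
  have h := tendsto_tsum_int_div_pow (F := G ∘ e) (hG.comp e.continuous)
    (hGc.comp_homeomorph e)
  have hint : ∫ x, (G ∘ e) x = ∫ x, G x := by
    have := (volume_preserving_uncurry ι (Fin n)).symm.integral_comp'  (g := G)
    exact this
  rw [hint] at h
  have h2 := ENNReal.tendsto_ofReal h
  rw [ofReal_integral_eq_lintegral_ofReal (hG.integrable_of_hasCompactSupport hGc)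
    (Eventually.of_forall hG0)] at h2
  refine h2.congr' ?_
  filter_upwards [eventually_ge_atTop 1] with N hN
  have hN0 : N ≠ 0 := by omega
  have hNpos : (0 : ℝ) < (N : ℝ) ^ (Fintype.card ι * n) := by positivity
  unfold riemannSum
  rw [tsum_univ (fun v : ι → Fin n → ℤ => ENNReal.ofReal (G ((N : ℝ)⁻¹ • tupleCast v))),
    ← ENNReal.ofReal_tsum_of_nonneg (fun _ => hG0 _) (summable_smul_tupleCast hGc hN0)]
  rw [Fintype.card_prod, Fintype.card_fin, ENNReal.ofReal_div_of_pos hNpos, div_eq_mul_inv,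
    mul_comm]
  congr 1
  · rw [ENNReal.ofReal_pow (by positivity), ENNReal.ofReal_natCast]
  · rw [← (Equiv.curry ι (Fin n) ℤ).tsum_eq]
    rfl

end RiemannSums

section Density

open Filter Topology

variable {n : ℕ} {ι : Type*} [Fintype ι]

/-- The set `W` of integer tuples has upper density at most `c`, in the sense of Riemann sums. -/
def HasUpperDensity (W : Set (ι → Fin n → ℤ)) (c : ℝ≥0∞) : Prop :=
  ∀ G : (ι → Fin n → ℝ) → ℝ, Continuous G → HasCompactSupport G → (∀ x, 0 ≤ G x) →
    limsup (riemannSum W G) atTop ≤ c * ∫⁻ x, ENNReal.ofReal (G x)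

lemma hasUpperDensity_univ : HasUpperDensity (Set.univ : Set (ι → Fin n → ℤ)) 1 := by
  intro G hG hGc hG0
  rw [(tendsto_riemannSum_univ hG hGc hG0).limsup_eq, one_mul]

lemma riemannSum_mono_set {W W' : Set (ι → Fin n → ℤ)} (h : W ⊆ W')
    (G : (ι → Fin n → ℝ) → ℝ) (N : ℕ) : riemannSum W G N ≤ riemannSum W' G N := by
  unfold riemannSum
  gcongr
  exact ENNReal.tsum_mono_subtype
    (fun v : ι → Fin n → ℤ => ENNReal.ofReal (G ((N : ℝ)⁻¹ • tupleCast v))) h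

lemma riemannSum_le_add (W : Set (ι → Fin n → ℤ)) {G H χ : (ι → Fin n → ℝ) → ℝ} {ε : ℝ}
    (hε : 0 ≤ ε) (h : ∀ x, G x ≤ H x + ε * χ x) (N : ℕ) :
    riemannSum W G N ≤ riemannSum W H N + ENNReal.ofReal ε * riemannSum Set.univ χ N := by
  calc riemannSum W G N ≤ riemannSum W H N + ENNReal.ofReal ε * riemannSum W χ N := by
        unfold riemannSum
        rw [mul_left_comm, ← mul_add, ← ENNReal.tsum_mul_left (a := ENNReal.ofReal ε),
          ← ENNReal.tsum_add]
        gcongr with v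
        calc ENNReal.ofReal (G ((N : ℝ)⁻¹ • tupleCast v.1))
            ≤ ENNReal.ofReal (H ((N : ℝ)⁻¹ • tupleCast v.1) +
              ε * χ ((N : ℝ)⁻¹ • tupleCast v.1)) := ENNReal.ofReal_le_ofReal (h _)
          _ ≤ _ := ENNReal.ofReal_add_le
          _ = _ := by rw [ENNReal.ofReal_mul hε]
    _ ≤ _ := by
        gcongr
        exact riemannSum_mono_set (Set.subset_univ _) _ _

lemma ENNReal.le_of_forall_le_add_ofReal_mul {a b d : ℝ≥0∞} (hd : d ≠ ∞)
    (h : ∀ ε : ℝ, 0 < ε → a ≤ b + ENNReal.ofReal ε * d) : a ≤ b := by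
  have : Tendsto (fun ε : ℝ => b + ENNReal.ofReal ε * d) (𝓝[>] 0)
      (𝓝 (b + ENNReal.ofReal 0 * d)) := by
    refine Tendsto.const_add _ (ENNReal.Tendsto.mul_const ?_ (Or.inr hd))
    exact (ENNReal.continuous_ofReal.tendsto 0).mono_left nhdsWithin_le_nhds
  simp only [ENNReal.ofReal_zero, zero_mul, add_zero] at this
  exact ge_of_tendsto this (eventually_mem_nhdsWithin.mono fun ε hε => h ε hε)

lemma lintegral_ofReal_ne_top {χ : (ι → Fin n → ℝ) → ℝ} (hχ : Continuous χ)
    (hχc : HasCompactSupport χ) : ∫⁻ x, ENNReal.ofReal (χ x) ≠ ∞ :=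
  (hχ.integrable_of_hasCompactSupport hχc).lintegral_lt_top.ne

lemma HasUpperDensity.limsup_riemannSum_le {W : Set (ι → Fin n → ℤ)} {c : ℝ≥0∞}
    (hW : HasUpperDensity W c) {H : ℕ → (ι → Fin n → ℝ) → ℝ} {H₀ χ : (ι → Fin n → ℝ) → ℝ}
    (hH₀ : Continuous H₀) (hH₀c : HasCompactSupport H₀) (hH₀0 : ∀ x, 0 ≤ H₀ x)
    (hχ : Continuous χ) (hχc : HasCompactSupport χ) (hχ0 : ∀ x, 0 ≤ χ x)
    (h : ∀ ε : ℝ, 0 < ε → ∀ᶠ N in atTop, ∀ x, H N x ≤ H₀ x + ε * χ x) :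
    limsup (fun N => riemannSum W (H N) N) atTop ≤ c * ∫⁻ x, ENNReal.ofReal (H₀ x) := by
  refine ENNReal.le_of_forall_le_add_ofReal_mul
    (ENNReal.add_ne_top.2 ⟨lintegral_ofReal_ne_top hχ hχc, ENNReal.one_ne_top⟩) fun ε hε => ?_
  have ht := tendsto_riemannSum_univ hχ hχc hχ0
  have ht' := ht.eventually_lt_const
    (ENNReal.lt_add_right (lintegral_ofReal_ne_top hχ hχc) one_ne_zero)
  calc limsup (fun N => riemannSum W (H N) N) atTop
      ≤ limsup (fun N => riemannSum W H₀ N +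
          ENNReal.ofReal ε * ((∫⁻ x, ENNReal.ofReal (χ x)) + 1)) atTop := by
        refine limsup_le_limsup ?_
        filter_upwards [h ε hε, ht'] with N hN hN'
        refine (riemannSum_le_add W hε.le hN N).trans ?_
        gcongr
    _ = limsup (riemannSum W H₀) atTop +
          ENNReal.ofReal ε * ((∫⁻ x, ENNReal.ofReal (χ x)) + 1) :=
        limsup_add_const _ _ _ (by isBoundedDefault) (by isBoundedDefault)
    _ ≤ _ := by
        gcongr
        exact hW H₀ hH₀ hH₀c hH₀0

lemma le_liminf_riemannSum {H : ℕ → (ι → Fin n → ℝ) → ℝ} {H₀ χ : (ι → Fin n → ℝ) → ℝ}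
    (hH₀ : Continuous H₀) (hH₀c : HasCompactSupport H₀) (hH₀0 : ∀ x, 0 ≤ H₀ x)
    (hχ : Continuous χ) (hχc : HasCompactSupport χ) (hχ0 : ∀ x, 0 ≤ χ x)
    (h : ∀ ε : ℝ, 0 < ε → ∀ᶠ N in atTop, ∀ x, H₀ x ≤ H N x + ε * χ x) :
    ∫⁻ x, ENNReal.ofReal (H₀ x) ≤ liminf (fun N => riemannSum Set.univ (H N) N) atTop := by
  refine ENNReal.le_of_forall_le_add_ofReal_mul (lintegral_ofReal_ne_top hχ hχc) fun ε hε => ?_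
  have ht : Tendsto (fun N => ENNReal.ofReal ε * riemannSum Set.univ χ N) atTop
      (𝓝 (ENNReal.ofReal ε * ∫⁻ x, ENNReal.ofReal (χ x))) :=
    ENNReal.Tendsto.const_mul (tendsto_riemannSum_univ hχ hχc hχ0) (Or.inr ENNReal.ofReal_ne_top)
  have hfin : ENNReal.ofReal ε * ∫⁻ x, ENNReal.ofReal (χ x) ≠ ∞ :=
    ENNReal.mul_ne_top ENNReal.ofReal_ne_top (lintegral_ofReal_ne_top hχ hχc)
  have h1 := ENNReal.Tendsto.sub (tendsto_riemannSum_univ hH₀ hH₀c hH₀0) ht (Or.inr hfin)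
  rw [← tsub_le_iff_right, ← h1.liminf_eq]
  refine liminf_le_liminf ((h ε hε).mono fun N hN => ?_)
  rw [tsub_le_iff_right]
  exact riemannSum_le_add Set.univ hε.le hN N

/-- Integer tuples `v` with `∑ pᵢ vᵢ ≡ 0` modulo `M`. -/
def congruenceSet (n : ℕ) (p : ι → ℤ) (M : ℕ) : Set (ι → Fin n → ℤ) :=
  {v | ∀ j, (M : ℤ) ∣ ∑ i, p i * v i j}

lemma isSLZInvariant_univ {ι : Type*} : IsSLZInvariant (Set.univ : Set (ι → Fin n → ℤ)) :=
  fun _ _ _ => trivial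

lemma isSLZInvariant_congruenceSet (p : ι → ℤ) (M : ℕ) :
    IsSLZInvariant (congruenceSet n p M) := by
  intro γ v hv j
  have : ∑ i, p i * (γ.1.mulVec (v i)) j = ∑ k, γ.1 j k * ∑ i, p i * v i k := by
    simp only [Matrix.mulVec, dotProduct, Finset.mul_sum]
    rw [Finset.sum_comm]
    refine Finset.sum_congr rfl fun k _ => Finset.sum_congr rfl fun i _ => by ring
  simp only
  rw [this]
  exact Finset.dvd_sum fun k _ => Dvd.dvd.mul_left (hv k) _

/-- A nonnegative continuous compactly supported function varies little under small shifts. -/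
lemma exists_shift_bound {G : (ι → Fin n → ℝ) → ℝ} (hG : Continuous G)
    (hGc : HasCompactSupport G) :
    ∃ χ : (ι → Fin n → ℝ) → ℝ, Continuous χ ∧ HasCompactSupport χ ∧ (∀ x, 0 ≤ χ x) ∧
      ∀ ε : ℝ, 0 < ε → ∃ δ > 0, ∀ x s, ‖s‖ < δ → G x ≤ G (x + s) + ε * χ x := by
  obtain ⟨χ, hχ1, _, hχc, hχ⟩ := exists_continuous_one_zero_of_isCompact
    (hGc.isCompact.cthickening (r := 1)) isClosed_empty (Set.disjoint_empty _)
  refine ⟨χ, χ.continuous, hχc, fun x => (hχ x).1, fun ε hε => ?_⟩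
  have hu := hG.uniformContinuous_of_tendsto_cocompact (x := 0) hGc.is_zero_at_infty
  obtain ⟨δ, hδ, h⟩ := Metric.uniformContinuous_iff.1 hu ε hε
  refine ⟨min δ 1, by positivity, fun x s hs => ?_⟩
  by_cases hx : x ∈ Metric.cthickening 1 (tsupport G)
  · have := h (a := x) (b := x + s) (by simpa using hs.trans_le (min_le_left _ _))
    rw [hχ1 hx, Real.dist_eq] at *
    simp only [Pi.one_apply, mul_one]
    linarith [(abs_lt.1 this).2]
  · have h1 : G x = 0 := image_eq_zero_of_notMem_tsupport fun h' =>
      hx (Metric.self_subset_cthickening _ h')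
    have h2 : G (x + s) = 0 := image_eq_zero_of_notMem_tsupport fun h' => by
      refine hx (Metric.mem_cthickening_of_dist_le x (x + s) 1 _ h' ?_)
      simpa using (hs.trans_le (min_le_right _ _)).le
    rw [h1, h2, zero_add]
    exact mul_nonneg hε.le (hχ x).1

lemma hasUpperDensity_congruenceSet (p b : ι → ℤ) {M : ℕ} (hM : 0 < M)
    (hb : (M : ℤ) ∣ ∑ i, p i * b i - 1) :
    HasUpperDensity (congruenceSet n p M) (((M : ℝ≥0∞) ^ n)⁻¹) := by
  intro G hG hGc hG0
  set W := congruenceSet n p M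
  have hMn : ((M : ℝ≥0∞) ^ n) ≠ 0 := by positivity
  have hMn' : ((M : ℝ≥0∞) ^ n) ≠ ∞ := by finiteness
  obtain ⟨χ, hχ, hχc, hχ0, hshift⟩ := exists_shift_bound hG hGc
  let t : (Fin n → Fin M) → ι → Fin n → ℤ := fun w i j => b i * (w j : ℕ)
  have hinj : Function.Injective (fun q : (Fin n → Fin M) × W => q.2.1 + t q.1) := by
    rintro ⟨w, v⟩ ⟨w', v'⟩ hq
    have hw : w = w' := by
      funext j
      have h1 : ∑ i, p i * v.1 i j + (∑ i, p i * b i) * (w j : ℕ) =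
          ∑ i, p i * v'.1 i j + (∑ i, p i * b i) * (w' j : ℕ) := by
        rw [Finset.sum_mul, Finset.sum_mul, ← Finset.sum_add_distrib, ← Finset.sum_add_distrib]
        refine Finset.sum_congr rfl fun i _ => ?_
        have := congrFun (congrFun hq i) j
        simp only [Pi.add_apply, t] at this
        linear_combination p i * this
      have h2 : (M : ℤ) ∣ (w j : ℕ) - (w' j : ℕ) := by
        have e : (((w j : ℕ) : ℤ) - (w' j : ℕ)) = ∑ i, p i * v'.1 i j - ∑ i, p i * v.1 i j -
          (∑ i, p i * b i - 1) * ((w j : ℕ) - (w' j : ℕ)) := by linear_combination h1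
        rw [e]
        exact dvd_sub (dvd_sub (v'.2 j) (v.2 j)) (Dvd.dvd.mul_right hb _)
      have h3 : ((w j : ℕ) : ℤ) - (w' j : ℕ) = 0 := by
        refine Int.eq_zero_of_abs_lt_dvd h2 ?_
        have := (w j).2; have := (w' j).2
        rw [abs_lt]; omega
      ext; omega
    subst hw
    simp only [Prod.mk.injEq, true_and]
    exact Subtype.ext (add_right_cancel hq)
  have hsum : ∀ N : ℕ, ∑ w : Fin n → Fin M,
      riemannSum W (fun x => G (x + (N : ℝ)⁻¹ • tupleCast (t w))) N ≤
      riemannSum Set.univ G N := by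
    intro N
    unfold riemannSum
    rw [← Finset.mul_sum]
    gcongr
    rw [← tsum_fintype (L := .unconditional _), ← ENNReal.tsum_prod (f := fun w (v : W) => ENNReal.ofReal
      (G ((N : ℝ)⁻¹ • tupleCast v.1 + (N : ℝ)⁻¹ • tupleCast (t w))))]
    rw [tsum_univ (fun v : ι → Fin n → ℤ => ENNReal.ofReal (G ((N : ℝ)⁻¹ • tupleCast v)))]
    refine le_trans (le_of_eq ?_) (ENNReal.tsum_comp_le_tsum_of_injective hinj _)
    refine tsum_congr fun q => ?_
    rw [← smul_add]
    congr 3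
    funext i j
    simp [tupleCast]
  have main : limsup (fun N => (M : ℝ≥0∞) ^ n * riemannSum W G N) atTop ≤
      ∫⁻ x, ENNReal.ofReal (G x) := by
    refine ENNReal.le_of_forall_le_add_ofReal_mul (d := (M : ℝ≥0∞) ^ n * ∫⁻ x, ENNReal.ofReal (χ x))
      (ENNReal.mul_ne_top hMn' (lintegral_ofReal_ne_top hχ hχc)) fun ε hε => ?_
    have ht : Tendsto (fun N => riemannSum Set.univ G N +
        ENNReal.ofReal ε * ((M : ℝ≥0∞) ^ n * riemannSum Set.univ χ N)) atTop
        (𝓝 ((∫⁻ x, ENNReal.ofReal (G x)) +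
          ENNReal.ofReal ε * ((M : ℝ≥0∞) ^ n * ∫⁻ x, ENNReal.ofReal (χ x)))) := by
      refine (tendsto_riemannSum_univ hG hGc hG0).add
        (ENNReal.Tendsto.const_mul (ENNReal.Tendsto.const_mul
          (tendsto_riemannSum_univ hχ hχc hχ0) (Or.inr hMn')) (Or.inr ENNReal.ofReal_ne_top))
    rw [← ht.limsup_eq]
    refine limsup_le_limsup ?_
    obtain ⟨δ, hδ, hs⟩ := hshift ε hε
    have hsmall : ∀ᶠ N : ℕ in atTop, ∀ w, ‖(N : ℝ)⁻¹ • tupleCast (t w)‖ < δ := by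
      rw [eventually_all]
      intro w
      have : Tendsto (fun N : ℕ => ‖(N : ℝ)⁻¹ • tupleCast (t w)‖) atTop
          (𝓝 ‖(0 : ℝ) • tupleCast (t w)‖) :=
        (tendsto_inv_atTop_nhds_zero_nat.smul_const _).norm
      rw [zero_smul, norm_zero] at this
      exact this.eventually_lt_const hδ
    filter_upwards [hsmall] with N hN
    calc (M : ℝ≥0∞) ^ n * riemannSum W G N = ∑ w : Fin n → Fin M, riemannSum W G N := by simp
      _ ≤ ∑ w : Fin n → Fin M, (riemannSum W (fun x => G (x + (N : ℝ)⁻¹ • tupleCast (t w))) N +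
            ENNReal.ofReal ε * riemannSum Set.univ χ N) :=
          Finset.sum_le_sum fun w _ => riemannSum_le_add W hε.le (fun x => hs x _ (hN w)) N
      _ ≤ _ := by
          rw [Finset.sum_add_distrib]
          gcongr
          · exact hsum N
          · simp only [Finset.sum_const, Finset.card_univ, Fintype.card_pi, Fintype.card_fin,
              Finset.prod_const, nsmul_eq_mul, Nat.cast_pow]
            rw [mul_left_comm]
  rw [ENNReal.limsup_const_mul_of_ne_top hMn'] at main
  exact (ENNReal.mul_le_iff_le_inv hMn hMn').1 main

end Density

section Shear

open Filter Topology

variable {n : ℕ} {ι : Type*} [Fintype ι] [DecidableEq ι]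

lemma lintegral_comp_mulVec {A : Matrix ι ι ℝ} (hA : A.det ≠ 0) {F : (ι → ℝ) → ℝ≥0∞}
    (hF : Measurable F) :
    ∫⁻ θ, F (A.mulVec θ) = ENNReal.ofReal |A.det|⁻¹ * ∫⁻ w, F w := by
  have h := Real.map_matrix_volume_pi_eq_smul_volume_pi hA
  have hm : Measurable (Matrix.toLin' A) := (LinearMap.continuous_of_finiteDimensional _).measurable
  have := lintegral_map (μ := volume) hF hm
  rw [h, lintegral_smul_measure, smul_eq_mul, abs_inv] at this
  exact this.symm

lemma LinearMap.measurePreserving_of_involutive {E : Type*} [NormedAddCommGroup E]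
    [NormedSpace ℝ E] [FiniteDimensional ℝ E] [MeasurableSpace E] [BorelSpace E]
    (ν : Measure E) [ν.IsAddHaarMeasure] {T : E →ₗ[ℝ] E} (hT : ∀ x, T (T x) = x) :
    MeasurePreserving T ν ν := by
  have h1 : LinearMap.det T * LinearMap.det T = 1 := by
    rw [← LinearMap.det_comp, show T ∘ₗ T = LinearMap.id from LinearMap.ext hT, LinearMap.det_id]
  have h2 : |(LinearMap.det T)⁻¹| = 1 := by
    have h3 : |LinearMap.det T| * |LinearMap.det T| = 1 := by rw [← abs_mul, h1, abs_one]
    rw [abs_inv, inv_eq_one]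
    nlinarith [abs_nonneg (LinearMap.det T)]
  refine ⟨(LinearMap.continuous_of_finiteDimensional T).measurable, ?_⟩
  rw [Measure.map_linearMap_addHaar_eq_smul_addHaar ν (by intro h; simp [h] at h1), h2]
  simp

omit [DecidableEq ι] in
lemma volume_preserving_tupleAct (g : SLR n) :
    MeasurePreserving (tupleAct g : (ι → Fin n → ℝ) → ι → Fin n → ℝ) := by
  refine volume_preserving_pi (f := fun _ : ι => fun x : Fin n → ℝ => g.1.mulVec x) fun _ => ?_
  refine ⟨(Continuous.matrix_mulVec continuous_const continuous_id).measurable, ?_⟩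
  have := Real.map_matrix_volume_pi_eq_smul_volume_pi (M := g.1) (by simp)
  rw [g.2, inv_one, abs_one, ENNReal.ofReal_one, one_smul] at this
  exact this

instance : (volume : Measure (ι → Fin n → ℝ)).IsAddHaarMeasure :=
  Measure.pi.isAddHaarMeasure _

/-- The square matrix of the coordinates `σ b` of the vectors `u a`. -/
def minorAt (σ : ι → Fin n) (u : ι → Fin n → ℝ) : Matrix ι ι ℝ := Matrix.of fun a b => u a (σ b)

/-- Replace the `j`-th coordinates of a tuple of vectors. -/
def replaceCoord (j : Fin n) (u : ι → Fin n → ℝ) (w : ι → ℝ) : ι → Fin n → ℝ :=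
  fun a => Function.update (u a) j (w a)

omit [Fintype ι] [DecidableEq ι] in
lemma minorAt_replaceCoord {σ : ι → Fin n} {j : Fin n} (hj : ∀ b, σ b ≠ j)
    (u : ι → Fin n → ℝ) (w : ι → ℝ) : minorAt σ (replaceCoord j u w) = minorAt σ u := by
  ext a b
  simp [minorAt, replaceCoord, hj b]

omit [Fintype ι] [DecidableEq ι] in
lemma continuous_replaceCoord (j : Fin n) :
    Continuous (fun p : (ι → Fin n → ℝ) × (ι → ℝ) => replaceCoord j p.1 p.2) := by
  refine continuous_pi fun a => ?_
  exact Continuous.update (by fun_prop) j (by fun_prop)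

omit [Fintype ι] [DecidableEq ι] in
lemma continuous_minorAt (σ : ι → Fin n) :
    Continuous (minorAt σ : (ι → Fin n → ℝ) → Matrix ι ι ℝ) := by
  refine continuous_matrix fun a b => ?_
  simp only [minorAt, Matrix.of_apply]
  fun_prop

/-- Exchanging the `j`-th coordinates of a tuple with an auxiliary vector. -/
def swapCoord (j : Fin n) :
    ((ι → Fin n → ℝ) × (ι → ℝ)) →ₗ[ℝ] ((ι → Fin n → ℝ) × (ι → ℝ)) where
  toFun p := (replaceCoord j p.1 p.2, fun a => p.1 a j)
  map_add' p q := by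
    ext a i
    · by_cases h : i = j
      · subst h; simp [replaceCoord]
      · simp [replaceCoord, h]
    · simp
  map_smul' c p := by
    ext a i
    · by_cases h : i = j
      · subst h; simp [replaceCoord]
      · simp [replaceCoord, h]
    · simp

omit [Fintype ι] [DecidableEq ι] in
lemma swapCoord_swapCoord (j : Fin n) (p : (ι → Fin n → ℝ) × (ι → ℝ)) :
    swapCoord j (swapCoord j p) = p := by
  ext a i
  · by_cases h : i = j
    · subst h; simp [swapCoord, replaceCoord]
    · simp [swapCoord, replaceCoord, h]
  · simp [swapCoord, replaceCoord]

/-- The integrand of the averaged function `shearAvg`. -/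
def shearKernel (f : (ι → Fin n → ℝ) → ℝ) (ρ : (ι → ℝ) → ℝ) (σ : ι → Fin n) (j : Fin n) (δ : ℝ)
    (u : ι → Fin n → ℝ) (w : ι → ℝ) : ℝ :=
  f (replaceCoord j u w) * ρ ((minorAt σ u)⁻¹.mulVec (δ • w - fun a => u a j)) *
    |(minorAt σ u).det|⁻¹

/-- The average of `f` under random shears in the direction of the `j`-th coordinate followed by
a diagonal stretch, in rescaled coordinates. -/
def shearAvg (f : (ι → Fin n → ℝ) → ℝ) (ρ : (ι → ℝ) → ℝ) (σ : ι → Fin n) (j : Fin n) (δ : ℝ)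
    (u : ι → Fin n → ℝ) : ℝ := ∫ w, shearKernel f ρ σ j δ u w

variable {f : (ι → Fin n → ℝ) → ℝ} {ρ : (ι → ℝ) → ℝ} {σ : ι → Fin n} {j : Fin n}

lemma shearKernel_nonneg (hf0 : ∀ x, 0 ≤ f x) (hρ0 : ∀ θ, 0 ≤ ρ θ) (δ : ℝ) (u w) :
    0 ≤ shearKernel f ρ σ j δ u w :=
  mul_nonneg (mul_nonneg (hf0 _) (hρ0 _)) (by positivity)

lemma continuous_shearKernel (hf : Continuous f) (hρ : Continuous ρ)
    (hfσ : ∀ x ∈ tsupport f, (minorAt σ x).det ≠ 0) (hj : ∀ b, σ b ≠ j) :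
    Continuous (fun q : (ℝ × (ι → Fin n → ℝ)) × (ι → ℝ) =>
      shearKernel f ρ σ j q.1.1 q.1.2 q.2) := by
  have hrep : Continuous (fun q : (ℝ × (ι → Fin n → ℝ)) × (ι → ℝ) =>
      replaceCoord j q.1.2 q.2) :=
    (continuous_replaceCoord j).comp (by fun_prop : Continuous
      fun q : (ℝ × (ι → Fin n → ℝ)) × (ι → ℝ) => (q.1.2, q.2))
  have hmin : Continuous (fun q : (ℝ × (ι → Fin n → ℝ)) × (ι → ℝ) => minorAt σ q.1.2) :=
    (continuous_minorAt σ).comp (by fun_prop)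
  rw [continuous_iff_continuousAt]
  intro q
  by_cases hq : replaceCoord j q.1.2 q.2 ∈ tsupport f
  · have hdet := hfσ _ hq
    rw [minorAt_replaceCoord hj] at hdet
    have hd : ContinuousAt (fun q : (ℝ × (ι → Fin n → ℝ)) × (ι → ℝ) =>
        (minorAt σ q.1.2).det) q := hmin.matrix_det.continuousAt
    simp only [shearKernel, Matrix.inv_def, Ring.inverse_eq_inv']
    refine ((hf.comp hrep).continuousAt.mul (hρ.continuousAt.comp ?_)).mul
      (hd.abs.inv₀ (abs_ne_zero.2 hdet))
    simp only [Matrix.smul_mulVec]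
    refine (hd.inv₀ hdet).smul (Continuous.continuousAt ?_)
    refine Continuous.matrix_mulVec hmin.matrix_adjugate ?_
    fun_prop
  · have hev : ∀ᶠ q' in 𝓝 q, shearKernel f ρ σ j q'.1.1 q'.1.2 q'.2 = 0 := by
      have : ∀ᶠ q' in 𝓝 q, replaceCoord j q'.1.2 q'.2 ∈ (tsupport f)ᶜ :=
        hrep.continuousAt.eventually
          ((isClosed_tsupport f).isOpen_compl.mem_nhds hq)
      filter_upwards [this] with q' hq'
      simp [shearKernel, image_eq_zero_of_notMem_tsupport hq']
    exact (continuousAt_const (y := (0 : ℝ))).congr (hev.mono fun _ h => h.symm)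

lemma shearKernel_eq_zero {δ : ℝ} {u : ι → Fin n → ℝ} {w : ι → ℝ}
    (hw : w ∉ (fun x : ι → Fin n → ℝ => fun a => x a j) '' tsupport f) :
    shearKernel f ρ σ j δ u w = 0 := by
  have : f (replaceCoord j u w) = 0 := image_eq_zero_of_notMem_tsupport fun h =>
    hw ⟨_, h, by simp [replaceCoord]⟩
  simp [shearKernel, this]

omit [Fintype ι] [DecidableEq ι] in
lemma isCompact_coord_image (hfc : HasCompactSupport f) (j : Fin n) :
    IsCompact ((fun x : ι → Fin n → ℝ => fun a => x a j) '' tsupport f) :=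
  hfc.isCompact.image (by fun_prop)

lemma continuous_shearAvg (hf : Continuous f) (hfc : HasCompactSupport f) (hρ : Continuous ρ)
    (hfσ : ∀ x ∈ tsupport f, (minorAt σ x).det ≠ 0) (hj : ∀ b, σ b ≠ j) :
    Continuous (fun q : ℝ × (ι → Fin n → ℝ) => shearAvg f ρ σ j q.1 q.2) := by
  have := continuous_parametric_integral_of_continuous (μ := volume)
    (f := fun (q : ℝ × (ι → Fin n → ℝ)) w => shearKernel f ρ σ j q.1 q.2 w)
    (continuous_shearKernel hf hρ hfσ hj) (isCompact_coord_image hfc j)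
  convert this using 1
  funext q
  exact (setIntegral_eq_integral_of_forall_compl_eq_zero
    fun w hw => shearKernel_eq_zero hw).symm

lemma ofReal_shearAvg (hf : Continuous f) (hfc : HasCompactSupport f) (hf0 : ∀ x, 0 ≤ f x)
    (hρ : Continuous ρ) (hρ0 : ∀ θ, 0 ≤ ρ θ)
    (hfσ : ∀ x ∈ tsupport f, (minorAt σ x).det ≠ 0) (hj : ∀ b, σ b ≠ j) (δ : ℝ)
    (u : ι → Fin n → ℝ) : ENNReal.ofReal (shearAvg f ρ σ j δ u) =
      ∫⁻ w, ENNReal.ofReal (shearKernel f ρ σ j δ u w) := by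
  refine ofReal_integral_eq_lintegral_ofReal ?_
    (Eventually.of_forall fun w => shearKernel_nonneg hf0 hρ0 _ _ _)
  refine Continuous.integrable_of_hasCompactSupport ?_ ?_
  · exact (continuous_shearKernel hf hρ hfσ hj).comp
      (by fun_prop : Continuous fun w : ι → ℝ => ((δ, u), w))
  · exact HasCompactSupport.intro (isCompact_coord_image hfc j) fun w hw => shearKernel_eq_zero hw

lemma exists_shearAvg_eq_zero (hfc : HasCompactSupport f) (hρc : HasCompactSupport ρ)
    (hfσ : ∀ x ∈ tsupport f, (minorAt σ x).det ≠ 0) (hj : ∀ b, σ b ≠ j) :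
    ∃ K : Set (ι → Fin n → ℝ), IsCompact K ∧
      ∀ δ ∈ Set.Icc (0 : ℝ) 1, ∀ u ∉ K, shearAvg f ρ σ j δ u = 0 := by
  obtain ⟨A, hA0, hA⟩ := hfc.isCompact.isBounded.exists_pos_norm_le
  obtain ⟨B, hB0, hB⟩ := hρc.isCompact.isBounded.exists_pos_norm_le
  refine ⟨Metric.closedBall 0 (A + Fintype.card ι * (A * B)), isCompact_closedBall _ _,
    fun δ hδ u hu => ?_⟩
  have : ∀ w, shearKernel f ρ σ j δ u w = 0 := by
    intro w
    by_contra hne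
    apply hu
    have h1 : replaceCoord j u w ∈ tsupport f := by
      by_contra h
      exact hne (by simp [shearKernel, image_eq_zero_of_notMem_tsupport h])
    have h2 : (minorAt σ u)⁻¹.mulVec (δ • w - fun a => u a j) ∈ tsupport ρ := by
      by_contra h
      exact hne (by simp [shearKernel, image_eq_zero_of_notMem_tsupport h])
    have hdet := hfσ _ h1
    rw [minorAt_replaceCoord hj] at hdet
    set θ := (minorAt σ u)⁻¹.mulVec (δ • w - fun a => u a j) with hθ
    have hθ' : (minorAt σ u).mulVec θ = δ • w - fun a => u a j := by
      rw [hθ, Matrix.mulVec_mulVec, Matrix.mul_nonsing_inv _ (Ne.isUnit hdet), Matrix.one_mulVec]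
    have hentry : ∀ a i, |replaceCoord j u w a i| ≤ A := fun a i =>
      ((norm_le_pi_norm (replaceCoord j u w a) i).trans
        (norm_le_pi_norm (replaceCoord j u w) a)).trans (hA _ h1)
    have hcoord : ∀ a i, i ≠ j → |u a i| ≤ A := fun a i hi => by
      simpa [replaceCoord, hi] using hentry a i
    have hw : ∀ a, |w a| ≤ A := fun a => by simpa [replaceCoord] using hentry a j
    have hθB : ∀ b, |θ b| ≤ B := fun b => (norm_le_pi_norm θ b).trans (hB _ h2)
    have hnn : 0 ≤ Fintype.card ι * (A * B) := by positivity
    rw [mem_closedBall_zero_iff, pi_norm_le_iff_of_nonneg (by positivity)]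
    intro a
    rw [pi_norm_le_iff_of_nonneg (by positivity)]
    intro i
    rw [Real.norm_eq_abs]
    by_cases hi : i = j
    · subst hi
      have e := congrFun hθ' a
      simp only [Matrix.mulVec, dotProduct, Pi.sub_apply, Pi.smul_apply, smul_eq_mul] at e
      have hs : |∑ b, minorAt σ u a b * θ b| ≤ Fintype.card ι * (A * B) := by
        refine (Finset.abs_sum_le_sum_abs _ _).trans ?_
        refine (Finset.sum_le_card_nsmul _ _ (A * B) fun b _ => ?_).trans (by simp)
        rw [abs_mul]
        exact mul_le_mul (hcoord a _ (hj b)) (hθB b) (abs_nonneg _) hA0.le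
      have hδw : |δ * w a| ≤ A := by
        rw [abs_mul, abs_of_nonneg hδ.1]
        nlinarith [hw a, abs_nonneg (w a), hδ.1, hδ.2]
      have : u a i = δ * w a - ∑ b, minorAt σ u a b * θ b := by rw [e]; ring
      rw [this]
      exact (abs_sub _ _).trans (add_le_add hδw hs)
    · exact (hcoord a i hi).trans (by linarith)
  simp [shearAvg, this]

lemma lintegral_shearAvg (hf : Continuous f) (hfc : HasCompactSupport f) (hf0 : ∀ x, 0 ≤ f x)
    (hρ : Continuous ρ) (hρ0 : ∀ θ, 0 ≤ ρ θ) (hρ1 : ∫⁻ θ, ENNReal.ofReal (ρ θ) = 1)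
    (hfσ : ∀ x ∈ tsupport f, (minorAt σ x).det ≠ 0) (hj : ∀ b, σ b ≠ j) (δ : ℝ) :
    ∫⁻ u, ENNReal.ofReal (shearAvg f ρ σ j δ u) = ∫⁻ x, ENNReal.ofReal (f x) := by
  have hk : Continuous (fun p : (ι → Fin n → ℝ) × (ι → ℝ) => shearKernel f ρ σ j δ p.1 p.2) :=
    (continuous_shearKernel hf hρ hfσ hj).comp
      (by fun_prop : Continuous fun p : (ι → Fin n → ℝ) × (ι → ℝ) => ((δ, p.1), p.2))
  have hkm : Measurable (fun p : (ι → Fin n → ℝ) × (ι → ℝ) =>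
      ENNReal.ofReal (shearKernel f ρ σ j δ p.1 p.2)) := hk.measurable.ennreal_ofReal
  have := Measure.prod.instIsAddHaarMeasure (volume : Measure (ι → Fin n → ℝ))
    (volume : Measure (ι → ℝ))
  have hswap : MeasurePreserving (swapCoord j : (ι → Fin n → ℝ) × (ι → ℝ) →ₗ[ℝ] _)
      (volume.prod volume) (volume.prod volume) :=
    LinearMap.measurePreserving_of_involutive _ (swapCoord_swapCoord j)
  simp_rw [ofReal_shearAvg hf hfc hf0 hρ hρ0 hfσ hj]
  rw [← lintegral_prod (μ := volume) (ν := volume) _ hkm.aemeasurable,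
    ← hswap.lintegral_comp hkm,
    lintegral_prod (fun p => ENNReal.ofReal (shearKernel f ρ σ j δ (swapCoord j p).1
      (swapCoord j p).2)) (hkm.comp hswap.measurable).aemeasurable]
  refine lintegral_congr fun u => ?_
  have e : ∀ w, shearKernel f ρ σ j δ (swapCoord j (u, w)).1 (swapCoord j (u, w)).2 =
      f u * |(minorAt σ u).det|⁻¹ *
        ρ ((minorAt σ u)⁻¹.mulVec ((δ • fun a => u a j) - w)) := by
    intro w
    have h1 := congrArg Prod.fst (swapCoord_swapCoord j (u, w))
    have h2 : (fun a => (swapCoord j (u, w)).1 a j) = w :=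
      congrArg Prod.snd (swapCoord_swapCoord j (u, w))
    have h3 : minorAt σ (swapCoord j (u, w)).1 = minorAt σ u := minorAt_replaceCoord hj u w
    simp only [shearKernel]
    rw [h2, h3, show replaceCoord j (swapCoord j (u, w)).1 (swapCoord j (u, w)).2 = u from h1]
    simp only [swapCoord, LinearMap.coe_mk, AddHom.coe_mk]
    ring
  simp_rw [e]
  by_cases hdet : (minorAt σ u).det = 0
  · have : f u = 0 := image_eq_zero_of_notMem_tsupport fun h => hfσ _ h hdet
    simp [this]
  have hρm : Measurable fun θ => ENNReal.ofReal (ρ θ) := hρ.measurable.ennreal_ofReal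
  have hinv : ((minorAt σ u)⁻¹).det ≠ 0 := by
    rw [Matrix.det_nonsing_inv, Ring.inverse_eq_inv']; exact inv_ne_zero hdet
  have hcomp : Continuous fun w => (minorAt σ u)⁻¹.mulVec w :=
    Continuous.matrix_mulVec continuous_const continuous_id
  have h0 : 0 ≤ f u * |(minorAt σ u).det|⁻¹ := mul_nonneg (hf0 u) (by positivity)
  simp_rw [ENNReal.ofReal_mul h0]
  rw [lintegral_const_mul' _ _ ENNReal.ofReal_ne_top,
    lintegral_sub_left_eq_self
      (fun w => ENNReal.ofReal (ρ ((minorAt σ u)⁻¹.mulVec w))) (δ • fun a => u a j),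
    lintegral_comp_mulVec hinv hρm, hρ1, mul_one, ← ENNReal.ofReal_mul h0,
    Matrix.det_nonsing_inv, Ring.inverse_eq_inv', abs_inv, inv_inv, mul_assoc,
    inv_mul_cancel₀ (abs_ne_zero.2 hdet), mul_one]

end Shear

section ShearAverage

open Filter Topology

variable {n : ℕ} {ι : Type*} [Fintype ι] [DecidableEq ι]

omit [Fintype ι] [DecidableEq ι] in
lemma tupleAct_one (x : ι → Fin n → ℝ) : tupleAct 1 x = x := by
  funext i
  simp [tupleAct]

/-- The matrix which contracts all coordinates but the `j`-th one by `m` and sends the `j`-th one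
to `m ^ (n - 1)` times its shear by `θ`. -/
def shearMatrix (σ : ι → Fin n) (j : Fin n) (m : ℕ) (θ : ι → ℝ) : Matrix (Fin n) (Fin n) ℝ :=
  Matrix.diagonal (fun i => if i = j then (m : ℝ) ^ (n - 1) else (m : ℝ)⁻¹) *
    (1 + Matrix.replicateCol Unit (Pi.single j 1 : Fin n → ℝ) *
      Matrix.replicateRow Unit (∑ b, θ b • (Pi.single (σ b) 1 : Fin n → ℝ)))

omit [DecidableEq ι] in
lemma det_shearMatrix {σ : ι → Fin n} {j : Fin n} (hj : ∀ b, σ b ≠ j) {m : ℕ} (hm : m ≠ 0)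
    (θ : ι → ℝ) : (shearMatrix σ j m θ).det = 1 := by
  have hm' : (m : ℝ) ≠ 0 := by exact_mod_cast hm
  rw [shearMatrix, Matrix.det_mul, Matrix.det_one_add_replicateCol_mul_replicateRow,
    Matrix.det_diagonal]
  have h1 : (∑ b, θ b • (Pi.single (σ b) 1 : Fin n → ℝ)) ⬝ᵥ Pi.single j 1 = 0 := by
    simp [fun b => (hj b).symm]
  rw [h1, add_zero, mul_one, Finset.prod_ite, Finset.prod_const, Finset.prod_const]
  have c1 : (Finset.univ.filter fun i : Fin n => i = j).card = 1 := by
    rw [Finset.filter_eq' Finset.univ j]; simp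
  have c2 : (Finset.univ.filter fun i : Fin n => ¬ i = j).card = n - 1 := by
    rw [Finset.filter_ne' Finset.univ j]; simp
  rw [c1, c2, pow_one, ← mul_pow, mul_inv_cancel₀ hm', one_pow]

/-- The matrix `shearMatrix` as an element of `SL(n, ℝ)`; the parameter `0` is replaced by `1`. -/
def shearSL (σ : ι → Fin n) (j : Fin n) (hj : ∀ b, σ b ≠ j) (N : ℕ) (θ : ι → ℝ) : SLR n :=
  ⟨shearMatrix σ j (max N 1) θ, det_shearMatrix hj (by positivity) θ⟩

omit [DecidableEq ι] in
lemma continuous_shearSL (σ : ι → Fin n) (j : Fin n) (hj : ∀ b, σ b ≠ j) (N : ℕ) :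
    Continuous (shearSL σ j hj N) := by
  rw [SLR.isClosedEmbedding_val.isInducing.continuous_iff]
  change Continuous (shearMatrix σ j (max N 1))
  unfold shearMatrix
  refine continuous_const.matrix_mul (continuous_const.add (continuous_const.matrix_mul ?_))
  refine continuous_matrix fun a b => ?_
  simp only [Matrix.replicateRow_apply, Finset.sum_apply, Pi.smul_apply]
  fun_prop

omit [DecidableEq ι] in
lemma tupleAct_shearSL (σ : ι → Fin n) (j : Fin n) (hj : ∀ b, σ b ≠ j) {N : ℕ} (hN : 1 ≤ N)
    (θ : ι → ℝ) (x : ι → Fin n → ℝ) :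
    tupleAct (shearSL σ j hj N θ) x = replaceCoord j ((N : ℝ)⁻¹ • x)
      (((N : ℝ) ^ n • minorAt σ ((N : ℝ)⁻¹ • x)).mulVec θ +
        (N : ℝ) ^ n • fun a => ((N : ℝ)⁻¹ • x) a j) := by
  have hN' : (N : ℝ) ≠ 0 := by positivity
  have hn : n ≠ 0 := fun h => by subst h; exact j.elim0
  have hpow : (N : ℝ) ^ (n - 1) = (N : ℝ) ^ n * (N : ℝ)⁻¹ := by
    rw [← Nat.sub_one_add_one hn, pow_succ, Nat.add_sub_cancel, mul_inv_cancel_right₀ hN']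
  funext a i
  have hmax : max N 1 = N := max_eq_left hN
  simp only [tupleAct, shearSL, shearMatrix, hmax, ← Matrix.mulVec_mulVec, Matrix.add_mulVec,
    Matrix.one_mulVec, Matrix.mulVec_diagonal]
  have h1 : ((Matrix.replicateRow Unit (∑ b, θ b • (Pi.single (σ b) 1 : Fin n → ℝ))).mulVec (x a))
      = fun _ => ∑ b, θ b * x a (σ b) := by
    funext u
    simp only [Matrix.mulVec, Matrix.replicateRow, Matrix.of_apply, sum_dotProduct,
      smul_dotProduct, single_dotProduct, one_mul, smul_eq_mul]
  rw [h1]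
  by_cases hi : i = j
  · subst hi
    simp [replaceCoord, Matrix.mulVec, dotProduct, minorAt, hpow, Matrix.replicateCol,
      Finset.mul_sum, mul_add]
    rw [add_comm]
    congr 1
    · refine Finset.sum_congr rfl fun b _ => by ring
    · ring
  · simp [replaceCoord, hi, Matrix.mulVec, dotProduct, Matrix.replicateCol]

variable {f : (ι → Fin n → ℝ) → ℝ} {ρ : (ι → ℝ) → ℝ} {σ : ι → Fin n} {j : Fin n}

lemma lintegral_shearSL (hf : Continuous f) (hfc : HasCompactSupport f) (hf0 : ∀ x, 0 ≤ f x)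
    (hρ : Continuous ρ) (hρ0 : ∀ θ, 0 ≤ ρ θ)
    (hfσ : ∀ x ∈ tsupport f, (minorAt σ x).det ≠ 0) (hj : ∀ b, σ b ≠ j) {N : ℕ} (hN : 1 ≤ N)
    (x : ι → Fin n → ℝ) :
    ∫⁻ θ, ENNReal.ofReal (f (tupleAct (shearSL σ j hj N θ) x)) * ENNReal.ofReal (ρ θ) =
      ((N : ℝ≥0∞) ^ (Fintype.card ι * n))⁻¹ *
        ENNReal.ofReal (shearAvg f ρ σ j ((N : ℝ) ^ n)⁻¹ ((N : ℝ)⁻¹ • x)) := by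
  have hN' : (N : ℝ) ≠ 0 := by positivity
  simp_rw [tupleAct_shearSL σ j hj hN, ofReal_shearAvg hf hfc hf0 hρ hρ0 hfσ hj]
  set u := (N : ℝ)⁻¹ • x
  by_cases hdet : (minorAt σ u).det = 0
  · have : ∀ w, f (replaceCoord j u w) = 0 := fun w =>
      image_eq_zero_of_notMem_tsupport fun h => hfσ _ h (by rwa [minorAt_replaceCoord hj])
    simp [this, shearKernel]
  let A := (N : ℝ) ^ n • minorAt σ u
  let c : ι → ℝ := (N : ℝ) ^ n • fun a => u a j
  have hA : A.det = (N : ℝ) ^ (Fintype.card ι * n) * (minorAt σ u).det := by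
    rw [Matrix.det_smul, ← pow_mul, mul_comm n]
  let F : (ι → ℝ) → ℝ≥0∞ := fun w => ENNReal.ofReal (f (replaceCoord j u w) *
    ρ ((minorAt σ u)⁻¹.mulVec (((N : ℝ) ^ n)⁻¹ • w - fun a => u a j)))
  have hF : Continuous F := by
    refine ENNReal.continuous_ofReal.comp (Continuous.mul ?_ ?_)
    · exact hf.comp ((continuous_replaceCoord j).comp (by fun_prop :
        Continuous fun w : ι → ℝ => (u, w)))
    · exact hρ.comp (Continuous.matrix_mulVec continuous_const (by fun_prop))
  have h1 : ∀ θ, ENNReal.ofReal (f (replaceCoord j u (A.mulVec θ + c))) * ENNReal.ofReal (ρ θ) =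
      F (A.mulVec θ + c) := by
    intro θ
    have e : (minorAt σ u)⁻¹.mulVec (((N : ℝ) ^ n)⁻¹ • (A.mulVec θ + c) - fun a => u a j) = θ := by
      have hp : ((N : ℝ) ^ n) ≠ 0 := by positivity
      simp only [A, c, smul_add, Matrix.smul_mulVec, inv_smul_smul₀ hp, add_sub_cancel_right]
      rw [Matrix.mulVec_mulVec, Matrix.nonsing_inv_mul _ (Ne.isUnit hdet), Matrix.one_mulVec]
    simp only [F]
    rw [e, ENNReal.ofReal_mul (hf0 _)]
  have hA0 : A.det ≠ 0 := by rw [hA]; positivity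
  change ∫⁻ θ, ENNReal.ofReal (f (replaceCoord j u (A.mulVec θ + c))) * ENNReal.ofReal (ρ θ) = _
  simp_rw [h1]
  rw [lintegral_comp_mulVec hA0 (F := fun w => F (w + c)) (hF.measurable.comp (by fun_prop)),
    lintegral_add_right_eq_self F c, hA, abs_mul, mul_inv, ENNReal.ofReal_mul (by positivity),
    mul_assoc]
  congr 1
  · rw [abs_of_nonneg (by positivity), ENNReal.ofReal_inv_of_pos (by positivity),
      ENNReal.ofReal_pow (by positivity), ENNReal.ofReal_natCast]
  · simp only [shearKernel, ENNReal.ofReal_mul' (inv_nonneg.2 (abs_nonneg (minorAt σ u).det))]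
    rw [lintegral_mul_const _ hF.measurable, mul_comm]

lemma lintegral_siegel_shearSL (hf : Continuous f) (hfc : HasCompactSupport f)
    (hf0 : ∀ x, 0 ≤ f x) (hρ : Continuous ρ) (hρ0 : ∀ θ, 0 ≤ ρ θ)
    (hfσ : ∀ x ∈ tsupport f, (minorAt σ x).det ≠ 0) (hj : ∀ b, σ b ≠ j) {N : ℕ} (hN : 1 ≤ N)
    {W : Set (ι → Fin n → ℤ)} (hW : IsSLZInvariant W) (g : SLR n) :
    ∫⁻ θ, siegel W (fun x => ENNReal.ofReal (f x)) (shearSL σ j hj N θ • latMk g)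
        ∂(volume.withDensity fun θ => ENNReal.ofReal (ρ θ)) =
      riemannSum W (fun u => shearAvg f ρ σ j ((N : ℝ) ^ n)⁻¹ (tupleAct g u)) N := by
  have hm : ∀ x : ι → Fin n → ℝ,
      Measurable fun θ => ENNReal.ofReal (f (tupleAct (shearSL σ j hj N θ) x)) := fun x =>
    (hf.comp ((continuous_tupleAct_left x).comp
      (continuous_shearSL σ j hj N))).measurable.ennreal_ofReal
  simp_rw [siegel_smul hW, siegel_latMk hW, latSum]
  rw [lintegral_tsum fun v => (hm _).aemeasurable, riemannSum, ← ENNReal.tsum_mul_left]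
  refine tsum_congr fun v => ?_
  rw [lintegral_withDensity_eq_lintegral_mul _ hρ.measurable.ennreal_ofReal (hm _)]
  have := lintegral_shearSL hf hfc hf0 hρ hρ0 hfσ hj hN (tupleAct g (tupleCast v.1))
  simp only [Pi.mul_apply]
  simp_rw [mul_comm (ENNReal.ofReal (ρ _))]
  rw [this]
  congr 4
  funext a
  simp [tupleAct, Matrix.mulVec_smul]

omit [DecidableEq ι] in
lemma exists_prob_density : ∃ ρ : (ι → ℝ) → ℝ, Continuous ρ ∧ HasCompactSupport ρ ∧
    (∀ θ, 0 ≤ ρ θ) ∧ ∫⁻ θ, ENNReal.ofReal (ρ θ) = 1 := by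
  let φ : ContDiffBump (0 : ι → ℝ) := default
  refine ⟨φ.normed volume, φ.continuous_normed, φ.hasCompactSupport_normed, φ.nonneg_normed, ?_⟩
  rw [← ofReal_integral_eq_lintegral_ofReal φ.integrable_normed
    (Eventually.of_forall φ.nonneg_normed), φ.integral_normed, ENNReal.ofReal_one]

/-- The averaged functions converge uniformly, with a common compact support. -/
lemma exists_dominating (hf : Continuous f) (hfc : HasCompactSupport f)
    (hρ : Continuous ρ) (hρc : HasCompactSupport ρ)
    (hfσ : ∀ x ∈ tsupport f, (minorAt σ x).det ≠ 0) (hj : ∀ b, σ b ≠ j) (g : SLR n) :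
    HasCompactSupport (fun u => shearAvg f ρ σ j 0 (tupleAct g u)) ∧
    ∃ χ : (ι → Fin n → ℝ) → ℝ, Continuous χ ∧ HasCompactSupport χ ∧ (∀ x, 0 ≤ χ x) ∧
      ∀ ε : ℝ, 0 < ε → ∀ᶠ N : ℕ in atTop, ∀ u,
        |shearAvg f ρ σ j ((N : ℝ) ^ n)⁻¹ (tupleAct g u) - shearAvg f ρ σ j 0 (tupleAct g u)|
          ≤ ε * χ u := by
  obtain ⟨K, hK, hKz⟩ := exists_shearAvg_eq_zero hfc hρc hfσ hj
  have hcont := continuous_shearAvg hf hfc hρ hfσ hj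
  have hK' : IsCompact (tupleAct g⁻¹ '' K) := hK.image (continuous_tupleAct_right _)
  have hmem : ∀ u, u ∉ tupleAct g⁻¹ '' K → tupleAct g u ∉ K := fun u hu h =>
    hu ⟨_, h, by rw [← tupleAct_mul, inv_mul_cancel, tupleAct_one]⟩
  refine ⟨HasCompactSupport.intro hK' fun u hu => hKz 0 ⟨le_rfl, zero_le_one⟩ _ (hmem u hu), ?_⟩
  obtain ⟨χ, hχ1, _, hχc, hχ⟩ := exists_continuous_one_zero_of_isCompact hK'
    isClosed_empty (Set.disjoint_empty _)
  refine ⟨χ, χ.continuous, hχc, fun x => (hχ x).1, fun ε hε => ?_⟩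
  have huc := (isCompact_Icc (a := (0 : ℝ)) (b := 1)).prod hK
    |>.uniformContinuousOn_of_continuous hcont.continuousOn
  obtain ⟨δ, hδ, h⟩ := Metric.uniformContinuousOn_iff.1 huc ε hε
  have hn : n ≠ 0 := fun h => by subst h; exact j.elim0
  have hlim : Tendsto (fun N : ℕ => ((N : ℝ) ^ n)⁻¹) atTop (𝓝 0) :=
    ((tendsto_pow_atTop hn).comp tendsto_natCast_atTop_atTop).inv_tendsto_atTop
  filter_upwards [hlim.eventually_lt_const hδ, hlim.eventually_lt_const one_pos] with N hN hN1 u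
  have hN0 : 0 ≤ ((N : ℝ) ^ n)⁻¹ := by positivity
  by_cases hu : u ∈ tupleAct g⁻¹ '' K
  · have huK : tupleAct g u ∈ K := by
      obtain ⟨x, hx, rfl⟩ := hu
      rwa [← tupleAct_mul, mul_inv_cancel, tupleAct_one]
    rw [hχ1 hu, Pi.one_apply, mul_one]
    refine (h (((N : ℝ) ^ n)⁻¹, tupleAct g u) ⟨⟨hN0, hN1.le⟩, huK⟩ (0, tupleAct g u)
      ⟨⟨le_rfl, zero_le_one⟩, huK⟩ ?_).le
    rw [Prod.dist_eq, dist_self, Real.dist_eq, sub_zero, abs_of_nonneg hN0]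
    exact max_lt hN hδ
  · rw [hKz _ ⟨hN0, hN1.le⟩ _ (hmem u hu), hKz 0 ⟨le_rfl, zero_le_one⟩ _ (hmem u hu), sub_zero,
      abs_zero]
    exact mul_nonneg hε.le (hχ u).1

/-- The mean value inequality for Siegel transforms of continuous functions supported on tuples
with a nonvanishing minor. -/
theorem lintegral_siegel_le_of_continuous {μ : Measure (LatticeSpace n)} [IsProbabilityMeasure μ]
    (hμ : ∀ g : SLR n, Measure.map (fun x => g • x) μ = μ)
    (hf : Continuous f) (hfc : HasCompactSupport f) (hf0 : ∀ x, 0 ≤ f x)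
    (hfσ : ∀ x ∈ tsupport f, (minorAt σ x).det ≠ 0) (hj : ∀ b, σ b ≠ j)
    {W : Set (ι → Fin n → ℤ)} (hW : IsSLZInvariant W) {c : ℝ≥0∞} (hWc : HasUpperDensity W c) :
    ∫⁻ L, siegel W (fun x => ENNReal.ofReal (f x)) L ∂μ ≤ c * ∫⁻ x, ENNReal.ofReal (f x) := by
  obtain ⟨ρ, hρ, hρc, hρ0, hρ1⟩ := exists_prob_density (ι := ι)
  have : IsProbabilityMeasure (volume.withDensity fun θ => ENNReal.ofReal (ρ θ)) :=
    ⟨by simpa using hρ1⟩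
  refine lintegral_le_of_limsup_average_le hμ (volume.withDensity fun θ => ENNReal.ofReal (ρ θ))
    (measurable_siegel hW hf.measurable.ennreal_ofReal) (continuous_shearSL σ j hj) fun L => ?_
  obtain ⟨g, rfl⟩ := latMk_surjective L
  obtain ⟨hc0, χ, hχ, hχc, hχ0, hdom⟩ := exists_dominating hf hfc hρ hρc hfσ hj g
  have hcont : Continuous fun u => shearAvg f ρ σ j 0 (tupleAct g u) :=
    (continuous_shearAvg hf hfc hρ hfσ hj).comp
      (continuous_const.prodMk (continuous_tupleAct_right g))
  have hnn : ∀ u, 0 ≤ shearAvg f ρ σ j 0 u := fun u =>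
    integral_nonneg fun w => shearKernel_nonneg hf0 hρ0 _ _ _
  have key := hWc.limsup_riemannSum_le
    (H := fun N u => shearAvg f ρ σ j ((N : ℝ) ^ n)⁻¹ (tupleAct g u))
    hcont hc0 (fun u => hnn _) hχ hχc hχ0
    fun ε hε => (hdom ε hε).mono fun N hN u => by linarith [(abs_le.1 (hN u)).2]
  rw [(volume_preserving_tupleAct g).lintegral_comp
    (f := fun u => ENNReal.ofReal (shearAvg f ρ σ j 0 u))
    ((continuous_shearAvg hf hfc hρ hfσ hj).comp
      (by fun_prop : Continuous fun u : ι → Fin n → ℝ => ((0 : ℝ), u))).measurable.ennreal_ofReal,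
    lintegral_shearAvg hf hfc hf0 hρ hρ0 hρ1 hfσ hj] at key
  refine le_trans (limsup_le_limsup ?_) key
  filter_upwards [eventually_ge_atTop 1] with N hN
  exact (lintegral_siegel_shearSL hf hfc hf0 hρ hρ0 hfσ hj hN hW g).le

theorem le_lintegral_siegel_of_continuous {μ : Measure (LatticeSpace n)} [IsProbabilityMeasure μ]
    (hμ : ∀ g : SLR n, Measure.map (fun x => g • x) μ = μ)
    (hf : Continuous f) (hfc : HasCompactSupport f) (hf0 : ∀ x, 0 ≤ f x)
    (hfσ : ∀ x ∈ tsupport f, (minorAt σ x).det ≠ 0) (hj : ∀ b, σ b ≠ j) :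
    ∫⁻ x, ENNReal.ofReal (f x) ≤
      ∫⁻ L, siegel Set.univ (fun x => ENNReal.ofReal (f x)) L ∂μ := by
  obtain ⟨ρ, hρ, hρc, hρ0, hρ1⟩ := exists_prob_density (ι := ι)
  have : IsProbabilityMeasure (volume.withDensity fun θ => ENNReal.ofReal (ρ θ)) :=
    ⟨by simpa using hρ1⟩
  refine le_lintegral_of_le_liminf_average hμ (volume.withDensity fun θ => ENNReal.ofReal (ρ θ))
    (measurable_siegel isSLZInvariant_univ hf.measurable.ennreal_ofReal)
    (continuous_shearSL σ j hj) fun L => ?_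
  obtain ⟨g, rfl⟩ := latMk_surjective L
  obtain ⟨hc0, χ, hχ, hχc, hχ0, hdom⟩ := exists_dominating hf hfc hρ hρc hfσ hj g
  have hcont : Continuous fun u => shearAvg f ρ σ j 0 (tupleAct g u) :=
    (continuous_shearAvg hf hfc hρ hfσ hj).comp
      (continuous_const.prodMk (continuous_tupleAct_right g))
  have hnn : ∀ u, 0 ≤ shearAvg f ρ σ j 0 u := fun u =>
    integral_nonneg fun w => shearKernel_nonneg hf0 hρ0 _ _ _
  have key := le_liminf_riemannSum
    (H := fun N u => shearAvg f ρ σ j ((N : ℝ) ^ n)⁻¹ (tupleAct g u))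
    hcont hc0 (fun u => hnn _) hχ hχc hχ0
    fun ε hε => (hdom ε hε).mono fun N hN u => by linarith [(abs_le.1 (hN u)).1]
  rw [(volume_preserving_tupleAct g).lintegral_comp
    (f := fun u => ENNReal.ofReal (shearAvg f ρ σ j 0 u))
    ((continuous_shearAvg hf hfc hρ hfσ hj).comp
      (by fun_prop : Continuous fun u : ι → Fin n → ℝ => ((0 : ℝ), u))).measurable.ennreal_ofReal,
    lintegral_shearAvg hf hfc hf0 hρ hρ0 hρ1 hfσ hj] at key
  refine key.trans (liminf_le_liminf ?_)
  filter_upwards [eventually_ge_atTop 1] with N hN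
  exact (lintegral_siegel_shearSL hf hfc hf0 hρ hρ0 hfσ hj hN isSLZInvariant_univ g).ge

end ShearAverage

section Comparison

open Filter Topology

variable {E : Type*} [MetricSpace E] [ProperSpace E] [MeasurableSpace E] [BorelSpace E]
  {μ₁ μ₂ : Measure E} {O : Set E}

lemma measure_le_of_lintegral_le (hO : ∀ f : E → ℝ, Continuous f → HasCompactSupport f →
      (∀ x, 0 ≤ f x) → tsupport f ⊆ O →
      ∫⁻ x, ENNReal.ofReal (f x) ∂μ₁ ≤ ∫⁻ x, ENNReal.ofReal (f x) ∂μ₂)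
    {U : Set E} (hU : IsOpen U) (hUO : U ⊆ O) : μ₁ U ≤ μ₂ U := by
  have hcompact : ∀ K ⊆ U, IsCompact K → μ₁ K ≤ μ₂ U := by
    intro K hKU hK
    obtain ⟨V, hV, hKV, hVU, hVc⟩ := exists_open_between_and_isCompact_closure hK hU hKU
    obtain ⟨χ, hχ1, hχ0, hχc, hχ⟩ := exists_continuous_one_zero_of_isCompact hK
      hV.isClosed_compl (Set.disjoint_compl_right_iff_subset.2 hKV)
    have hsupp : Function.support χ ⊆ V := fun x hx => by
      by_contra h
      exact hx (hχ0 h)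
    have hts : tsupport χ ⊆ U := (closure_mono hsupp).trans hVU
    calc μ₁ K = ∫⁻ x, K.indicator 1 x ∂μ₁ := (lintegral_indicator_one hK.measurableSet).symm
      _ ≤ ∫⁻ x, ENNReal.ofReal (χ x) ∂μ₁ := by
          refine lintegral_mono fun x => ?_
          refine Set.indicator_le' (fun x hx => ?_) (fun x _ => (zero_le : 0 ≤ ENNReal.ofReal (χ x))) x
          rw [hχ1 hx]; simp
      _ ≤ ∫⁻ x, ENNReal.ofReal (χ x) ∂μ₂ :=
          hO χ χ.continuous hχc (fun x => (hχ x).1) (hts.trans hUO)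
      _ ≤ ∫⁻ x, U.indicator 1 x ∂μ₂ := by
          refine lintegral_mono fun x => ?_
          refine Set.le_indicator (g := (1 : E → ℝ≥0∞)) (f := fun x => ENNReal.ofReal (χ x))
            (fun x hx => ?_) (fun x hx => ?_) x
          · simpa using ENNReal.ofReal_le_ofReal (hχ x).2
          · have : χ x = 0 := image_eq_zero_of_notMem_tsupport fun h => hx (hts h)
            simp [this]
      _ = μ₂ U := lintegral_indicator_one hU.measurableSet
  obtain ⟨F, hF, -, hFU, hFm⟩ := hU.exists_iUnion_isClosed
  rcases isEmpty_or_nonempty E with hE | ⟨⟨x₀⟩⟩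
  · simp [Set.eq_empty_of_isEmpty U]
  have hmono : Monotone fun k : ℕ => F k ∩ Metric.closedBall x₀ k := fun a b hab =>
    Set.inter_subset_inter (hFm hab) (Metric.closedBall_subset_closedBall (by exact_mod_cast hab))
  have hun : ⋃ k : ℕ, F k ∩ Metric.closedBall x₀ k = U := by
    ext x
    rw [← hFU]
    simp only [Set.mem_iUnion, Set.mem_inter_iff]
    refine ⟨fun ⟨k, h, _⟩ => ⟨k, h⟩, fun ⟨k, h⟩ => ?_⟩
    obtain ⟨l, hl⟩ := exists_nat_ge (dist x x₀)
    exact ⟨max k l, hFm (le_max_left k l) h,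
      hl.trans (by exact_mod_cast le_max_right k l)⟩
  rw [← hun, hmono.measure_iUnion, hun]
  refine iSup_le fun k => hcompact _ ?_ ((isCompact_closedBall x₀ k).inter_left (hF k))
  rw [← hun]
  exact Set.subset_iUnion (fun k : ℕ => F k ∩ Metric.closedBall x₀ k) k

omit [ProperSpace E] [BorelSpace E] in
lemma measure_le_of_isOpen_le [μ₂.OuterRegular] (hO : IsOpen O)
    (h : ∀ U ⊆ O, IsOpen U → μ₁ U ≤ μ₂ U) {B : Set E} (hB : B ⊆ O) : μ₁ B ≤ μ₂ B := by
  rw [B.measure_eq_iInf_isOpen μ₂]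
  refine le_iInf₂ fun U hBU => le_iInf fun hU => ?_
  calc μ₁ B ≤ μ₁ (U ∩ O) := measure_mono (Set.subset_inter hBU hB)
    _ ≤ μ₂ (U ∩ O) := h _ Set.inter_subset_right (hU.inter hO)
    _ ≤ μ₂ U := measure_mono Set.inter_subset_left

lemma le_measure_of_isOpen_le [μ₂.OuterRegular] [IsLocallyFiniteMeasure μ₂] (hO : IsOpen O)
    (h : ∀ U ⊆ O, IsOpen U → μ₂ U ≤ μ₁ U)
    (h' : ∀ B ⊆ O, μ₁ B ≤ μ₂ B) {B : Set E} (hBm : MeasurableSet B) (hB : B ⊆ O) :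
    μ₂ B ≤ μ₁ B := by
  have hfin : ∀ B ⊆ O, MeasurableSet B → μ₂ B ≠ ∞ → μ₂ B ≤ μ₁ B := by
    intro B hB hBm hBf
    obtain ⟨U, hBU, hU, hUf⟩ := B.exists_isOpen_lt_of_lt (μ := μ₂) ∞ hBf.lt_top
    have hle := h (U ∩ O) Set.inter_subset_right (hU.inter hO)
    have hBUO : B ⊆ U ∩ O := Set.subset_inter hBU hB
    have e1 := measure_inter_add_sdiff₀ (μ := μ₂) (U ∩ O) hBm.nullMeasurableSet
    have e2 := measure_inter_add_sdiff₀ (μ := μ₁) (U ∩ O) hBm.nullMeasurableSet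
    rw [Set.inter_eq_right.2 hBUO] at e1 e2
    have hd := h' ((U ∩ O) \ B) (Set.sdiff_subset.trans Set.inter_subset_right)
    have hdf : μ₂ ((U ∩ O) \ B) ≠ ∞ :=
      ((measure_mono (Set.sdiff_subset.trans Set.inter_subset_left)).trans_lt hUf).ne
    rw [← e1, ← e2] at hle
    exact (ENNReal.add_le_add_iff_right hdf).1 (hle.trans (by gcongr))
  rcases isEmpty_or_nonempty E with hE | ⟨⟨x₀⟩⟩
  · simp [Set.eq_empty_of_isEmpty B]
  have hmono : Monotone fun k : ℕ => B ∩ Metric.closedBall x₀ k := fun a b hab =>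
    Set.inter_subset_inter_right _ (Metric.closedBall_subset_closedBall (by exact_mod_cast hab))
  have hun : ⋃ k : ℕ, B ∩ Metric.closedBall x₀ k = B := by
    rw [← Set.inter_iUnion, Metric.iUnion_closedBall_nat, Set.inter_univ]
  conv_lhs => rw [← hun, hmono.measure_iUnion]
  refine iSup_le fun k => (hfin _ (Set.inter_subset_left.trans hB)
    (hBm.inter Metric.isClosed_closedBall.measurableSet) ?_).trans
    (measure_mono Set.inter_subset_left)
  exact ((measure_mono Set.inter_subset_right).trans_lt
    (isCompact_closedBall x₀ k).measure_lt_top).ne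

end Comparison

lemma measure_le_of_iUnion {E κ : Type*} [MeasurableSpace E] [Countable κ] {μ₁ μ₂ : Measure E}
    {O : κ → Set E} (hO : ∀ k, MeasurableSet (O k))
    (h : ∀ k, ∀ B ⊆ O k, MeasurableSet B → μ₁ B ≤ μ₂ B) {B : Set E} (hB : MeasurableSet B)
    (hBO : B ⊆ ⋃ k, O k) : μ₁ B ≤ μ₂ B := by
  rcases isEmpty_or_nonempty κ with hκ | hκ
  · simp only [Set.iUnion_of_empty, Set.subset_empty_iff] at hBO
    simp [hBO]
  obtain ⟨e, he⟩ := exists_surjective_nat κ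
  have hun : B = ⋃ k, B ∩ disjointed (O ∘ e) k := by
    have h1 : ⋃ k, (O ∘ e) k = ⋃ k, O k := he.iUnion_comp O
    rw [← Set.inter_iUnion, iUnion_disjointed, h1, Set.inter_eq_left.2 hBO]
  have hm : ∀ k, MeasurableSet (B ∩ disjointed (O ∘ e) k) := fun k =>
    hB.inter (MeasurableSet.disjointed (fun k => hO (e k)) k)
  have hd : Pairwise (Function.onFun Disjoint fun k => B ∩ disjointed (O ∘ e) k) := fun a b hab =>
    (disjoint_disjointed (O ∘ e) hab).mono Set.inter_subset_right Set.inter_subset_right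
  rw [hun, measure_iUnion hd hm, measure_iUnion hd hm]
  exact ENNReal.tsum_le_tsum fun k => h (e k) _
    (Set.inter_subset_right.trans (disjointed_subset _ _)) (hm k)

section MeanValue

open Filter Topology

variable {n : ℕ} {ι : Type*} [Fintype ι]

instance : (volume : Measure (ι → Fin n → ℝ)).OuterRegular :=
  haveI : IsLocallyFiniteMeasure (volume : Measure (ι → Fin n → ℝ)) := inferInstance
  inferInstance

lemma exists_minorAt_ne_zero [DecidableEq ι] {x : ι → Fin n → ℝ} (hx : LinearIndependent ℝ x) :
    ∃ σ : ι → Fin n, (minorAt σ x).det ≠ 0 := by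
  have hrank : (Matrix.of x).rank = Fintype.card ι :=
    LinearIndependent.rank_matrix (M := Matrix.of x) hx
  rw [Matrix.rank_eq_finrank_span_cols] at hrank
  obtain ⟨κ, a, ha, hspan, hli⟩ := exists_linearIndependent' ℝ (Matrix.of x).col
  have : Finite κ := Finite.of_injective a ha
  have := Fintype.ofFinite κ
  have hcard : Fintype.card κ = Fintype.card ι := by
    rw [← hrank, ← hspan, finrank_span_eq_card hli]
  let e : ι ≃ κ := Fintype.equivOfCardEq hcard.symm
  refine ⟨a ∘ e, ?_⟩
  have hcol : LinearIndependent ℝ (minorAt (a ∘ e) x).col := by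
    exact hli.comp e e.injective
  exact (((Matrix.isUnit_iff_isUnit_det _).1
    (Matrix.linearIndependent_cols_iff_isUnit.1 hcol))).ne_zero

/-- The intensity measure of the tuples of lattice vectors with coordinates in `W`. -/
def siegelMeasure (μ : Measure (LatticeSpace n)) (W : Set (ι → Fin n → ℤ)) :
    Measure (ι → Fin n → ℝ) :=
  μ.bind fun L => Measure.sum fun v : W =>
    Measure.dirac (tupleAct (Quotient.out (α := SLR n) L) (tupleCast v.1))

lemma lintegral_siegelMeasure (μ : Measure (LatticeSpace n)) {W : Set (ι → Fin n → ℤ)}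
    (hW : IsSLZInvariant W) {f : (ι → Fin n → ℝ) → ℝ≥0∞} (hf : Measurable f) :
    ∫⁻ x, f x ∂(siegelMeasure μ W) = ∫⁻ L, siegel W f L ∂μ := by
  have hsum : ∀ (L : LatticeSpace n) {g : (ι → Fin n → ℝ) → ℝ≥0∞} (_ : Measurable g),
      ∫⁻ x, g x ∂(Measure.sum fun v : W =>
        Measure.dirac (tupleAct (Quotient.out (α := SLR n) L) (tupleCast v.1))) = siegel W g L := by
    intro L g hg
    rw [lintegral_sum_measure]
    simp_rw [lintegral_dirac' _ hg]
    rfl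
  rw [siegelMeasure, Measure.lintegral_bind ?_ hf.aemeasurable]
  · exact lintegral_congr fun L => hsum L hf
  · refine (Measure.measurable_of_measurable_coe _ fun s hs => ?_).aemeasurable
    have hm : Measurable (s.indicator (1 : (ι → Fin n → ℝ) → ℝ≥0∞)) :=
      measurable_one.indicator hs
    simp_rw [← lintegral_indicator_one hs, fun L => hsum L hm]
    exact measurable_siegel hW hm

variable {μ : Measure (LatticeSpace n)} [IsProbabilityMeasure μ]
  (hμ : ∀ g : SLR n, Measure.map (fun x => g • x) μ = μ)

include hμ

lemma exists_open_cover_linearIndependent (hι : Fintype.card ι < n) :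
    ∃ O : (ι → Fin n) → Set (ι → Fin n → ℝ), (∀ σ, IsOpen (O σ)) ∧
      {x : ι → Fin n → ℝ | LinearIndependent ℝ x} ⊆ ⋃ σ, O σ ∧
      (∀ σ (W : Set (ι → Fin n → ℤ)) (c : ℝ≥0∞), IsSLZInvariant W → HasUpperDensity W c →
        c ≠ ∞ → ∀ B ⊆ O σ, siegelMeasure μ W B ≤ (c • volume) B) ∧
      (∀ σ, ∀ B ⊆ O σ, MeasurableSet B → volume B ≤ siegelMeasure μ Set.univ B) := by
  classical
  refine ⟨fun σ => {x | (minorAt σ x).det ≠ 0}, fun σ => ?_, fun x hx => ?_, ?_⟩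
  · exact isOpen_ne_fun (continuous_minorAt σ).matrix_det continuous_const
  · obtain ⟨σ, hσ⟩ := exists_minorAt_ne_zero hx
    exact Set.mem_iUnion.2 ⟨σ, hσ⟩
  have hj : ∀ σ : ι → Fin n, ∃ j, ∀ b, σ b ≠ j := by
    intro σ
    by_contra! h
    have := Fintype.card_le_of_surjective σ h
    rw [Fintype.card_fin] at this
    omega
  have hopen : ∀ σ : ι → Fin n, IsOpen {x : ι → Fin n → ℝ | (minorAt σ x).det ≠ 0} := fun σ =>
    isOpen_ne_fun (continuous_minorAt σ).matrix_det continuous_const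
  have upper : ∀ (σ : ι → Fin n) (W : Set (ι → Fin n → ℤ)) (c : ℝ≥0∞), IsSLZInvariant W →
      HasUpperDensity W c → c ≠ ∞ → ∀ B ⊆ {x : ι → Fin n → ℝ | (minorAt σ x).det ≠ 0},
      siegelMeasure μ W B ≤ (c • volume) B := by
    intro σ W c hW hc hc' B hB
    obtain ⟨j, hj⟩ := hj σ
    have : (c • volume : Measure (ι → Fin n → ℝ)).OuterRegular := Measure.OuterRegular.smul _ hc'
    refine measure_le_of_isOpen_le (hopen σ) (fun U hU hUo => ?_) hB
    refine measure_le_of_lintegral_le (fun f hf hfc hf0 hfs => ?_) hUo hU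
    rw [lintegral_siegelMeasure μ hW hf.measurable.ennreal_ofReal, lintegral_smul_measure]
    exact lintegral_siegel_le_of_continuous hμ hf hfc hf0 (fun x hx => hfs hx) hj hW hc
  refine ⟨upper, fun σ B hB hBm => ?_⟩
  obtain ⟨j, hj⟩ := hj σ
  refine le_measure_of_isOpen_le (hopen σ) (fun U hU hUo => ?_) (fun B hB => ?_) hBm hB
  · refine measure_le_of_lintegral_le (fun f hf hfc hf0 hfs => ?_) hUo hU
    rw [lintegral_siegelMeasure μ isSLZInvariant_univ hf.measurable.ennreal_ofReal]
    exact le_lintegral_siegel_of_continuous hμ hf hfc hf0 (fun x hx => hfs hx) hj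
  · simpa using upper σ Set.univ 1 isSLZInvariant_univ hasUpperDensity_univ ENNReal.one_ne_top B hB

omit hμ [IsProbabilityMeasure μ] in
lemma measurableSet_linearIndependent :
    MeasurableSet {x : ι → Fin n → ℝ | LinearIndependent ℝ x} :=
  isOpen_setOfPred_linearIndependent.measurableSet

/-- The mean value inequality for functions vanishing on linearly dependent tuples. -/
theorem lintegral_siegel_le (hι : Fintype.card ι < n) {W : Set (ι → Fin n → ℤ)}
    (hW : IsSLZInvariant W) {c : ℝ≥0∞} (hWc : HasUpperDensity W c) (hc : c ≠ ∞)
    {f : (ι → Fin n → ℝ) → ℝ≥0∞} (hf : Measurable f)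
    (hf0 : ∀ x, ¬ LinearIndependent ℝ x → f x = 0) :
    ∫⁻ L, siegel W f L ∂μ ≤ c * ∫⁻ x, f x := by
  obtain ⟨O, hO, hcov, hle, -⟩ := exists_open_cover_linearIndependent hμ hι
  set I := {x : ι → Fin n → ℝ | LinearIndependent ℝ x}
  have hI : MeasurableSet I := measurableSet_linearIndependent
  have hfI : I.indicator f = f := Set.indicator_eq_self.2 fun x hx => by
    by_contra h
    exact hx (hf0 x h)
  rw [← lintegral_siegelMeasure μ hW hf, ← hfI, lintegral_indicator hI, lintegral_indicator hI,
    ← smul_eq_mul, ← lintegral_smul_measure, ← Measure.restrict_smul]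
  refine lintegral_mono' (Measure.le_iff.2 fun B hB => ?_) le_rfl
  rw [Measure.restrict_apply hB, Measure.restrict_apply hB]
  exact measure_le_of_iUnion (fun σ => (hO σ).measurableSet)
    (fun σ B hB _ => hle σ W c hW hWc hc B hB) (hB.inter hI) (Set.inter_subset_right.trans hcov)

/-- The mean value formula for functions vanishing on linearly dependent tuples. -/
theorem lintegral_siegel_univ (hι : Fintype.card ι < n)
    {f : (ι → Fin n → ℝ) → ℝ≥0∞} (hf : Measurable f)
    (hf0 : ∀ x, ¬ LinearIndependent ℝ x → f x = 0) :
    ∫⁻ L, siegel Set.univ f L ∂μ = ∫⁻ x, f x := by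
  refine le_antisymm ?_ ?_
  · simpa using lintegral_siegel_le hμ hι isSLZInvariant_univ hasUpperDensity_univ
      ENNReal.one_ne_top hf hf0
  obtain ⟨O, hO, hcov, -, hle⟩ := exists_open_cover_linearIndependent hμ hι
  set I := {x : ι → Fin n → ℝ | LinearIndependent ℝ x}
  have hI : MeasurableSet I := measurableSet_linearIndependent
  have hfI : I.indicator f = f := Set.indicator_eq_self.2 fun x hx => by
    by_contra h
    exact hx (hf0 x h)
  rw [← lintegral_siegelMeasure μ isSLZInvariant_univ hf, ← hfI, lintegral_indicator hI,
    lintegral_indicator hI]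
  refine lintegral_mono' (Measure.le_iff.2 fun B hB => ?_) le_rfl
  rw [Measure.restrict_apply hB, Measure.restrict_apply hB]
  exact measure_le_of_iUnion (fun σ => (hO σ).measurableSet)
    hle (hB.inter hI) (Set.inter_subset_right.trans hcov)

end MeanValue

section YoungReal

open Filter Topology
open scoped FourierTransform

lemma abs_cube_sub_cube_le {a b c s : ℝ} (ha : 0 ≤ a) (hb : 0 ≤ b) (hc : 0 ≤ c) (hs : 0 < s) :
    |a ^ 3 - b ^ 3| ≤ (a ^ 3 + b ^ 3 + c ^ 3 - 3 * (a * b * c)) / (2 * s)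
      + 9 * s * (a ^ 3 + b ^ 3 + c ^ 3) := by
  set σ := a + b + c with hσ
  have hσ0 : 0 ≤ σ := by positivity
  have h1 : |a ^ 3 - b ^ 3| ≤ |a - b| * σ ^ 2 := by
    have : a ^ 3 - b ^ 3 = (a - b) * (a ^ 2 + a * b + b ^ 2) := by ring
    rw [this, abs_mul, abs_of_nonneg (by positivity : 0 ≤ a ^ 2 + a * b + b ^ 2)]
    gcongr
    rw [hσ]; nlinarith [mul_nonneg ha hb, mul_nonneg ha hc, mul_nonneg hb hc, sq_nonneg c]
  have h2 : |a - b| * σ ^ 2 ≤ σ * ((a - b) ^ 2 / (4 * s) + s * σ ^ 2) := by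
    have : |a - b| * σ ≤ (a - b) ^ 2 / (4 * s) + s * σ ^ 2 := by
      rw [← sq_abs (a - b)]
      have : |a - b| ^ 2 / (4 * s) + s * σ ^ 2 - |a - b| * σ
          = (|a - b| - 2 * s * σ) ^ 2 / (4 * s) := by field_simp; ring
      have : 0 ≤ (|a - b| - 2 * s * σ) ^ 2 / (4 * s) := by positivity
      linarith
    calc |a - b| * σ ^ 2 = σ * (|a - b| * σ) := by ring
      _ ≤ _ := by gcongr
  have h3 : σ * (a - b) ^ 2 ≤ 2 * (a ^ 3 + b ^ 3 + c ^ 3 - 3 * (a * b * c)) := by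
    have : a ^ 3 + b ^ 3 + c ^ 3 - 3 * (a * b * c)
        = σ * ((a - b) ^ 2 + (b - c) ^ 2 + (c - a) ^ 2) / 2 := by rw [hσ]; ring
    rw [this]
    nlinarith [mul_nonneg hσ0 (sq_nonneg (b - c)), mul_nonneg hσ0 (sq_nonneg (c - a))]
  have h4 : σ ^ 3 ≤ 9 * (a ^ 3 + b ^ 3 + c ^ 3) := by
    rw [hσ]
    nlinarith [mul_nonneg (add_nonneg ha hb) (sq_nonneg (a - b)),
      mul_nonneg (add_nonneg hb hc) (sq_nonneg (b - c)),
      mul_nonneg (add_nonneg hc ha) (sq_nonneg (c - a)),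
      mul_nonneg (add_nonneg (add_nonneg ha hb) hc) (sq_nonneg (a - b)),
      mul_nonneg (add_nonneg (add_nonneg ha hb) hc) (sq_nonneg (b - c)),
      mul_nonneg (add_nonneg (add_nonneg ha hb) hc) (sq_nonneg (c - a))]
  calc |a ^ 3 - b ^ 3| ≤ σ * ((a - b) ^ 2 / (4 * s) + s * σ ^ 2) := h1.trans h2
    _ = σ * (a - b) ^ 2 / (4 * s) + s * σ ^ 3 := by ring
    _ ≤ 2 * (a ^ 3 + b ^ 3 + c ^ 3 - 3 * (a * b * c)) / (4 * s)
        + s * (9 * (a ^ 3 + b ^ 3 + c ^ 3)) := by gcongr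
    _ = _ := by field_simp; ring

/-- The additive character `exp (2 π i x)` of the real line. -/
def expChar (x : ℝ) : ℂ := Complex.exp (((2 * Real.pi * x : ℝ) : ℂ) * Complex.I)

lemma continuous_expChar : Continuous expChar := by
  unfold expChar
  fun_prop

lemma norm_expChar (x : ℝ) : ‖expChar x‖ = 1 := Complex.norm_exp_ofReal_mul_I _

lemma expChar_add (x y : ℝ) : expChar (x + y) = expChar x * expChar y := by
  rw [expChar, expChar, expChar, ← Complex.exp_add]
  congr 1
  push_cast
  ring

lemma conj_expChar (x : ℝ) : (starRingEnd ℂ) (expChar x) = expChar (-x) := by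
  rw [expChar, expChar, ← Complex.exp_conj]
  simp only [map_mul, Complex.conj_ofReal, Complex.conj_I]
  push_cast
  ring_nf

/-- The characteristic function of the density `F`. -/
def densityChar (F : ℝ → ℝ) (t : ℝ) : ℂ := ∫ x, expChar (x * t) * F x

lemma continuous_densityChar {F : ℝ → ℝ} (hF : Integrable F) : Continuous (densityChar F) := by
  refine continuous_of_dominated (bound := fun x => ‖F x‖) (fun t => ?_) (fun t => ?_) hF.norm ?_
  · exact (continuous_expChar.comp (by fun_prop)).aestronglyMeasurable.mul
      hF.ofReal.aestronglyMeasurable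
  · exact ae_of_all _ fun x => by simp [norm_expChar]
  · exact ae_of_all _ fun x => (continuous_expChar.comp (by fun_prop)).mul continuous_const

lemma tendsto_densityChar (F : ℝ → ℝ) : Tendsto (densityChar F) atBot (𝓝 0) := by
  have h := Real.tendsto_integral_exp_smul_cocompact (fun x => (F x : ℂ))
  have h' := (h.mono_left atTop_le_cocompact).comp tendsto_neg_atBot_atTop
  refine h'.congr fun t => ?_
  refine integral_congr_ae (ae_of_all _ fun x => ?_)
  simp only [Circle.smul_def, Real.fourierChar_apply, smul_eq_mul, expChar, mul_neg, neg_neg]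

lemma densityChar_zero {F : ℝ → ℝ} (hF1 : ∫ x, F x = 1) : densityChar F 0 = 1 := by
  simp only [densityChar, expChar, mul_zero, Complex.ofReal_zero, zero_mul, Complex.exp_zero,
    one_mul]
  rw [integral_complex_ofReal, hF1, Complex.ofReal_one]

lemma exists_norm_densityChar_eq {F : ℝ → ℝ} (hF : Integrable F) (hF1 : ∫ x, F x = 1) :
    ∃ t, ‖densityChar F t‖ = 1 / 2 := by
  have hc : Continuous fun t => ‖densityChar F t‖ := (continuous_densityChar hF).norm
  have ht : Tendsto (fun t => ‖densityChar F t‖) atBot (𝓝 0) := by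
    simpa using (tendsto_densityChar F).norm
  obtain ⟨T, hT⟩ := (ht.eventually (gt_mem_nhds (by norm_num : (0 : ℝ) < 1 / 2))).exists
  exact mem_range_of_exists_le_of_exists_ge hc ⟨T, hT.le⟩
    ⟨0, by rw [densityChar_zero hF1]; norm_num⟩

lemma norm_densityChar_neg (F : ℝ → ℝ) (t : ℝ) :
    ‖densityChar F (-t)‖ = ‖densityChar F t‖ := by
  have : densityChar F (-t) = (starRingEnd ℂ) (densityChar F t) := by
    rw [densityChar, densityChar, ← integral_conj]
    refine integral_congr_ae (ae_of_all _ fun x => ?_)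
    simp only [map_mul, Complex.conj_ofReal, conj_expChar, mul_neg]
  rw [this, RCLike.norm_conj]

lemma norm_densityChar_le {F : ℝ → ℝ} (hF0 : ∀ x, 0 ≤ F x) (hF1 : ∫ x, F x = 1) (t : ℝ) :
    ‖densityChar F t‖ ≤ 1 := by
  refine (norm_integral_le_integral_norm _).trans ?_
  simp [abs_of_nonneg (hF0 _), hF1, norm_expChar]

lemma norm_integral_sub_le_of_norm_le_one {E : Type*} [MeasurableSpace E] {m : Measure E}
    {u v : E → ℝ} (hu : Integrable u m) (hv : Integrable v m) {e : E → ℂ}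
    (he : AEStronglyMeasurable e m) (he1 : ∀ x, ‖e x‖ = 1) :
    ‖∫ x, e x * u x ∂m‖ ≤ ‖∫ x, e x * v x ∂m‖ + ∫ x, |u x - v x| ∂m := by
  have hb : ∀ {w : E → ℝ}, Integrable w m → Integrable (fun x => e x * (w x : ℂ)) m := by
    intro w hw
    exact hw.ofReal.bdd_mul he (ae_of_all _ fun x => (he1 x).le)
  have h : ∫ x, e x * u x ∂m = ∫ x, e x * v x ∂m + ∫ x, e x * ((u x - v x : ℝ) : ℂ) ∂m := by
    rw [← integral_add (hb hv) (hb (w := fun x => u x - v x) (hu.sub hv))]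
    refine integral_congr_ae (ae_of_all _ fun x => ?_)
    push_cast; ring
  rw [h]
  refine (norm_add_le _ _).trans (add_le_add_right ?_ _)
  refine (norm_integral_le_integral_norm _).trans (le_of_eq ?_)
  refine integral_congr_ae (ae_of_all _ fun x => ?_)
  simp only [norm_mul, he1, one_mul, Complex.norm_real, Real.norm_eq_abs]


lemma measurePreserving_fst_add :
    MeasurePreserving (fun z : ℝ × ℝ => (z.1, z.1 + z.2)) (volume.prod volume)
      (volume.prod volume) :=
  measurePreserving_prod_add volume volume

lemma measurePreserving_snd_add :
    MeasurePreserving (fun z : ℝ × ℝ => (z.2, z.1 + z.2)) (volume.prod volume)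
      (volume.prod volume) := by
  have h := measurePreserving_fst_add.comp
    (Measure.measurePreserving_swap (μ := (volume : Measure ℝ)) (ν := (volume : Measure ℝ)))
  have he : (fun z : ℝ × ℝ => (z.2, z.1 + z.2)) = (fun z : ℝ × ℝ => (z.1, z.1 + z.2)) ∘ Prod.swap :=
    funext fun z => by simp [add_comm]
  rw [he]
  exact h

lemma integral_comp_of_measurePreserving {α β G : Type*} [MeasurableSpace α] [MeasurableSpace β]
    [NormedAddCommGroup G] [NormedSpace ℝ G] {m : Measure α} {m' : Measure β} {T : α → β}
    (hT : MeasurePreserving T m m') {g : β → G} (hg : AEStronglyMeasurable g m') :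
    ∫ x, g (T x) ∂m = ∫ y, g y ∂m' := by
  rw [← hT.map_eq] at hg ⊢
  exact (integral_map hT.measurable.aemeasurable hg).symm

lemma integral_expChar_mul_prod (F G : ℝ → ℝ) (s t : ℝ) :
    ∫ z : ℝ × ℝ, expChar (z.1 * s + z.2 * t) * ((F z.1 * G z.2 : ℝ) : ℂ) ∂(volume.prod volume)
      = densityChar F s * densityChar G t := by
  rw [densityChar, densityChar, ← integral_prod_mul]
  refine integral_congr_ae (ae_of_all _ fun z => ?_)
  simp only [expChar_add]
  push_cast
  ring

lemma aestronglyMeasurable_expChar_mul {F H : ℝ → ℝ} (hF : Integrable F) (hH : Integrable H)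
    (s t : ℝ) :
    AEStronglyMeasurable
      (fun z : ℝ × ℝ => expChar (z.1 * s + z.2 * t) * ((F z.1 * H z.2 : ℝ) : ℂ))
      (volume.prod volume) :=
  (continuous_expChar.comp (by fun_prop)).aestronglyMeasurable.mul
    (hF.mul_prod hH).ofReal.aestronglyMeasurable

lemma integral_expChar_mul_fst_add {F H : ℝ → ℝ} (hF : Integrable F) (hH : Integrable H)
    (s t : ℝ) :
    ∫ z : ℝ × ℝ, expChar (z.1 * s + z.2 * t) * ((F z.1 * H (z.1 + z.2) : ℝ) : ℂ)
      ∂(volume.prod volume) = densityChar F (s - t) * densityChar H t := by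
  rw [← integral_expChar_mul_prod, ← integral_comp_of_measurePreserving measurePreserving_fst_add
    (aestronglyMeasurable_expChar_mul hF hH _ _)]
  refine integral_congr_ae (ae_of_all _ fun z => ?_)
  simp only
  ring_nf

lemma integral_expChar_mul_snd_add {G H : ℝ → ℝ} (hG : Integrable G) (hH : Integrable H)
    (s t : ℝ) :
    ∫ z : ℝ × ℝ, expChar (z.1 * s + z.2 * t) * ((G z.2 * H (z.1 + z.2) : ℝ) : ℂ)
      ∂(volume.prod volume) = densityChar G (t - s) * densityChar H s := by
  rw [← integral_expChar_mul_prod, ← integral_comp_of_measurePreserving measurePreserving_snd_add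
    (aestronglyMeasurable_expChar_mul hG hH _ _)]
  refine integral_congr_ae (ae_of_all _ fun z => ?_)
  simp only
  ring_nf

/-- The three joint densities on the plane cannot be simultaneously close to each other. -/
lemma exists_le_integral_abs_sub {F G H : ℝ → ℝ} (hF : Integrable F) (hG : Integrable G)
    (hH : Integrable H) (hF0 : ∀ x, 0 ≤ F x) (hH0 : ∀ x, 0 ≤ H x)
    (hF1 : ∫ x, F x = 1) (hG1 : ∫ x, G x = 1) (hH1 : ∫ x, H x = 1) {η : ℝ} (hη : η ≤ 1 / 100)
    (huv : ∫ z : ℝ × ℝ, |F z.1 * G z.2 - F z.1 * H (z.1 + z.2)| ∂(volume.prod volume) ≤ η)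
    (huw : ∫ z : ℝ × ℝ, |F z.1 * G z.2 - G z.2 * H (z.1 + z.2)| ∂(volume.prod volume) ≤ η) :
    False := by
  have hu : Integrable (fun z : ℝ × ℝ => F z.1 * G z.2) (volume.prod volume) := hF.mul_prod hG
  have hv : Integrable (fun z : ℝ × ℝ => F z.1 * H (z.1 + z.2)) (volume.prod volume) :=
    measurePreserving_fst_add.integrable_comp_of_integrable (hF.mul_prod hH)
  have hw : Integrable (fun z : ℝ × ℝ => G z.2 * H (z.1 + z.2)) (volume.prod volume) :=
    measurePreserving_snd_add.integrable_comp_of_integrable (hG.mul_prod hH)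
  have hm : ∀ s t : ℝ, AEStronglyMeasurable (fun z : ℝ × ℝ => expChar (z.1 * s + z.2 * t))
      (volume.prod volume) := fun s t =>
    (continuous_expChar.comp (by fun_prop)).aestronglyMeasurable
  obtain ⟨t, ht⟩ := exists_norm_densityChar_eq hG hG1
  have h1 := norm_integral_sub_le_of_norm_le_one hu hv (hm 0 t) fun _ => norm_expChar _
  have h2 := norm_integral_sub_le_of_norm_le_one hu hw (hm t 0) fun _ => norm_expChar _
  have h3 := norm_integral_sub_le_of_norm_le_one hv hu (hm t t) fun _ => norm_expChar _
  rw [integral_expChar_mul_prod, integral_expChar_mul_fst_add hF hH, norm_mul, norm_mul, zero_sub,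
    norm_densityChar_neg, densityChar_zero hF1, norm_one, one_mul, ht] at h1
  rw [integral_expChar_mul_prod, integral_expChar_mul_snd_add hG hH, norm_mul, norm_mul, zero_sub,
    norm_densityChar_neg, densityChar_zero hG1, norm_one, mul_one, ht] at h2
  rw [integral_expChar_mul_prod, integral_expChar_mul_fst_add hF hH, norm_mul, norm_mul, sub_self,
    densityChar_zero hF1, norm_one, one_mul, ht] at h3
  simp_rw [abs_sub_comm (F _ * H _)] at h3
  have hf := norm_densityChar_le hF0 hF1 t
  have hh := norm_densityChar_le hH0 hH1 t
  have hf' := norm_nonneg (densityChar F t)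
  have hh' := norm_nonneg (densityChar H t)
  set a := ‖densityChar F t‖
  set h := ‖densityChar H t‖
  have ha : a ≤ 1 / 50 := by linarith
  have hb : h ≤ 1 / 50 := by linarith
  nlinarith

/-- A strict form of Young's convolution inequality on the real line. -/
lemma integral_young_real {p q r : ℝ → ℝ}
    (hp0 : ∀ x, 0 ≤ p x) (hq0 : ∀ x, 0 ≤ q x) (hr0 : ∀ x, 0 ≤ r x)
    (hm : AEStronglyMeasurable (fun z : ℝ × ℝ => (p z.1 * q z.2 * r (z.1 + z.2)) ^ 2)
      (volume.prod volume))
    (hpi : Integrable fun x => p x ^ 3) (hqi : Integrable fun x => q x ^ 3)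
    (hri : Integrable fun x => r x ^ 3) (hp1 : ∫ x, p x ^ 3 = 1) (hq1 : ∫ x, q x ^ 3 = 1)
    (hr1 : ∫ x, r x ^ 3 = 1) :
    Integrable (fun z : ℝ × ℝ => (p z.1 * q z.2 * r (z.1 + z.2)) ^ 2) (volume.prod volume) ∧
    ∫ z : ℝ × ℝ, (p z.1 * q z.2 * r (z.1 + z.2)) ^ 2 ∂(volume.prod volume) ≤ 1 - 1 / 2000000 := by
  set u : ℝ × ℝ → ℝ := fun z => p z.1 ^ 3 * q z.2 ^ 3
  set v : ℝ × ℝ → ℝ := fun z => p z.1 ^ 3 * r (z.1 + z.2) ^ 3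
  set w : ℝ × ℝ → ℝ := fun z => q z.2 ^ 3 * r (z.1 + z.2) ^ 3
  set T : ℝ × ℝ → ℝ := fun z => (p z.1 * q z.2 * r (z.1 + z.2)) ^ 2
  have hu : Integrable u (volume.prod volume) := hpi.mul_prod hqi
  have hv : Integrable v (volume.prod volume) :=
    measurePreserving_fst_add.integrable_comp_of_integrable (hpi.mul_prod hri)
  have hw : Integrable w (volume.prod volume) :=
    measurePreserving_snd_add.integrable_comp_of_integrable (hqi.mul_prod hri)
  have hu1 : ∫ z, u z ∂(volume.prod volume) = 1 := by
    rw [integral_prod_mul (fun x => p x ^ 3) (fun x => q x ^ 3), hp1, hq1, one_mul]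
  have hv1 : ∫ z, v z ∂(volume.prod volume) = 1 := by
    rw [integral_comp_of_measurePreserving measurePreserving_fst_add
      (g := fun z : ℝ × ℝ => p z.1 ^ 3 * r z.2 ^ 3) (hpi.mul_prod hri).aestronglyMeasurable,
      integral_prod_mul (fun x => p x ^ 3) (fun x => r x ^ 3), hp1, hr1, one_mul]
  have hw1 : ∫ z, w z ∂(volume.prod volume) = 1 := by
    rw [integral_comp_of_measurePreserving measurePreserving_snd_add
      (g := fun z : ℝ × ℝ => q z.1 ^ 3 * r z.2 ^ 3) (hqi.mul_prod hri).aestronglyMeasurable,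
      integral_prod_mul (fun x => q x ^ 3) (fun x => r x ^ 3), hq1, hr1, one_mul]
  have hcube : ∀ {s : ℝ} (_ : 0 < s) (z : ℝ × ℝ),
      |u z - v z| ≤ (u z + v z + w z - 3 * T z) / (2 * s) + 9 * s * (u z + v z + w z) ∧
      |u z - w z| ≤ (u z + v z + w z - 3 * T z) / (2 * s) + 9 * s * (u z + v z + w z) := by
    intro s hs z
    have ha := mul_nonneg (hp0 z.1) (hq0 z.2)
    have hb := mul_nonneg (hp0 z.1) (hr0 (z.1 + z.2))
    have hc := mul_nonneg (hq0 z.2) (hr0 (z.1 + z.2))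
    constructor
    · convert abs_cube_sub_cube_le ha hb hc hs using 2 <;> simp only [u, v, w, T] <;> ring_nf
    · convert abs_cube_sub_cube_le ha hc hb hs using 2 <;> simp only [u, v, w, T] <;> ring_nf
  have hTi : Integrable T (volume.prod volume) := by
    refine ((hu.add hv).add hw).mono' hm (ae_of_all _ fun z => ?_)
    have hT0 : 0 ≤ T z := sq_nonneg _
    have hsum : T z ≤ u z + v z + w z := by
      have ha := mul_nonneg (hp0 z.1) (hq0 z.2)
      have hb := mul_nonneg (hp0 z.1) (hr0 (z.1 + z.2))
      have hc := mul_nonneg (hq0 z.2) (hr0 (z.1 + z.2))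
      have key : ∀ {a b c : ℝ}, 0 ≤ a → 0 ≤ b → 0 ≤ c → a * b * c ≤ a ^ 3 + b ^ 3 + c ^ 3 := by
        intro a b c ha hb hc
        nlinarith [mul_nonneg (add_nonneg (add_nonneg ha hb) hc) (sq_nonneg (a - b)),
          mul_nonneg (add_nonneg (add_nonneg ha hb) hc) (sq_nonneg (b - c)),
          mul_nonneg (add_nonneg (add_nonneg ha hb) hc) (sq_nonneg (c - a)),
          mul_nonneg (mul_nonneg ha hb) hc]
      convert key ha hb hc using 1 <;> simp only [u, v, w, T] <;> ring_nf
    rw [Real.norm_eq_abs, abs_of_nonneg hT0]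
    exact hsum
  refine ⟨hTi, ?_⟩
  by_contra! hlt
  have hs : (0 : ℝ) < 1 / 5400 := by norm_num
  have hbi : Integrable (fun z => (u z + v z + w z - 3 * T z) / (2 * (1 / 5400))
      + 9 * (1 / 5400) * (u z + v z + w z)) (volume.prod volume) :=
    ((((hu.add hv).add hw).sub (hTi.const_mul 3)).div_const _).add
      (((hu.add hv).add hw).const_mul _)
  have hbound : ∫ z, ((u z + v z + w z - 3 * T z) / (2 * (1 / 5400))
      + 9 * (1 / 5400) * (u z + v z + w z)) ∂(volume.prod volume) ≤ 1 / 100 := by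
    have e : ∀ z, (u z + v z + w z - 3 * T z) / (2 * (1 / 5400))
      + 9 * (1 / 5400) * (u z + v z + w z) =
      (2700 + 1 / 600) * (u z + v z + w z) - 8100 * T z := fun z => by ring
    have huv : Integrable (fun z => u z + v z) (volume.prod volume) := hu.add hv
    have huvw : Integrable (fun z => u z + v z + w z) (volume.prod volume) := huv.add hw
    simp_rw [e]
    rw [integral_sub (huvw.const_mul _) (hTi.const_mul _), integral_const_mul, integral_const_mul]
    have h3 : ∫ z, (u z + v z + w z) ∂(volume.prod volume) = 3 := by
      rw [integral_add huv hw, integral_add hu hv, hu1, hv1, hw1]; norm_num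
    rw [h3]
    linarith
  refine exists_le_integral_abs_sub hpi hqi hri (fun x => pow_nonneg (hp0 x) 3)
    (fun x => pow_nonneg (hr0 x) 3) hp1 hq1 hr1 le_rfl
    ((integral_mono (hu.sub hv).abs hbi fun z => (hcube hs z).1).trans hbound)
    ((integral_mono (hu.sub hw).abs hbi fun z => (hcube hs z).2).trans hbound)

end YoungReal

section Young

/-- The constant in the strict Young inequality on the real line. -/
def youngConst : ℝ := 1 - 1 / 2000000

/-- Young's inequality with constant `C` for three functions on an additive group, written in
terms of the densities whose `2/3`-powers are integrated. -/
def YoungInequality (E : Type*) [Add E] [MeasureSpace E] (C : ℝ≥0∞) : Prop :=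
  ∀ f g h : E → ℝ≥0∞, Measurable f → Measurable g → Measurable h →
    ∫⁻ x, ∫⁻ y, (f x * g y * h (x + y)) ^ (2 / 3 : ℝ) ≤
      C * ((∫⁻ x, f x) * (∫⁻ x, g x) * ∫⁻ x, h x) ^ (2 / 3 : ℝ)

lemma lintegral_young_of_lintegral_eq_one {f g h : ℝ → ℝ≥0∞} (hf : Measurable f)
    (hg : Measurable g) (hh : Measurable h) (hf1 : ∫⁻ x, f x = 1) (hg1 : ∫⁻ x, g x = 1)
    (hh1 : ∫⁻ x, h x = 1) :
    ∫⁻ x, ∫⁻ y, (f x * g y * h (x + y)) ^ (2 / 3 : ℝ) ≤ ENNReal.ofReal youngConst := by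
  have hcube : ∀ {a : ℝ≥0∞}, a.toReal = (a.toReal ^ (1 / 3 : ℝ)) ^ 3 := by
    intro a
    rw [← Real.rpow_natCast, ← Real.rpow_mul ENNReal.toReal_nonneg]
    norm_num
  have hint : ∀ {k : ℝ → ℝ≥0∞}, Measurable k → ∫⁻ x, k x = 1 →
      Integrable (fun x => ((k x).toReal ^ (1 / 3 : ℝ)) ^ 3) ∧
        ∫ x, ((k x).toReal ^ (1 / 3 : ℝ)) ^ 3 = 1 := by
    intro k hk hk1
    simp_rw [← hcube]
    refine ⟨integrable_toReal_of_lintegral_ne_top hk.aemeasurable (by simp [hk1]), ?_⟩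
    rw [integral_toReal hk.aemeasurable (ae_lt_top hk (by simp [hk1])), hk1, ENNReal.toReal_one]
  obtain ⟨hpi, hp1⟩ := hint hf hf1
  obtain ⟨hqi, hq1⟩ := hint hg hg1
  obtain ⟨hri, hr1⟩ := hint hh hh1
  set p : ℝ → ℝ := fun x => (f x).toReal ^ (1 / 3 : ℝ)
  set q : ℝ → ℝ := fun x => (g x).toReal ^ (1 / 3 : ℝ)
  set r : ℝ → ℝ := fun x => (h x).toReal ^ (1 / 3 : ℝ)
  have hp0 : ∀ x, 0 ≤ p x := fun x => Real.rpow_nonneg ENNReal.toReal_nonneg _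
  have hq0 : ∀ x, 0 ≤ q x := fun x => Real.rpow_nonneg ENNReal.toReal_nonneg _
  have hr0 : ∀ x, 0 ≤ r x := fun x => Real.rpow_nonneg ENNReal.toReal_nonneg _
  have hpm : Measurable p := hf.ennreal_toReal.pow_const _
  have hqm : Measurable q := hg.ennreal_toReal.pow_const _
  have hrm : Measurable r := hh.ennreal_toReal.pow_const _
  obtain ⟨hi, hle⟩ := integral_young_real hp0 hq0 hr0
    (Measurable.aestronglyMeasurable (by fun_prop)) hpi hqi hri hp1 hq1 hr1
  have hae : (fun z : ℝ × ℝ => (f z.1 * g z.2 * h (z.1 + z.2)) ^ (2 / 3 : ℝ)) =ᵐ[volume.prod volume]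
      fun z => ENNReal.ofReal ((p z.1 * q z.2 * r (z.1 + z.2)) ^ 2) := by
    have h1 : ∀ᵐ z : ℝ × ℝ ∂(volume.prod volume), f z.1 < ∞ :=
      Measure.quasiMeasurePreserving_fst.ae (ae_lt_top hf (by simp [hf1]))
    have h2 : ∀ᵐ z : ℝ × ℝ ∂(volume.prod volume), g z.2 < ∞ :=
      Measure.quasiMeasurePreserving_snd.ae (ae_lt_top hg (by simp [hg1]))
    have h3 : ∀ᵐ z : ℝ × ℝ ∂(volume.prod volume), h (z.1 + z.2) < ∞ :=
      (Measure.quasiMeasurePreserving_snd.comp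
        measurePreserving_fst_add.quasiMeasurePreserving).ae (ae_lt_top hh (by simp [hh1]))
    filter_upwards [h1, h2, h3] with z h1 h2 h3
    rw [← ENNReal.ofReal_toReal h1.ne, ← ENNReal.ofReal_toReal h2.ne, ← ENNReal.ofReal_toReal h3.ne,
      hcube (a := f z.1), hcube (a := g z.2), hcube (a := h (z.1 + z.2)),
      ← ENNReal.ofReal_mul (by positivity), ← ENNReal.ofReal_mul (by positivity),
      ← mul_pow, ← mul_pow, ENNReal.ofReal_rpow_of_nonneg (by positivity) (by norm_num)]
    congr 1
    change ((p z.1 * q z.2 * r (z.1 + z.2)) ^ 3) ^ (2 / 3 : ℝ) = _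
    rw [← Real.rpow_natCast, ← Real.rpow_mul (mul_nonneg (mul_nonneg (hp0 _) (hq0 _)) (hr0 _)),
      ← Real.rpow_natCast]
    norm_num
  rw [← lintegral_prod (fun z : ℝ × ℝ => (f z.1 * g z.2 * h (z.1 + z.2)) ^ (2 / 3 : ℝ))
    (Measurable.aemeasurable (by fun_prop)), lintegral_congr_ae hae,
    ← ofReal_integral_eq_lintegral_ofReal hi (ae_of_all _ fun z => sq_nonneg _)]
  exact ENNReal.ofReal_le_ofReal hle

theorem youngInequality_real : YoungInequality ℝ (ENNReal.ofReal youngConst) := by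
  intro f g h hf hg hh
  have hpos : (0 : ℝ) < 2 / 3 := by norm_num
  have hC : ENNReal.ofReal youngConst ≠ 0 := by
    rw [Ne, ENNReal.ofReal_eq_zero, not_le, youngConst]
    norm_num
  by_cases hf0 : ∫⁻ x, f x = 0
  · have h0 : ∀ᵐ x, ∫⁻ y, (f x * g y * h (x + y)) ^ (2 / 3 : ℝ) = 0 := by
      filter_upwards [(lintegral_eq_zero_iff hf).1 hf0] with x hx
      simp [hx, ENNReal.zero_rpow_of_pos hpos]
    rw [lintegral_congr_ae h0]
    simp
  by_cases hg0 : ∫⁻ x, g x = 0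
  · have h0 : ∀ x, ∫⁻ y, (f x * g y * h (x + y)) ^ (2 / 3 : ℝ) = 0 := by
      intro x
      rw [← lintegral_zero (μ := (volume : Measure ℝ))]
      refine lintegral_congr_ae ?_
      filter_upwards [(lintegral_eq_zero_iff hg).1 hg0] with y hy
      simp [hy, ENNReal.zero_rpow_of_pos hpos]
    simp [h0]
  by_cases hh0 : ∫⁻ x, h x = 0
  · have h0 : ∀ x, ∫⁻ y, (f x * g y * h (x + y)) ^ (2 / 3 : ℝ) = 0 := by
      intro x
      rw [← lintegral_zero (μ := (volume : Measure ℝ))]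
      refine lintegral_congr_ae ?_
      filter_upwards [(measurePreserving_add_left volume x).quasiMeasurePreserving.ae
        ((lintegral_eq_zero_iff hh).1 hh0)] with y hy
      simp only [Pi.zero_apply] at hy
      simp [hy, ENNReal.zero_rpow_of_pos hpos]
    simp [h0]
  by_cases htop : (∫⁻ x, f x) * (∫⁻ x, g x) * (∫⁻ x, h x) = ∞
  · rw [htop, ENNReal.top_rpow_of_pos hpos, ENNReal.mul_top hC]
    exact le_top
  have hfg : (∫⁻ x, f x) * (∫⁻ x, g x) ≠ ∞ := fun hc => htop (by rw [hc, ENNReal.top_mul hh0])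
  have hft : ∫⁻ x, f x ≠ ∞ := fun hc => hfg (by rw [hc, ENNReal.top_mul hg0])
  have hgt : ∫⁻ x, g x ≠ ∞ := fun hc => hfg (by rw [hc, ENNReal.mul_top hf0])
  have hht : ∫⁻ x, h x ≠ ∞ := fun hc =>
    htop (by rw [hc, ENNReal.mul_top (mul_ne_zero hf0 hg0)])
  set a := ∫⁻ x, f x
  set b := ∫⁻ x, g x
  set c := ∫⁻ x, h x
  have key := lintegral_young_of_lintegral_eq_one (hf.const_mul a⁻¹) (hg.const_mul b⁻¹)
    (hh.const_mul c⁻¹) (by rw [lintegral_const_mul _ hf, ENNReal.inv_mul_cancel hf0 hft])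
    (by rw [lintegral_const_mul _ hg, ENNReal.inv_mul_cancel hg0 hgt])
    (by rw [lintegral_const_mul _ hh, ENNReal.inv_mul_cancel hh0 hht])
  have hscale : ∀ x y, (f x * g y * h (x + y)) ^ (2 / 3 : ℝ) = (a * b * c) ^ (2 / 3 : ℝ) *
      (a⁻¹ * f x * (b⁻¹ * g y) * (c⁻¹ * h (x + y))) ^ (2 / 3 : ℝ) := by
    intro x y
    rw [← ENNReal.mul_rpow_of_nonneg _ _ hpos.le]
    congr 1
    calc f x * g y * h (x + y) = (a * a⁻¹) * (b * b⁻¹) * (c * c⁻¹) * (f x * g y * h (x + y)) := by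
          rw [ENNReal.mul_inv_cancel hf0 hft, ENNReal.mul_inv_cancel hg0 hgt,
            ENNReal.mul_inv_cancel hh0 hht, one_mul, one_mul, one_mul]
      _ = _ := by ring
  have hm : Measurable fun z : ℝ × ℝ =>
      (a⁻¹ * f z.1 * (b⁻¹ * g z.2) * (c⁻¹ * h (z.1 + z.2))) ^ (2 / 3 : ℝ) := by fun_prop
  simp_rw [hscale]
  have h1 : ∀ x, ∫⁻ y, (a * b * c) ^ (2 / 3 : ℝ) *
      (a⁻¹ * f x * (b⁻¹ * g y) * (c⁻¹ * h (x + y))) ^ (2 / 3 : ℝ) = (a * b * c) ^ (2 / 3 : ℝ) *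
      ∫⁻ y, (a⁻¹ * f x * (b⁻¹ * g y) * (c⁻¹ * h (x + y))) ^ (2 / 3 : ℝ) := fun x =>
    lintegral_const_mul _ (hm.comp measurable_prodMk_left)
  simp_rw [h1]
  rw [lintegral_const_mul _ hm.lintegral_prod_right', mul_comm]
  gcongr

lemma YoungInequality.prod {E E' : Type*} [Add E] [Add E'] [MeasureSpace E] [MeasureSpace E']
    [MeasurableAdd₂ E] [MeasurableAdd₂ E'] [SFinite (volume : Measure E)]
    [SFinite (volume : Measure E')] {C C' : ℝ≥0∞}
    (hE : YoungInequality E C) (hE' : YoungInequality E' C') : YoungInequality (E × E') (C * C') := by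
  intro f g h hf hg hh
  have hpos : (0 : ℝ) ≤ 2 / 3 := by norm_num
  have hm : Measurable fun z : ((E × E') × (E × E')) =>
      (f z.1 * g z.2 * h (z.1.1 + z.2.1, z.1.2 + z.2.2)) ^ (2 / 3 : ℝ) := by fun_prop
  calc ∫⁻ x, ∫⁻ y, (f x * g y * h (x + y)) ^ (2 / 3 : ℝ)
      = ∫⁻ x, ∫⁻ x', ∫⁻ y, ∫⁻ y', (f (x, x') * g (y, y') * h (x + y, x' + y')) ^ (2 / 3 : ℝ) := by
        refine (lintegral_prod _ hm.lintegral_prod_right'.aemeasurable).trans ?_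
        refine lintegral_congr fun x => lintegral_congr fun x' => ?_
        exact lintegral_prod _ (hm.comp measurable_prodMk_left).aemeasurable
    _ = ∫⁻ x, ∫⁻ y, ∫⁻ x', ∫⁻ y', (f (x, x') * g (y, y') * h (x + y, x' + y')) ^ (2 / 3 : ℝ) := by
        refine lintegral_congr fun x => ?_
        rw [lintegral_lintegral_swap]
        refine Measurable.aemeasurable ?_
        have : Measurable fun w : (E' × E) × E' =>
            (f (x, w.1.1) * g (w.1.2, w.2) * h (x + w.1.2, w.1.1 + w.2)) ^ (2 / 3 : ℝ) := by fun_prop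
        exact this.lintegral_prod_right'
    _ ≤ ∫⁻ x, ∫⁻ y, C' * ((∫⁻ x', f (x, x')) * (∫⁻ y', g (y, y')) * ∫⁻ x', h (x + y, x'))
          ^ (2 / 3 : ℝ) := by
        refine lintegral_mono fun x => lintegral_mono fun y => ?_
        exact hE' _ _ _ (by fun_prop) (by fun_prop) (by fun_prop)
    _ = C' * ∫⁻ x, ∫⁻ y, ((∫⁻ x', f (x, x')) * (∫⁻ y', g (y, y')) * ∫⁻ x', h (x + y, x'))
          ^ (2 / 3 : ℝ) := by
        have hm' : Measurable fun z : E × E => ((∫⁻ x', f (z.1, x')) * (∫⁻ y', g (z.2, y')) *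
            ∫⁻ x', h (z.1 + z.2, x')) ^ (2 / 3 : ℝ) := by
          have h1 : Measurable fun x => ∫⁻ x', f (x, x') := hf.lintegral_prod_right'
          have h2 : Measurable fun x => ∫⁻ x', g (x, x') := hg.lintegral_prod_right'
          have h3 : Measurable fun x => ∫⁻ x', h (x, x') := hh.lintegral_prod_right'
          exact (((h1.comp measurable_fst).mul (h2.comp measurable_snd)).mul
            (h3.comp (measurable_fst.add measurable_snd))).pow_const _
        rw [← lintegral_const_mul _ hm'.lintegral_prod_right']
        refine lintegral_congr fun x => ?_
        exact lintegral_const_mul _ (hm'.comp measurable_prodMk_left)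
    _ ≤ C' * (C * ((∫⁻ x, ∫⁻ x', f (x, x')) * (∫⁻ x, ∫⁻ x', g (x, x')) *
          ∫⁻ x, ∫⁻ x', h (x, x')) ^ (2 / 3 : ℝ)) := by
        gcongr
        exact hE _ _ _ hf.lintegral_prod_right' hg.lintegral_prod_right' hh.lintegral_prod_right'
    _ = _ := by
        rw [Measure.volume_eq_prod, lintegral_prod _ hf.aemeasurable,
          lintegral_prod _ hg.aemeasurable, lintegral_prod _ hh.aemeasurable]
        ring

lemma YoungInequality.of_measurableEquiv {E E' : Type*} [Add E] [Add E'] [MeasureSpace E]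
    [MeasureSpace E'] {C : ℝ≥0∞} (hE : YoungInequality E C) (e : E ≃ᵐ E')
    (he : MeasurePreserving e) (hadd : ∀ x y, e (x + y) = e x + e y) : YoungInequality E' C := by
  intro f g h hf hg hh
  have key : ∀ k : E' → ℝ≥0∞, ∫⁻ x, k (e x) = ∫⁻ x, k x := fun k =>
    he.lintegral_comp_emb e.measurableEmbedding k
  have := hE _ _ _ (hf.comp e.measurable) (hg.comp e.measurable) (hh.comp e.measurable)
  simp only [Function.comp_apply, hadd, key] at this
  rw [← key]
  simp_rw [← key (fun y => (f _ * g y * h (_ + y)) ^ (2 / 3 : ℝ))]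
  exact this

theorem youngInequality_pi (n : ℕ) :
    YoungInequality (Fin n → ℝ) (ENNReal.ofReal youngConst ^ n) := by
  induction n with
  | zero =>
    intro f g h _ _ _
    have hv : ∀ k : (Fin 0 → ℝ) → ℝ≥0∞, ∫⁻ x, k x = k 0 := fun k => by
      rw [volume_pi, Measure.pi_of_empty _ 0, lintegral_dirac]
    simp only [hv, add_zero, pow_zero, one_mul]
    exact le_refl _
  | succ n ih =>
    rw [pow_succ']
    refine (youngInequality_real.prod ih).of_measurableEquiv
      (MeasurableEquiv.piFinSuccAbove (fun _ => ℝ) 0).symm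
      (volume_preserving_piFinSuccAbove (fun _ => ℝ) 0).symm fun x y => ?_
    ext i
    refine Fin.cases ?_ (fun i => ?_) i <;> simp [MeasurableEquiv.piFinSuccAbove]

/-- The strict Young inequality for indicator functions of sets of equal volume. -/
theorem lintegral_indicator_young {n : ℕ} {A B D : Set (Fin n → ℝ)} (hA : MeasurableSet A)
    (hB : MeasurableSet B) (hD : MeasurableSet D) {v : ℝ≥0∞} (hAv : volume A = v)
    (hBv : volume B = v) (hDv : volume D = v) :
    ∫⁻ x, ∫⁻ y, A.indicator 1 x * B.indicator 1 y * D.indicator 1 (x + y) ≤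
      ENNReal.ofReal youngConst ^ n * v ^ 2 := by
  have h := youngInequality_pi n (A.indicator 1) (B.indicator 1) (D.indicator 1)
    (measurable_one.indicator hA) (measurable_one.indicator hB) (measurable_one.indicator hD)
  rw [lintegral_indicator_one hA, lintegral_indicator_one hB, lintegral_indicator_one hD,
    hAv, hBv, hDv] at h
  have e : (v * v * v) ^ (2 / 3 : ℝ) = v ^ 2 := by
    rw [show v * v * v = v ^ (3 : ℝ) by norm_cast; ring, ← ENNReal.rpow_mul]
    norm_num
  rw [e] at h
  refine le_trans (le_of_eq ?_) h
  refine lintegral_congr fun x => lintegral_congr fun y => ?_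
  by_cases hx : x ∈ A <;> by_cases hy : y ∈ B <;> by_cases hz : x + y ∈ D <;> simp [hx, hy, hz]

end Young

section Relations

variable {n r : ℕ}

/-- The integer tuples satisfying the linear relation with coefficients `c`. -/
def relationSet (n : ℕ) (c : Fin (r + 1) → ℤ) : Set (Fin (r + 1) → Fin n → ℤ) :=
  {v | ∑ i, c i • v i = 0}

lemma isSLZInvariant_relationSet (c : Fin (r + 1) → ℤ) : IsSLZInvariant (relationSet n c) := by
  intro γ v hv
  change ∑ i, c i • γ.1.mulVec (v i) = 0
  have h : ∑ i, c i • γ.1.mulVec (v i) = γ.1.mulVec (∑ i, c i • v i) := by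
    rw [Matrix.mulVec_sum]
    exact Finset.sum_congr rfl fun i _ => (Matrix.mulVec_smul _ _ _).symm
  rw [h, show ∑ i, c i • v i = 0 from hv, Matrix.mulVec_zero]

lemma sum_smul_tupleAct {c : Fin (r + 1) → ℤ} {v : Fin (r + 1) → Fin n → ℤ}
    (hv : v ∈ relationSet n c) (g : SLR n) :
    ∑ i, (c i : ℝ) • tupleAct g (tupleCast v) i = 0 := by
  have h : ∑ i, (c i : ℝ) • tupleCast v i = 0 := by
    ext j
    have := congrFun (show ∑ i, c i • v i = 0 from hv) j
    simp only [Finset.sum_apply, Pi.smul_apply, smul_eq_mul, Pi.zero_apply] at this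
    simp only [tupleCast, Finset.sum_apply, Pi.smul_apply, smul_eq_mul, Pi.zero_apply]
    exact_mod_cast this
  have h2 : ∑ i, (c i : ℝ) • tupleAct g (tupleCast v) i =
      g.1.mulVec (∑ i, (c i : ℝ) • tupleCast v i) := by
    rw [Matrix.mulVec_sum]
    simp [Matrix.mulVec_smul, tupleAct]
  rw [h2, h, Matrix.mulVec_zero]

lemma linearIndependent_tupleAct {ι : Type*} {g : SLR n} {x : ι → Fin n → ℝ} :
    LinearIndependent ℝ (tupleAct g x) ↔ LinearIndependent ℝ x := by
  have hinj : Function.Injective (Matrix.mulVecLin g.1) := by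
    rw [Matrix.coe_mulVecLin]
    exact Matrix.mulVec_injective_of_isUnit
      ((Matrix.isUnit_iff_isUnit_det _).2 (by rw [g.2]; exact isUnit_one))
  exact (Matrix.mulVecLin g.1).linearIndependent_iff (LinearMap.ker_eq_bot.2 hinj)

lemma exists_primitive_relation {v : Fin (r + 1) → Fin n → ℤ} (g : SLR n)
    (hv : ¬LinearIndependent ℝ (tupleAct g (tupleCast v))) :
    ∃ c : Fin (r + 1) → ℤ, Finset.univ.gcd c = 1 ∧ v ∈ relationSet n c := by
  have h1 : ¬LinearIndependent ℤ v := by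
    rwa [linearIndependent_tupleAct, show tupleCast v = fun i => algebraMap ℤ ℝ ∘ v i from rfl,
      linearIndependent_algebraMap_comp_iff] at hv
  obtain ⟨c, hc, i, hi⟩ := Fintype.not_linearIndependent_iff.1 h1
  obtain ⟨d, hd, hd1⟩ := Finset.extract_gcd c (Finset.univ_nonempty (α := Fin (r + 1)))
  refine ⟨d, hd1, ?_⟩
  have hg : Finset.univ.gcd c ≠ 0 := fun h => hi (Finset.gcd_eq_zero_iff.1 h i (Finset.mem_univ i))
  have h3 : Finset.univ.gcd c • ∑ i, d i • v i = 0 := by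
    rw [Finset.smul_sum, ← hc]
    exact Finset.sum_congr rfl fun j hj => by rw [hd j hj, mul_smul]
  exact (smul_eq_zero.1 h3).resolve_left hg

/-- The tuples of points of `S` whose first entry depends linearly on the others, which are
linearly independent and different from the first entry. -/
def dependentSet (r : ℕ) (S : Set (Fin n → ℝ)) : Set (Fin (r + 1) → Fin n → ℝ) :=
  {y | (∀ i, y i ∈ S) ∧ LinearIndependent ℝ (Fin.tail y) ∧ ¬LinearIndependent ℝ y ∧
    ∀ i, Fin.tail y i ≠ y 0}

lemma measurableSet_dependentSet {S : Set (Fin n → ℝ)} (hS : MeasurableSet S) :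
    MeasurableSet (dependentSet r S) := by
  have ht : Measurable (fun y : Fin (r + 1) → Fin n → ℝ => Fin.tail y) :=
    measurable_pi_lambda _ fun i => measurable_pi_apply _
  have h1 : MeasurableSet {y : Fin (r + 1) → Fin n → ℝ | ∀ i, y i ∈ S} := by
    rw [Set.ofPred_forall]
    exact MeasurableSet.iInter fun i => measurable_pi_apply i hS
  have h2 : MeasurableSet {y : Fin (r + 1) → Fin n → ℝ | LinearIndependent ℝ (Fin.tail y)} :=
    ht (measurableSet_linearIndependent)
  have h3 : MeasurableSet {y : Fin (r + 1) → Fin n → ℝ | ¬LinearIndependent ℝ y} :=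
    (measurableSet_linearIndependent).compl
  have h4 : MeasurableSet {y : Fin (r + 1) → Fin n → ℝ | ∀ i, Fin.tail y i ≠ y 0} := by
    rw [Set.ofPred_forall]
    exact MeasurableSet.iInter fun i =>
      (measurableSet_eq_fun (measurable_pi_apply i.succ) (measurable_pi_apply 0)).compl
  exact h1.inter (h2.inter (h3.inter h4))

lemma ne_zero_of_linearIndependent_tail {y : Fin (r + 1) → Fin n → ℝ} {c : Fin (r + 1) → ℤ}
    (hy : LinearIndependent ℝ (Fin.tail y)) (hc : Finset.univ.gcd c = 1)
    (h : ∑ i, (c i : ℝ) • y i = 0) : c 0 ≠ 0 := by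
  intro h0
  rw [Fin.sum_univ_succ, h0] at h
  have h1 := Fintype.linearIndependent_iff.1 hy (fun i => (c i.succ : ℝ))
    (by simpa [Fin.tail] using h)
  have h2 : Finset.univ.gcd c = 0 := Finset.gcd_eq_zero_iff.2 fun i _ => by
    refine Fin.cases h0 (fun j => ?_) i
    exact_mod_cast h1 j
  omega

lemma linearIndependent_succAbove {y : Fin (r + 1) → Fin n → ℝ} {c : Fin (r + 1) → ℝ}
    (hy : LinearIndependent ℝ (Fin.tail y)) (h : ∑ i, c i • y i = 0) (h0 : c 0 ≠ 0)
    {k : Fin (r + 1)} (hk : c k ≠ 0) : LinearIndependent ℝ (fun j => y (k.succAbove j)) := by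
  rw [Fintype.linearIndependent_iff]
  intro d hd j
  set e : Fin (r + 1) → ℝ := k.insertNth 0 d
  have he : ∑ i, e i • y i = 0 := by
    rw [Fin.sum_univ_succAbove _ k]
    simpa [e] using hd
  have h1 : ∑ i, (c 0 * e i - e 0 * c i) • y i = 0 := by
    simp only [sub_smul, mul_smul, Finset.sum_sub_distrib, ← Finset.smul_sum, he, h]
    simp
  have h2 : ∀ i, c 0 * e i - e 0 * c i = 0 := by
    rw [Fin.sum_univ_succ] at h1
    have h3 := Fintype.linearIndependent_iff.1 hy (fun i => c 0 * e i.succ - e 0 * c i.succ)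
      (by simpa [mul_comm, Fin.tail] using h1)
    intro i
    refine Fin.cases (by ring) h3 i
  have h4 : e 0 = 0 := by
    have := h2 k
    simpa [e, hk] using this
  have h5 := h2 (k.succAbove j)
  simpa [h4, h0, e] using h5

lemma exists_tail_ne_zero {S : Set (Fin n → ℝ)} (hS : S ∩ (-S) = ∅)
    {y : Fin (r + 1) → Fin n → ℝ} {c : Fin (r + 1) → ℤ} (hy : y ∈ dependentSet r S)
    (h : ∑ i, (c i : ℝ) • y i = 0) (h0 : c 0 ≠ 0) (hc : ∀ i, |c i| ≤ 1) :
    ∃ a b : Fin r, a ≠ b ∧ c a.succ ≠ 0 ∧ c b.succ ≠ 0 := by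
  obtain ⟨hyS, -, -, hne⟩ := hy
  have hsym : ∀ x ∈ S, -x ∉ S := fun x hx hx' => by
    have : x ∈ S ∩ (-S) := ⟨hx, hx'⟩
    rw [hS] at this
    exact this
  have hpm : ∀ i, c i ≠ 0 → c i = 1 ∨ c i = -1 := fun i hi => by
    have := abs_le.1 (hc i)
    omega
  have hz : (0 : Fin n → ℝ) ∉ S := fun hz => hsym 0 hz (by simpa using hz)
  have h0' : (c 0 : ℝ) ≠ 0 := by exact_mod_cast h0
  rw [Fin.sum_univ_succ] at h
  by_contra! hcon
  by_cases hall : ∀ a : Fin r, c a.succ = 0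
  · simp only [hall, Int.cast_zero, zero_smul, Finset.sum_const_zero, add_zero] at h
    exact hz ((smul_eq_zero.1 h).resolve_left h0' ▸ hyS 0)
  · push Not at hall
    obtain ⟨a, ha⟩ := hall
    rw [Finset.sum_eq_single a (fun b _ hb => by rw [hcon a b hb.symm ha]; simp) (by simp)] at h
    have key : y a.succ = y 0 ∨ y a.succ = -y 0 := by
      rcases hpm 0 h0 with h1 | h1 <;> rcases hpm _ ha with h2 | h2 <;> rw [h1, h2] at h <;>
        simp only [Int.cast_one, Int.cast_neg, one_smul, neg_smul] at h
      · exact Or.inr (eq_neg_of_add_eq_zero_right h)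
      · exact Or.inl (by rw [← sub_eq_add_neg] at h; exact (sub_eq_zero.1 h).symm)
      · exact Or.inl (by rw [neg_add_eq_zero] at h; exact h.symm)
      · exact Or.inr (by rw [← neg_add, neg_eq_zero] at h; exact eq_neg_of_add_eq_zero_right h)
    rcases key with h1 | h1
    · exact hne a h1
    · exact hsym _ (hyS 0) (h1 ▸ hyS a.succ)

/-- The tuples of points of `S` that can be completed to a tuple of points of `S` satisfying the
relation `c` by inserting an entry at position `k`. -/
def completableSet (S : Set (Fin n → ℝ)) (c : Fin (r + 1) → ℤ) (k : Fin (r + 1)) :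
    Set (Fin r → Fin n → ℝ) :=
  {x | (∀ i, x i ∈ S) ∧ -∑ j, ((c (k.succAbove j) : ℝ) / c k) • x j ∈ S}

lemma measurableSet_completableSet {S : Set (Fin n → ℝ)} (hS : MeasurableSet S)
    (c : Fin (r + 1) → ℤ) (k : Fin (r + 1)) : MeasurableSet (completableSet S c k) := by
  have h1 : MeasurableSet {x : Fin r → Fin n → ℝ | ∀ i, x i ∈ S} := by
    rw [Set.ofPred_forall]
    exact MeasurableSet.iInter fun i => measurable_pi_apply i hS
  refine h1.inter ?_
  have h2 : Measurable (fun x : Fin r → Fin n → ℝ =>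
      -∑ j, ((c (k.succAbove j) : ℝ) / c k) • x j) := by fun_prop
  exact h2 hS

lemma siegel_relationSet_le {S : Set (Fin n → ℝ)} {c : Fin (r + 1) → ℤ}
    {k : Fin (r + 1)} (h0 : c 0 ≠ 0) (hk : c k ≠ 0) (L : LatticeSpace n) :
    siegel (relationSet n c) ((dependentSet r S).indicator 1) L ≤
      siegel (congruenceSet n (fun j => c (k.succAbove j)) (c k).natAbs)
        ((completableSet S c k ∩ {x | LinearIndependent ℝ x}).indicator 1) L := by
  unfold siegel latSum
  set g := Quotient.out (α := SLR n) L
  have hmem : ∀ v ∈ relationSet n c, (fun j => v (k.succAbove j)) ∈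
      congruenceSet n (fun j => c (k.succAbove j)) (c k).natAbs := by
    intro v hv j
    rw [Int.natAbs_dvd]
    have := congrFun (show ∑ i, c i • v i = 0 from hv) j
    rw [Fin.sum_univ_succAbove _ k] at this
    simp only [Pi.add_apply, Finset.sum_apply, Pi.smul_apply, smul_eq_mul, Pi.zero_apply] at this
    exact ⟨-v k j, by linarith⟩
  let φ : relationSet n c → congruenceSet n (fun j => c (k.succAbove j)) (c k).natAbs :=
    fun v => ⟨fun j => v.1 (k.succAbove j), hmem v.1 v.2⟩
  have hφ : Function.Injective φ := by
    intro v w hvw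
    have h1 : ∀ j, v.1 (k.succAbove j) = w.1 (k.succAbove j) :=
      fun j => congrFun (congrArg Subtype.val hvw) j
    have h2 : v.1 k = w.1 k := by
      have hv : ∑ i, c i • v.1 i = 0 := v.2
      have hw : ∑ i, c i • w.1 i = 0 := w.2
      rw [Fin.sum_univ_succAbove _ k] at hv hw
      simp only [h1] at hv
      have := add_right_cancel (hv.trans hw.symm)
      exact smul_right_injective _ hk this
    ext i : 2
    obtain rfl | ⟨j, rfl⟩ := Fin.eq_self_or_eq_succAbove k i
    · exact h2
    · exact h1 j
  refine le_trans (ENNReal.tsum_le_tsum fun v => ?_)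
    (ENNReal.tsum_comp_le_tsum_of_injective hφ
      fun w => (completableSet S c k ∩ {x | LinearIndependent ℝ x}).indicator 1
        (tupleAct g (tupleCast w.1)))
  by_cases hy : tupleAct g (tupleCast v.1) ∈ dependentSet r S
  · have hrel := sum_smul_tupleAct v.2 g
    have hk' : (c k : ℝ) ≠ 0 := by exact_mod_cast hk
    rw [Set.indicator_of_mem hy, Set.indicator_of_mem]
    · rfl
    refine ⟨⟨fun j => hy.1 (k.succAbove j), ?_⟩, ?_⟩
    · convert hy.1 k using 1
      rw [Fin.sum_univ_succAbove _ k, add_comm, ← eq_neg_iff_add_eq_zero] at hrel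
      have h1 : ∑ j, ((c (k.succAbove j) : ℝ) / c k) • tupleAct g (tupleCast (φ v).1) j =
          (c k : ℝ)⁻¹ • ∑ j, (c (k.succAbove j) : ℝ) •
            tupleAct g (tupleCast v.1) (k.succAbove j) := by
        rw [Finset.smul_sum]
        refine Finset.sum_congr rfl fun j _ => ?_
        rw [smul_smul, div_eq_inv_mul]
        rfl
      rw [h1, hrel, smul_neg, neg_neg, smul_smul, inv_mul_cancel₀ hk', one_smul]
    · exact linearIndependent_succAbove hy.2.1 hrel (by exact_mod_cast h0) hk'
  · rw [Set.indicator_of_notMem hy]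
    exact zero_le

end Relations

section RelationBounds

variable {n r : ℕ}

lemma lintegral_smul_of_abs_eq_one {e : ℝ} (he : |e| = 1) (F : (Fin n → ℝ) → ℝ≥0∞) :
    ∫⁻ s, F (e • s) = ∫⁻ s, F s := by
  rcases eq_or_eq_neg_of_abs_eq he with rfl | rfl
  · simp
  · simpa using lintegral_neg_eq_self (μ := (volume : Measure (Fin n → ℝ))) F

lemma volume_smul_mem_of_abs_eq_one {e : ℝ} (he : |e| = 1) {S : Set (Fin n → ℝ)}
    (hS : MeasurableSet S) : volume {s | e • s ∈ S} = volume S := by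
  have h := lintegral_smul_of_abs_eq_one he (S.indicator 1)
  rw [lintegral_indicator_one hS] at h
  rw [← h]
  exact (lintegral_indicator_one (hS.preimage (measurable_const_smul e))).symm

lemma lintegral_indicator_young_affine {S : Set (Fin n → ℝ)} (hS : MeasurableSet S) {d e : ℝ}
    (hd : |d| = 1) (he : |e| = 1) (w : Fin n → ℝ) :
    ∫⁻ s, ∫⁻ t, S.indicator 1 s * S.indicator 1 t * S.indicator 1 (d • s + e • t + w) ≤
      ENNReal.ofReal youngConst ^ n * volume S ^ 2 := by
  have hdd : d * d = 1 := by rw [← abs_mul_abs_self, hd, one_mul]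
  have hee : e * e = 1 := by rw [← abs_mul_abs_self, he, one_mul]
  rw [← lintegral_smul_of_abs_eq_one hd]
  have h1 : ∀ s : Fin n → ℝ, ∫⁻ t, S.indicator (1 : (Fin n → ℝ) → ℝ≥0∞) (d • s) *
      S.indicator 1 t * S.indicator 1 (d • d • s + e • t + w) =
      ∫⁻ t, {s | d • s ∈ S}.indicator 1 s * {t | e • t ∈ S}.indicator 1 t *
        {u | u + w ∈ S}.indicator 1 (s + t) := fun s => by
    rw [← lintegral_smul_of_abs_eq_one he]
    refine lintegral_congr fun t => ?_
    simp only [smul_smul, hdd, hee, one_smul]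
    rfl
  simp_rw [h1]
  exact lintegral_indicator_young (hS.preimage (measurable_const_smul d))
    (hS.preimage (measurable_const_smul e)) (hS.preimage (measurable_add_const w))
    (volume_smul_mem_of_abs_eq_one hd hS) (volume_smul_mem_of_abs_eq_one he hS)
    (measure_preimage_add_right _ w S)

lemma volume_forall_mem (r : ℕ) (S : Set (Fin n → ℝ)) :
    volume {x : Fin r → Fin n → ℝ | ∀ i, x i ∈ S} = volume S ^ r := by
  have : {x : Fin r → Fin n → ℝ | ∀ i, x i ∈ S} = Set.univ.pi fun _ => S := by
    ext; simp
  rw [this, volume_pi_pi]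
  simp

lemma measurableSet_forall_mem (r : ℕ) {S : Set (Fin n → ℝ)} (hS : MeasurableSet S) :
    MeasurableSet {x : Fin r → Fin n → ℝ | ∀ i, x i ∈ S} := by
  rw [Set.ofPred_forall]
  exact MeasurableSet.iInter fun i => measurable_pi_apply i hS

lemma volume_sum_mem_le {S : Set (Fin n → ℝ)} (hS : MeasurableSet S) {e : Fin r → ℝ}
    {a b : Fin r} (hab : a ≠ b) (ha : |e a| = 1) (hb : |e b| = 1) :
    volume {x : Fin r → Fin n → ℝ | (∀ i, x i ∈ S) ∧ ∑ j, e j • x j ∈ S} ≤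
      ENNReal.ofReal youngConst ^ n * volume S ^ r := by
  classical
  set C := ENNReal.ofReal youngConst ^ n
  set A := {x : Fin r → Fin n → ℝ | ∀ i, x i ∈ S}
  have hA : MeasurableSet A := measurableSet_forall_mem r hS
  have hB : MeasurableSet {x : Fin r → Fin n → ℝ | (∀ i, x i ∈ S) ∧ ∑ j, e j • x j ∈ S} :=
    hA.inter ((by fun_prop : Measurable fun x : Fin r → Fin n → ℝ => ∑ j, e j • x j) hS)
  set B := {x : Fin r → Fin n → ℝ | (∀ i, x i ∈ S) ∧ ∑ j, e j • x j ∈ S}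
  have hBm : Measurable (B.indicator (1 : (Fin r → Fin n → ℝ) → ℝ≥0∞)) :=
    measurable_one.indicator hB
  have hAm : Measurable (fun x => C * A.indicator (1 : (Fin r → Fin n → ℝ) → ℝ≥0∞) x) :=
    (measurable_one.indicator hA).const_mul C
  have hS1 : Measurable (S.indicator (1 : (Fin n → ℝ) → ℝ≥0∞)) := measurable_one.indicator hS
  have key : lmarginal (fun _ => volume) {a, b} (B.indicator (1 : (Fin r → Fin n → ℝ) → ℝ≥0∞)) ≤
      lmarginal (fun _ => volume) {a, b} (fun x => C * A.indicator 1 x) := by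
    intro x
    rw [lmarginal_insert _ hBm (by simpa using hab), lmarginal_insert _ hAm (by simpa using hab)]
    simp only [lmarginal_singleton]
    by_cases hx : ∀ i, i ≠ a → i ≠ b → x i ∈ S
    · have hu : ∀ s t : Fin n → ℝ, ∀ i, Function.update (Function.update x a s) b t i =
          if i = b then t else if i = a then s else x i := fun s t i => by
        simp [Function.update_apply]
      have hmem : ∀ s t : Fin n → ℝ, Function.update (Function.update x a s) b t ∈ A ↔
          s ∈ S ∧ t ∈ S := by
        intro s t
        constructor
        · intro h
          refine ⟨by simpa [hab] using h a, by simpa using h b⟩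
        · rintro ⟨hs, ht⟩ i
          rw [hu]
          split_ifs with h1 h2
          exacts [ht, hs, hx i h2 h1]
      have hR : ∫⁻ s, ∫⁻ t, C * A.indicator 1 (Function.update (Function.update x a s) b t) =
          C * volume S ^ 2 := by
        have h1 : ∀ s t : Fin n → ℝ,
            A.indicator (1 : (Fin r → Fin n → ℝ) → ℝ≥0∞)
              (Function.update (Function.update x a s) b t) =
            S.indicator 1 s * S.indicator 1 t := fun s t => by
          by_cases hs : s ∈ S <;> by_cases ht : t ∈ S <;> simp [hmem, hs, ht]
        simp_rw [h1]
        have h2 : ∀ s : Fin n → ℝ, ∫⁻ t, C * (S.indicator (1 : (Fin n → ℝ) → ℝ≥0∞) s *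
            S.indicator 1 t) = C * volume S * S.indicator 1 s := fun s => by
          rw [lintegral_const_mul _ (by fun_prop), lintegral_const_mul _ hS1,
            lintegral_indicator_one hS]
          ring
        simp_rw [h2]
        rw [lintegral_const_mul _ hS1, lintegral_indicator_one hS]
        ring
      refine le_of_le_of_eq ?_ hR.symm
      set w : Fin n → ℝ := ∑ j ∈ Finset.univ \ {a, b}, e j • x j
      have hsum : ∀ s t : Fin n → ℝ,
          ∑ j, e j • Function.update (Function.update x a s) b t j = e a • s + e b • t + w := by
        intro s t
        rw [← Finset.sum_sdiff (Finset.subset_univ {a, b}), Finset.sum_pair hab, add_comm]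
        congr 1
        · simp [hab]
        · refine Finset.sum_congr rfl fun j hj => ?_
          simp only [Finset.mem_sdiff, Finset.mem_univ, true_and, Finset.mem_insert,
            Finset.mem_singleton, not_or] at hj
          rw [hu, if_neg hj.2, if_neg hj.1]
      refine le_trans (lintegral_mono fun s => lintegral_mono fun t => ?_)
        (lintegral_indicator_young_affine hS ha hb w)
      by_cases h : Function.update (Function.update x a s) b t ∈ B
      · have h1 := (hmem s t).1 h.1
        have h2 := h.2
        rw [hsum] at h2
        simp [h, h1, h2]
      · simp [h]
    · push Not at hx
      obtain ⟨i, hia, hib, hi⟩ := hx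
      have h0 : ∀ s t : Fin n → ℝ, Function.update (Function.update x a s) b t ∉ B :=
        fun s t h => hi (by simpa [hia, hib] using h.1 i)
      simp [h0]
  have h := lmarginal_le_of_subset (Finset.subset_univ _) hBm hAm key
  simp only [lmarginal_univ] at h
  have hcoeff := h 0
  simp only at hcoeff
  rw [← volume_pi, lintegral_indicator_one hB, lintegral_const_mul _ (measurable_one.indicator hA),
    lintegral_indicator_one hA, volume_forall_mem] at hcoeff
  exact hcoeff

/-- The weight of an integer coefficient in the sum over all linear relations. -/
def relWeight (k : ℤ) : ℝ≥0∞ := (max 1 (k.natAbs : ℝ≥0∞) ^ 2)⁻¹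

lemma relWeight_of_abs_le {k : ℤ} (hk : |k| ≤ 1) : relWeight k = 1 := by
  have h : (k.natAbs : ℝ≥0∞) ≤ 1 := by
    have : k.natAbs ≤ 1 := by
      have := Int.abs_eq_natAbs k
      omega
    exact_mod_cast this
  rw [relWeight, max_eq_left h]
  simp

/-- The bound on the contribution of a single relation, up to weights. -/
def relError (n K : ℕ) : ℝ≥0∞ := ENNReal.ofReal youngConst ^ n + (2 ^ (n - 2 * K))⁻¹

lemma siegel_eq_zero_of_forall {W : Set (Fin (r + 1) → Fin n → ℤ)}
    {f : (Fin (r + 1) → Fin n → ℝ) → ℝ≥0∞}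
    (h : ∀ v ∈ W, ∀ g : SLR n, f (tupleAct g (tupleCast v)) = 0) (L : LatticeSpace n) :
    siegel W f L = 0 := by
  simp only [siegel, latSum, ENNReal.tsum_eq_zero]
  exact fun v => h v.1 v.2 _

variable {μ : Measure (LatticeSpace n)} [IsProbabilityMeasure μ]

lemma lintegral_siegel_relationSet_le_volume
    (hμ : ∀ g : SLR n, Measure.map (fun x => g • x) μ = μ) (hr : r < n) {S : Set (Fin n → ℝ)}
    (hS : MeasurableSet S) {c : Fin (r + 1) → ℤ} (hc : Finset.univ.gcd c = 1)
    {k : Fin (r + 1)} (h0 : c 0 ≠ 0) (hk : c k ≠ 0) :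
    ∫⁻ L, siegel (relationSet n c) ((dependentSet r S).indicator 1) L ∂μ ≤
      (((c k).natAbs : ℝ≥0∞) ^ n)⁻¹ * volume (completableSet S c k) := by
  have hM : 0 < (c k).natAbs := Int.natAbs_pos.2 hk
  obtain ⟨b, hb⟩ := Finset.gcd_eq_sum_mul (s := Finset.univ) (f := c)
  rw [hc, Fin.sum_univ_succAbove _ k] at hb
  have hdens : HasUpperDensity (congruenceSet n (fun j => c (k.succAbove j)) (c k).natAbs)
      ((((c k).natAbs : ℝ≥0∞) ^ n)⁻¹) := by
    refine hasUpperDensity_congruenceSet _ (fun j => b (k.succAbove j)) hM ?_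
    rw [Int.natAbs_dvd]
    exact ⟨-b k, by linarith⟩
  have hE : MeasurableSet (completableSet S c k ∩ {x | LinearIndependent ℝ x}) :=
    (measurableSet_completableSet hS c k).inter measurableSet_linearIndependent
  refine (lintegral_mono fun L => siegel_relationSet_le h0 hk L).trans
    ((lintegral_siegel_le hμ (by simpa using hr) (isSLZInvariant_congruenceSet _ _) hdens
      (by simp [hk]) (measurable_one.indicator hE) fun x hx =>
        Set.indicator_of_notMem (fun h => hx h.2) _).trans ?_)
  rw [lintegral_indicator_one hE]
  gcongr
  exact Set.inter_subset_left

lemma lintegral_siegel_relationSet_le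
    (hμ : ∀ g : SLR n, Measure.map (fun x => g • x) μ = μ) {K : ℕ} (hrK : r + 1 ≤ K)
    (hK : 2 * K ≤ n) {S : Set (Fin n → ℝ)} (hS : MeasurableSet S) (hSS : S ∩ (-S) = ∅)
    {c : Fin (r + 1) → ℤ} (hc : Finset.univ.gcd c = 1) :
    ∫⁻ L, siegel (relationSet n c) ((dependentSet r S).indicator 1) L ∂μ ≤
      relError n K * volume S ^ r * ∏ i, relWeight (c i) := by
  by_cases hex : ∃ v ∈ relationSet n c, ∃ g : SLR n, tupleAct g (tupleCast v) ∈ dependentSet r S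
  swap
  · push Not at hex
    simp_rw [siegel_eq_zero_of_forall (f := (dependentSet r S).indicator 1)
      fun v hv g => Set.indicator_of_notMem (hex v hv g) _]
    simp
  obtain ⟨v, hv, g, hy⟩ := hex
  have hrel := sum_smul_tupleAct hv g
  have h0 := ne_zero_of_linearIndependent_tail hy.2.1 hc hrel
  by_cases h1 : ∀ i, |c i| ≤ 1
  · obtain ⟨a, b, hab, ha, hb⟩ := exists_tail_ne_zero hSS hy hrel h0 h1
    have habs : ∀ i, c i ≠ 0 → |(c i : ℝ)| = 1 := fun i hi => by
      have h2 : |c i| = 1 := le_antisymm (h1 i) (Int.one_le_abs hi)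
      exact_mod_cast h2
    have hvol : volume (completableSet S c 0) ≤ ENNReal.ofReal youngConst ^ n * volume S ^ r := by
      have h3 : completableSet S c 0 = {x : Fin r → Fin n → ℝ |
          (∀ i, x i ∈ S) ∧ ∑ j, (-((c j.succ : ℝ) / c 0)) • x j ∈ S} := by
        ext x
        simp [completableSet]
      rw [h3]
      refine volume_sum_mem_le hS hab ?_ ?_ <;>
        rw [abs_neg, abs_div, habs _ h0, habs _ (by assumption), div_one]
    have hM : (c 0).natAbs = 1 := by
      have h2 : |c 0| = 1 := le_antisymm (h1 0) (Int.one_le_abs h0)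
      have := Int.abs_eq_natAbs (c 0)
      omega
    refine (lintegral_siegel_relationSet_le_volume hμ (by omega) hS hc h0 h0).trans ?_
    rw [Finset.prod_eq_one fun i _ => relWeight_of_abs_le (h1 i), hM]
    simp only [Nat.cast_one, one_pow, inv_one, one_mul, mul_one]
    refine hvol.trans ?_
    gcongr
    exact le_self_add
  · push Not at h1
    obtain ⟨i, hi⟩ := h1
    obtain ⟨k, -, hk⟩ := Finset.exists_max_image Finset.univ (fun i => (c i).natAbs)
      Finset.univ_nonempty
    have hM : 2 ≤ (c k).natAbs := by
      have := hk i (Finset.mem_univ i)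
      have := Int.abs_eq_natAbs (c i)
      omega
    have hk0 : c k ≠ 0 := by omega
    refine (lintegral_siegel_relationSet_le_volume hμ (by omega) hS hc h0 hk0).trans ?_
    set M := (c k).natAbs
    have hM2 : (2 : ℝ≥0∞) ≤ M := by exact_mod_cast hM
    have hM1 : (1 : ℝ≥0∞) ≤ M := by exact_mod_cast (by omega : 1 ≤ M)
    have hvol : volume (completableSet S c k) ≤ volume S ^ r := by
      rw [← volume_forall_mem]
      exact measure_mono fun x hx => hx.1
    have hw : (((M : ℝ≥0∞) ^ 2)⁻¹) ^ K ≤ ∏ i, relWeight (c i) := by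
      calc (((M : ℝ≥0∞) ^ 2)⁻¹) ^ K ≤ (((M : ℝ≥0∞) ^ 2)⁻¹) ^ (r + 1) := by
            refine pow_le_pow_right_of_le_one' ?_ hrK
            exact ENNReal.inv_le_one.2 (one_le_pow₀ hM1)
        _ = ∏ i : Fin (r + 1), ((M : ℝ≥0∞) ^ 2)⁻¹ := by simp
        _ ≤ _ := by
            refine Finset.prod_le_prod' fun i _ => ?_
            rw [relWeight]
            gcongr
            refine max_le hM1 ?_
            exact_mod_cast hk i (Finset.mem_univ i)
    have hpow : ((M : ℝ≥0∞) ^ n)⁻¹ ≤ (2 ^ (n - 2 * K))⁻¹ * (((M : ℝ≥0∞) ^ 2)⁻¹) ^ K := by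
      have h2 : (M : ℝ≥0∞) ^ n = M ^ (n - 2 * K) * M ^ (2 * K) := by
        rw [← pow_add]
        congr 1
        omega
      rw [h2, ENNReal.mul_inv (by simp) (by simp), ← ENNReal.inv_pow, ← pow_mul]
      gcongr
    calc ((M : ℝ≥0∞) ^ n)⁻¹ * volume (completableSet S c k)
        ≤ ((2 ^ (n - 2 * K))⁻¹ * (((M : ℝ≥0∞) ^ 2)⁻¹) ^ K) * volume S ^ r := by gcongr
      _ ≤ (relError n K * ∏ i, relWeight (c i)) * volume S ^ r := by
          gcongr
          exact le_add_self
      _ = _ := by ring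

/-- The sum of the weights of all integers. -/
def relWeightSum : ℝ≥0∞ := ∑' k : ℤ, relWeight k

lemma tsum_prod_relWeight (m : ℕ) :
    ∑' c : Fin m → ℤ, ∏ i, relWeight (c i) = relWeightSum ^ m := by
  induction m with
  | zero => simp
  | succ m ih =>
    rw [← (Fin.consEquiv fun _ : Fin (m + 1) => ℤ).tsum_eq, ENNReal.tsum_prod']
    simp_rw [Fin.prod_univ_succ]
    simp only [Fin.consEquiv_apply, Fin.cons_zero, Fin.cons_succ, ENNReal.tsum_mul_left, ih,
      ENNReal.tsum_mul_right]
    rw [pow_succ']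
    rfl

lemma relWeightSum_ne_top : relWeightSum ≠ ∞ := by
  have h1 : ∑' k : ℤ, ENNReal.ofReal (1 / (k : ℝ) ^ 2) ≠ ∞ :=
    (Real.summable_one_div_int_pow.2 one_lt_two).tsum_ofReal_ne_top
  have h2 : ∑' k : ℤ, (if k = 0 then (1 : ℝ≥0∞) else 0) = 1 := tsum_ite_eq 0 fun _ => 1
  refine ne_top_of_le_ne_top (ENNReal.add_ne_top.2 ⟨ENNReal.one_ne_top, h1⟩) ?_
  rw [← h2, ← ENNReal.tsum_add]
  refine ENNReal.tsum_le_tsum fun k => ?_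
  by_cases hk : k = 0
  · simp [hk, relWeight]
  · have hk' : 0 < (k.natAbs : ℝ) := by exact_mod_cast Int.natAbs_pos.2 hk
    have h3 : (k : ℝ) ^ 2 = (k.natAbs : ℝ) ^ 2 := by
      rw [Nat.cast_natAbs, Int.cast_abs, sq_abs]
    rw [if_neg hk, zero_add, relWeight, h3, one_div, ENNReal.ofReal_inv_of_pos (by positivity),
      ENNReal.ofReal_pow hk'.le, ENNReal.ofReal_natCast]
    gcongr
    exact le_max_right _ _

theorem lintegral_siegel_dependentSet_le
    (hμ : ∀ g : SLR n, Measure.map (fun x => g • x) μ = μ) {K : ℕ} (hrK : r + 1 ≤ K)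
    (hK : 2 * K ≤ n) {S : Set (Fin n → ℝ)} (hS : MeasurableSet S) (hSS : S ∩ (-S) = ∅) :
    ∫⁻ L, siegel Set.univ ((dependentSet r S).indicator 1) L ∂μ ≤
      relError n K * volume S ^ r * relWeightSum ^ (r + 1) := by
  classical
  set f : (Fin (r + 1) → Fin n → ℝ) → ℝ≥0∞ := (dependentSet r S).indicator 1
  have hf : Measurable f := measurable_one.indicator (measurableSet_dependentSet hS)
  have hle : ∀ L : LatticeSpace n, siegel Set.univ f L ≤
      ∑' c : {c : Fin (r + 1) → ℤ // Finset.univ.gcd c = 1}, siegel (relationSet n c.1) f L := by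
    intro L
    unfold siegel latSum
    set g := Quotient.out (α := SLR n) L
    have h1 : ∀ W : Set (Fin (r + 1) → Fin n → ℤ), ∑' v : W, f (tupleAct g (tupleCast v.1)) =
        ∑' v, W.indicator (fun v => f (tupleAct g (tupleCast v))) v := fun W =>
      tsum_subtype W fun v => f (tupleAct g (tupleCast v))
    simp_rw [h1]
    rw [ENNReal.tsum_comm]
    refine ENNReal.tsum_le_tsum fun v => ?_
    by_cases hy : tupleAct g (tupleCast v) ∈ dependentSet r S
    · obtain ⟨c, hc, hv⟩ := exists_primitive_relation g hy.2.2.1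
      refine le_trans ?_ (ENNReal.le_tsum ⟨c, hc⟩)
      rw [Set.indicator_of_mem (Set.mem_univ v), Set.indicator_of_mem hv]
    · have : f (tupleAct g (tupleCast v)) = 0 := Set.indicator_of_notMem hy _
      simp [this]
  calc ∫⁻ L, siegel Set.univ f L ∂μ
      ≤ ∫⁻ L, ∑' c : {c : Fin (r + 1) → ℤ // Finset.univ.gcd c = 1},
          siegel (relationSet n c.1) f L ∂μ := lintegral_mono hle
    _ = ∑' c : {c : Fin (r + 1) → ℤ // Finset.univ.gcd c = 1},
          ∫⁻ L, siegel (relationSet n c.1) f L ∂μ :=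
        lintegral_tsum fun c =>
          (measurable_siegel (isSLZInvariant_relationSet c.1) hf).aemeasurable
    _ ≤ ∑' c : {c : Fin (r + 1) → ℤ // Finset.univ.gcd c = 1},
          relError n K * volume S ^ r * ∏ i, relWeight (c.1 i) :=
        ENNReal.tsum_le_tsum fun c => lintegral_siegel_relationSet_le hμ hrK hK hS hSS c.2
    _ ≤ ∑' c : Fin (r + 1) → ℤ, relError n K * volume S ^ r * ∏ i, relWeight (c i) :=
        ENNReal.tsum_comp_le_tsum_of_injective Subtype.val_injective
          fun c : Fin (r + 1) → ℤ => relError n K * volume S ^ r * ∏ i, relWeight (c i)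
    _ = _ := by rw [ENNReal.tsum_mul_left, tsum_prod_relWeight]

end RelationBounds

section InclusionExclusion

open Finset

variable {α : Type*} [DecidableEq α]

/-- The Möbius transform of a function on finite sets. -/
def moebiusSum (φ : Finset α → ℝ) (T : Finset α) : ℝ :=
  ∑ A ∈ T.powerset, (-1) ^ (#T - #A) * φ A

omit [DecidableEq α] in
lemma abs_moebiusSum_le {φ : Finset α → ℝ} (hφ : ∀ A, |φ A| ≤ 1) (T : Finset α) :
    |moebiusSum φ T| ≤ 2 ^ #T := by
  refine (abs_sum_le_sum_abs _ _).trans ?_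
  refine (sum_le_sum (g := fun _ => (1 : ℝ)) fun A _ => ?_).trans (by simp)
  simpa [abs_mul] using hφ A

lemma sum_moebiusSum (φ : Finset α → ℝ) (Z : Finset α) :
    ∑ T ∈ Z.powerset, moebiusSum φ T = φ Z := by
  simp only [moebiusSum]
  rw [sum_comm' (t' := Z.powerset) (s' := fun A => Icc A Z)
    (by intro T A; simp only [mem_powerset, mem_Icc]
        constructor
        · rintro ⟨h1, h2⟩; exact ⟨⟨h2, h1⟩, h2.trans h1⟩
        · rintro ⟨⟨h1, h2⟩, -⟩; exact ⟨h2, h1⟩)]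
  rw [sum_eq_single_of_mem Z (mem_powerset_self Z)]
  · simp
  intro A hA hne
  rw [mem_powerset] at hA
  rw [← sum_mul, Icc_eq_image_powerset hA, sum_image]
  · have h1 : ∀ U ∈ (Z \ A).powerset, (-1 : ℝ) ^ (#(A ∪ U) - #A) = (-1) ^ #U := by
      intro U hU
      rw [mem_powerset] at hU
      rw [card_union_of_disjoint (disjoint_of_subset_right hU disjoint_sdiff),
        Nat.add_sub_cancel_left]
    rw [sum_congr rfl h1]
    have h2 : ∑ U ∈ (Z \ A).powerset, (-1 : ℤ) ^ #U = 0 := by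
      refine sum_powerset_neg_one_pow_card_of_nonempty ?_
      rw [sdiff_nonempty]
      exact fun h => hne (hA.antisymm h)
    have h3 : ∑ U ∈ (Z \ A).powerset, (-1 : ℝ) ^ #U = 0 := by exact_mod_cast h2
    rw [h3, zero_mul]
  · intro U hU V hV h
    simp only [coe_powerset, Set.mem_preimage, Set.mem_powerset_iff, coe_subset] at hU hV
    have h1 := congrArg (· \ A) h
    simp only [union_sdiff_left] at h1
    rwa [sdiff_eq_self_of_disjoint (disjoint_of_subset_left hU sdiff_disjoint),
      sdiff_eq_self_of_disjoint (disjoint_of_subset_left hV sdiff_disjoint)] at h1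

omit [DecidableEq α] in
lemma sum_two_pow_card_powerset (X : Finset α) : ∑ T ∈ X.powerset, (2 : ℝ) ^ #T = 3 ^ #X := by
  have := Finset.sum_pow_mul_eq_add_pow (2 : ℝ) 1 X
  simp only [one_pow, mul_one] at this
  rw [this]
  norm_num

lemma sum_biUnion_le_of_nonneg' {β γ : Type*} [DecidableEq γ] (s : Finset β) (t : β → Finset γ)
    (f : γ → ℝ) (hf : ∀ c, 0 ≤ f c) : ∑ c ∈ s.biUnion t, f c ≤ ∑ b ∈ s, ∑ c ∈ t b, f c := by
  classical
  induction s using Finset.induction_on with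
  | empty => simp
  | insert b s hb ih =>
    rw [biUnion_insert, sum_insert hb]
    refine le_trans ?_ (add_le_add_right ih _)
    rw [← sum_union_inter]
    exact le_add_of_nonneg_right (sum_nonneg fun c _ => hf c)

lemma sum_two_pow_card_le_of_cover {A P : Finset (Finset α)} {Q : ℕ → Finset (Finset α)} {K : ℕ}
    (hP : ∀ X ∈ P, #X = K) (hQ : ∀ r, ∀ X ∈ Q r, #X = r)
    (h : ∀ T ∈ A, ∃ X ∈ P ∪ (range K).biUnion Q, T ⊆ X) :
    ∑ T ∈ A, (2 : ℝ) ^ #T ≤ 3 ^ K * #P + ∑ r ∈ range K, (3 : ℝ) ^ r * #(Q r) := by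
  calc ∑ T ∈ A, (2 : ℝ) ^ #T
      ≤ ∑ T ∈ (P ∪ (range K).biUnion Q).biUnion powerset, (2 : ℝ) ^ #T := by
        refine sum_le_sum_of_subset_of_nonneg (fun T hT => ?_) fun _ _ _ => by positivity
        obtain ⟨X, hX, hTX⟩ := h T hT
        exact mem_biUnion.2 ⟨X, hX, mem_powerset.2 hTX⟩
    _ ≤ ∑ X ∈ P ∪ (range K).biUnion Q, ∑ T ∈ X.powerset, (2 : ℝ) ^ #T :=
        sum_biUnion_le_of_nonneg' _ _ _ fun _ => by positivity
    _ = ∑ X ∈ P ∪ (range K).biUnion Q, (3 : ℝ) ^ #X := by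
        simp_rw [sum_two_pow_card_powerset]
    _ ≤ ∑ X ∈ P, (3 : ℝ) ^ #X + ∑ X ∈ (range K).biUnion Q, (3 : ℝ) ^ #X := by
        rw [← sum_union_inter (s₁ := P)]
        exact le_add_of_nonneg_right (sum_nonneg fun _ _ => by positivity)
    _ ≤ ∑ X ∈ P, (3 : ℝ) ^ #X + ∑ r ∈ range K, ∑ X ∈ Q r, (3 : ℝ) ^ #X := by
        gcongr
        exact sum_biUnion_le_of_nonneg' _ _ _ fun _ => by positivity
    _ = _ := by
        have h1 : ∀ (R : Finset (Finset α)) (m : ℕ), (∀ X ∈ R, #X = m) →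
            ∑ X ∈ R, (3 : ℝ) ^ #X = 3 ^ m * #R := fun R m hR => by
          rw [sum_congr rfl fun X hX => congrArg _ (hR X hX), sum_const, nsmul_eq_mul, mul_comm]
        rw [h1 P K hP, sum_congr rfl fun r _ => h1 (Q r) r (hQ r)]

lemma exists_superset_of_independent {I : Finset α → Prop} (hI : ∀ X Y, X ⊆ Y → I Y → I X)
    {Z T : Finset α} {K : ℕ} (hZ : ¬(I Z ∧ #Z ≤ K)) (hTZ : T ⊆ Z) (hTK : #T ≤ K) (hIT : I T) :
    (∃ X, T ⊆ X ∧ (X ⊆ Z ∧ #X = K) ∧ I X) ∨ ∃ X r, r < K ∧ T ⊆ X ∧ (X ⊆ Z ∧ #X = r) ∧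
      I X ∧ ∃ z ∈ Z, z ∉ X ∧ ¬I (insert z X) := by
  classical
  obtain ⟨Y, hY, hmax⟩ := exists_max_image {Y ∈ Z.powerset | T ⊆ Y ∧ I Y} card
    ⟨T, by simp [hTZ, hIT]⟩
  simp only [mem_filter, mem_powerset] at hY hmax
  obtain ⟨hYZ, hTY, hIY⟩ := hY
  by_cases hYK : K ≤ #Y
  · obtain ⟨X, hTX, hXY, hX⟩ := exists_subsuperset_card_eq hTY hTK hYK
    exact Or.inl ⟨X, hTX, ⟨hXY.trans hYZ, hX⟩, hI X Y hXY hIY⟩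
  · obtain ⟨z, hz, hzY⟩ : ∃ z ∈ Z, z ∉ Y := by
      by_contra! h
      have : Y = Z := hYZ.antisymm h
      subst this
      exact hZ ⟨hIY, by omega⟩
    refine Or.inr ⟨Y, #Y, by omega, hTY, ⟨hYZ, rfl⟩, hIY, z, hz, hzY, fun h => ?_⟩
    have := hmax (insert z Y) ⟨insert_subset hz hYZ, hTY.trans (subset_insert z Y), h⟩
    rw [card_insert_of_notMem hzY] at this
    omega

open Classical in
theorem abs_sub_sum_moebiusSum_le {I : Finset α → Prop} (hI0 : I ∅)
    (hI : ∀ X Y, X ⊆ Y → I Y → I X) {φ : Finset α → ℝ} (hφ : ∀ A, |φ A| ≤ 1)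
    (Z : Finset α) (K : ℕ) :
    |φ Z - ∑ k ∈ range (K + 1), ∑ T ∈ powersetCard k Z with I T, moebiusSum φ T| ≤
      2 * (3 ^ K * #{T ∈ powersetCard K Z | I T} +
        ∑ r ∈ range K, (3 : ℝ) ^ r * #{X ∈ powersetCard r Z | I X ∧ ∃ z ∈ Z, z ∉ X ∧ ¬I (insert z X)}) := by
  have hΦ : ∑ k ∈ range (K + 1), ∑ T ∈ powersetCard k Z with I T, moebiusSum φ T =
      ∑ T ∈ Z.powerset with #T ≤ K ∧ I T, moebiusSum φ T := by
    rw [← sum_fiberwise_of_maps_to (s := {T ∈ Z.powerset | #T ≤ K ∧ I T}) (t := range (K + 1))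
      (g := fun T => #T) (by intro T hT; simp at hT ⊢; omega)]
    refine sum_congr rfl fun k hk => sum_congr ?_ fun _ _ => rfl
    ext T
    simp only [mem_filter, mem_powersetCard, mem_powerset, mem_range] at hk ⊢
    constructor
    · rintro ⟨⟨h1, h2⟩, h3⟩; exact ⟨⟨h1, by omega, h3⟩, h2⟩
    · rintro ⟨⟨h1, -, h3⟩, h2⟩; exact ⟨⟨h1, h2⟩, h3⟩
  rw [hΦ]
  set P := {T ∈ powersetCard K Z | I T}
  set Q := fun r => {X ∈ powersetCard r Z | I X ∧ ∃ z ∈ Z, z ∉ X ∧ ¬I (insert z X)}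
  by_cases hZ : I Z ∧ #Z ≤ K
  · have h1 : {T ∈ Z.powerset | #T ≤ K ∧ I T} = Z.powerset := by
      refine filter_true_of_mem fun T hT => ?_
      rw [mem_powerset] at hT
      exact ⟨(card_le_card hT).trans hZ.2, hI T Z hT hZ.1⟩
    rw [h1, sum_moebiusSum, sub_self, abs_zero]
    exact mul_nonneg (by norm_num) (add_nonneg (mul_nonneg (by positivity) (Nat.cast_nonneg _))
      (sum_nonneg fun r _ => mul_nonneg (by positivity) (Nat.cast_nonneg _)))
  have hsum : ∑ T ∈ Z.powerset with #T ≤ K ∧ I T, (2 : ℝ) ^ #T ≤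
      3 ^ K * #P + ∑ r ∈ range K, (3 : ℝ) ^ r * #(Q r) := by
    refine sum_two_pow_card_le_of_cover (fun X hX => (mem_powersetCard.1 (mem_filter.1 hX).1).2)
      (fun r X hX => (mem_powersetCard.1 (mem_filter.1 hX).1).2) fun T hT => ?_
    simp only [mem_filter, mem_powerset] at hT
    rcases exists_superset_of_independent hI hZ hT.1 hT.2.1 hT.2.2 with ⟨X, hTX, hX⟩ | h
    · exact ⟨X, mem_union_left _ (by simpa [P] using hX), hTX⟩
    · obtain ⟨X, r, hr, hTX, hX⟩ := h
      exact ⟨X, mem_union_right _ (mem_biUnion.2 ⟨r, by simpa using hr,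
        by simpa [Q] using hX⟩), hTX⟩
  have hone : (1 : ℝ) ≤ ∑ T ∈ Z.powerset with #T ≤ K ∧ I T, (2 : ℝ) ^ #T := by
    have := single_le_sum (f := fun T : Finset α => (2 : ℝ) ^ #T) (fun T _ => by positivity)
      (show ∅ ∈ {T ∈ Z.powerset | #T ≤ K ∧ I T} by simp [hI0])
    simpa using this
  have hΦ' : |∑ T ∈ Z.powerset with #T ≤ K ∧ I T, moebiusSum φ T| ≤
      ∑ T ∈ Z.powerset with #T ≤ K ∧ I T, (2 : ℝ) ^ #T :=
    (abs_sum_le_sum_abs _ _).trans (sum_le_sum fun T _ => abs_moebiusSum_le hφ T)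
  have := abs_sub (φ Z) (∑ T ∈ Z.powerset with #T ≤ K ∧ I T, moebiusSum φ T)
  have := hφ Z
  linarith

open Classical in
/-- Summing over injective tuples counts every subset with all its orderings. -/
lemma sum_injective_piFinset {M : Type*} [AddCommMonoid M] (Z : Finset α) (k : ℕ)
    (F : Finset α → M) :
    ∑ y ∈ Fintype.piFinset (fun _ : Fin k => Z) with Function.Injective y, F (univ.image y) =
      k.factorial • ∑ T ∈ powersetCard k Z, F T := by
  rw [← sum_fiberwise_of_maps_to (t := powersetCard k Z) (g := fun y => univ.image y), smul_sum]
  · refine sum_congr rfl fun T hT => ?_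
    rw [mem_powersetCard] at hT
    rw [sum_congr rfl fun y hy => by rw [(mem_filter.1 hy).2], sum_const]
    congr 1
    have e : Fin k ≃ T := (Fintype.equivFinOfCardEq (by simpa using hT.2)).symm
    have h := Fintype.card_equiv e
    rw [Fintype.card_fin] at h
    rw [← h, ← card_univ]
    symm
    refine card_bij (fun e _ i => (e i : α)) ?_ ?_ ?_
    · intro e _
      simp only [mem_filter, Fintype.mem_piFinset]
      refine ⟨⟨fun i => hT.1 (e i).2, Subtype.val_injective.comp e.injective⟩, ?_⟩
      ext x
      simp only [mem_image, mem_univ, true_and]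
      constructor
      · rintro ⟨i, rfl⟩; exact (e i).2
      · intro hx; exact ⟨e.symm ⟨x, hx⟩, by simp⟩
    · intro e _ e' _ h
      ext i
      exact congrFun h i
    · intro y hy
      simp only [mem_filter, Fintype.mem_piFinset] at hy
      obtain ⟨⟨-, hinj⟩, him⟩ := hy
      have hmem : ∀ i, y i ∈ T := fun i => him ▸ mem_image_of_mem y (mem_univ i)
      refine ⟨Equiv.ofBijective (fun i => ⟨y i, hmem i⟩) ⟨fun i j h => ?_, fun x => ?_⟩,
        mem_univ _, rfl⟩
      · exact hinj (congrArg Subtype.val h)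
      · obtain ⟨i, -, hi⟩ := mem_image.1 (him.symm ▸ x.2 : (x : α) ∈ univ.image y)
        exact ⟨i, Subtype.ext hi⟩
  · intro y hy
    simp only [mem_filter, Fintype.mem_piFinset] at hy
    rw [mem_powersetCard]
    refine ⟨fun x hx => ?_, by rw [card_image_of_injective _ hy.2]; simp⟩
    obtain ⟨i, -, rfl⟩ := mem_image.1 hx
    exact hy.1 i

lemma sum_powerset_univ_image {k : ℕ} {y : Fin k → α} (hy : Function.Injective y)
    (φ : Finset α → ℝ) :
    ∑ s : Finset (Fin k), (-1) ^ (k - #s) * φ (s.image y) = moebiusSum φ (univ.image y) := by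
  rw [moebiusSum]
  refine sum_bij (fun s _ => s.image y) (fun s _ => ?_) (fun s _ t _ h => ?_) (fun A hA => ?_)
    (fun s _ => ?_)
  · exact mem_powerset.2 (image_subset_image (subset_univ s))
  · exact image_injective hy h
  · obtain ⟨s, -, hs⟩ := subset_image_iff.1 (mem_powerset.1 hA)
    exact ⟨s, mem_univ s, hs⟩
  · simp [card_image_of_injective _ hy]

end InclusionExclusion

section LatticePoints

variable {n k r : ℕ} {S : Set (Fin n → ℝ)}

lemma tupleAct_tupleCast_injective {ι : Type*} (g : SLR n) :
    Function.Injective fun v : ι → Fin n → ℤ => tupleAct g (tupleCast v) := by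
  intro v w h
  funext i j
  have h1 := congrFun h i
  have h2 : Function.Injective g.1.mulVec := Matrix.mulVec_injective_of_isUnit
    ((Matrix.isUnit_iff_isUnit_det _).2 (by rw [g.2]; exact isUnit_one))
  have h3 : ((v i j : ℤ) : ℝ) = w i j := congrFun (h2 h1) j
  exact_mod_cast h3

lemma siegel_univ_eq_sum {L : LatticeSpace n} {Z : Finset (Fin n → ℝ)}
    (hZ : (Z : Set (Fin n → ℝ)) = latticeOf L ∩ S) {f : (Fin k → Fin n → ℝ) → ℝ≥0∞}
    (hf : ∀ y, (∃ i, y i ∉ S) → f y = 0) :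
    siegel Set.univ f L = ∑ y ∈ Fintype.piFinset fun _ => Z, f y := by
  classical
  unfold siegel latSum
  set g := Quotient.out (α := SLR n) L
  rw [tsum_univ fun v : Fin k → Fin n → ℤ => f (tupleAct g (tupleCast v))]
  set φ : (Fin k → Fin n → ℤ) → Fin k → Fin n → ℝ := fun v => tupleAct g (tupleCast v)
  have hφ : Function.Injective φ := tupleAct_tupleCast_injective g
  have hmem : ∀ y, (∀ i, y i ∈ latticeOf L) ↔ y ∈ Set.range φ := by
    intro y
    constructor
    · intro h
      choose v hv using h
      exact ⟨v, funext fun i => (hv i).symm⟩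
    · rintro ⟨v, rfl⟩ i
      exact ⟨v i, rfl⟩
  have h1 : ∀ v, f (φ v) = (Set.range φ).indicator f (φ v) := fun v => by
    rw [Set.indicator_of_mem (Set.mem_range_self v)]
  rw [show ∑' v, f (tupleAct g (tupleCast v)) = ∑' v, (Set.range φ).indicator f (φ v) from
    tsum_congr h1, hφ.tsum_eq (Set.support_indicator_subset)]
  have hZmem : ∀ y : Fin k → Fin n → ℝ, y ∈ Fintype.piFinset (fun _ => Z) ↔
      y ∈ Set.range φ ∧ ∀ i, y i ∈ S := by
    intro y
    rw [← hmem, Fintype.mem_piFinset, ← forall_and]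
    refine forall_congr' fun i => ?_
    rw [← Finset.mem_coe, hZ, Set.mem_inter_iff]
  rw [tsum_eq_sum (s := Fintype.piFinset fun _ => Z)]
  · refine Finset.sum_congr rfl fun y hy => ?_
    rw [Set.indicator_of_mem ((hZmem y).1 hy).1]
  · intro y hy
    rw [hZmem, not_and_or] at hy
    rcases hy with h | h
    · exact Set.indicator_of_notMem h _
    · push Not at h
      simp [Set.indicator_apply, hf y h]

open Classical in
lemma siegel_univ_indicator_eq_card {L : LatticeSpace n} {Z : Finset (Fin n → ℝ)}
    (hZ : (Z : Set (Fin n → ℝ)) = latticeOf L ∩ S) {A : Set (Fin k → Fin n → ℝ)}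
    (hA : ∀ y ∈ A, ∀ i, y i ∈ S) :
    siegel Set.univ (A.indicator 1) L =
      (((Fintype.piFinset fun _ => Z).filter (· ∈ A)).card : ℝ≥0∞) := by
  rw [siegel_univ_eq_sum hZ fun y ⟨i, hi⟩ => Set.indicator_of_notMem (fun h => hi (hA y h i)) _]
  rw [Finset.card_filter]
  push_cast
  exact Finset.sum_congr rfl fun y _ => by simp [Set.indicator_apply]

/-- The linear independence of a finite set of vectors. -/
def FinsetIndep (T : Finset (Fin n → ℝ)) : Prop := LinearIndepOn ℝ id (T : Set (Fin n → ℝ))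

lemma finsetIndep_image_iff [DecidableEq (Fin n → ℝ)] {y : Fin k → Fin n → ℝ} :
    LinearIndependent ℝ y ↔ Function.Injective y ∧ FinsetIndep (Finset.univ.image y) := by
  have h : ((Finset.univ.image y : Finset _) : Set (Fin n → ℝ)) = Set.range y := by simp
  unfold FinsetIndep
  rw [h]
  constructor
  · exact fun hy => ⟨hy.injective, hy.linearIndepOn_id⟩
  · rintro ⟨hinj, hy⟩
    exact (linearIndepOn_id_range_iff hinj).1 hy

lemma FinsetIndep.mono {X Y : Finset (Fin n → ℝ)} (h : X ⊆ Y) (hY : FinsetIndep Y) :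
    FinsetIndep X :=
  LinearIndepOn.mono hY (Finset.coe_subset.2 h)

lemma finsetIndep_empty : FinsetIndep (∅ : Finset (Fin n → ℝ)) := by
  simp [FinsetIndep]

/-- The linearly independent tuples in `S` whose entries at the positions in `s` form a
configuration in `𝒜`. -/
def patternSet (S : Set (Fin n → ℝ)) (𝒜 : Set (Set (Fin n → ℝ))) (s : Finset (Fin k)) :
    Set (Fin k → Fin n → ℝ) :=
  {y | (∀ i, y i ∈ S) ∧ LinearIndependent ℝ y ∧ Set.image y s ∈ 𝒜}

/-- The linearly independent tuples in `S`. -/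
def independentSet (k : ℕ) (S : Set (Fin n → ℝ)) : Set (Fin k → Fin n → ℝ) :=
  {y | (∀ i, y i ∈ S) ∧ LinearIndependent ℝ y}

open Classical in
/-- The indicator function of a collection of sets, on finite sets. -/
def collectionIndicator (𝒜 : Set (Set (Fin n → ℝ))) (T : Finset (Fin n → ℝ)) : ℝ :=
  if (T : Set (Fin n → ℝ)) ∈ 𝒜 then 1 else 0

open Classical in
lemma sum_siegel_patternSet {L : LatticeSpace n} {Z : Finset (Fin n → ℝ)}
    (hZ : (Z : Set (Fin n → ℝ)) = latticeOf L ∩ S) (𝒜 : Set (Set (Fin n → ℝ))) (k : ℕ) :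
    ∑ s : Finset (Fin k), (-1) ^ (k - s.card) *
      (siegel Set.univ ((patternSet S 𝒜 s).indicator 1) L).toReal =
    k.factorial * ∑ T ∈ Finset.powersetCard k Z with FinsetIndep T,
      moebiusSum (collectionIndicator 𝒜) T := by
  have hS : ∀ y ∈ Fintype.piFinset (fun _ : Fin k => Z), ∀ i, y i ∈ S := fun y hy i => by
    have h1 : y i ∈ (Z : Set (Fin n → ℝ)) := Fintype.mem_piFinset.1 hy i
    rw [hZ] at h1
    exact h1.2
  have h1 : ∀ s : Finset (Fin k),
      (siegel Set.univ ((patternSet S 𝒜 s).indicator 1) L).toReal =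
        ∑ y ∈ Fintype.piFinset (fun _ : Fin k => Z) with LinearIndependent ℝ y,
          collectionIndicator 𝒜 (s.image y) := by
    intro s
    rw [siegel_univ_indicator_eq_card hZ fun y hy => hy.1, ENNReal.toReal_natCast,
      Finset.card_filter, Finset.sum_filter]
    push_cast
    refine Finset.sum_congr rfl fun y hy => ?_
    simp only [patternSet, Set.mem_ofPred_eq, collectionIndicator, Finset.coe_image, hS y hy,
      implies_true, true_and]
    split_ifs <;> tauto
  have h2 : ∀ y ∈ (Fintype.piFinset fun _ : Fin k => Z).filter fun y => LinearIndependent ℝ y,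
      ∑ s : Finset (Fin k), (-1) ^ (k - s.card) * collectionIndicator 𝒜 (s.image y) =
        moebiusSum (collectionIndicator 𝒜) (Finset.univ.image y) := fun y hy =>
    sum_powerset_univ_image (Finset.mem_filter.1 hy).2.injective _
  rw [Finset.sum_congr rfl fun s _ => by rw [h1 s, Finset.mul_sum], Finset.sum_comm,
    Finset.sum_congr rfl h2, ← nsmul_eq_mul, Finset.sum_filter (s := Finset.powersetCard k Z),
    ← sum_injective_piFinset Z k fun T =>
      if FinsetIndep T then moebiusSum (collectionIndicator 𝒜) T else 0,
    ← Finset.sum_filter, Finset.filter_filter]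
  simp only [finsetIndep_image_iff]

open Classical in
lemma siegel_independentSet {L : LatticeSpace n} {Z : Finset (Fin n → ℝ)}
    (hZ : (Z : Set (Fin n → ℝ)) = latticeOf L ∩ S) (k : ℕ) :
    (siegel Set.univ ((independentSet k S).indicator 1) L).toReal =
    k.factorial * ((Finset.powersetCard k Z).filter FinsetIndep).card := by
  have hS : ∀ y ∈ Fintype.piFinset (fun _ : Fin k => Z), ∀ i, y i ∈ S := fun y hy i => by
    have h1 : y i ∈ (Z : Set (Fin n → ℝ)) := Fintype.mem_piFinset.1 hy i
    rw [hZ] at h1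
    exact h1.2
  rw [siegel_univ_indicator_eq_card hZ fun y hy => hy.1, ENNReal.toReal_natCast]
  norm_cast
  rw [Finset.card_filter (s := Finset.powersetCard k Z), ← smul_eq_mul,
    ← sum_injective_piFinset Z k fun T => if FinsetIndep T then 1 else 0, Finset.sum_filter,
    Finset.card_filter]
  refine Finset.sum_congr rfl fun y hy => ?_
  simp only [independentSet, Set.mem_ofPred_eq, hS y hy, implies_true, true_and,
    finsetIndep_image_iff]
  split_ifs <;> tauto

open Classical in
lemma le_siegel_dependentSet {L : LatticeSpace n} {Z : Finset (Fin n → ℝ)}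
    (hZ : (Z : Set (Fin n → ℝ)) = latticeOf L ∩ S) (r : ℕ) :
    r.factorial * ((Finset.powersetCard r Z).filter fun X => FinsetIndep X ∧
      ∃ z ∈ Z, z ∉ X ∧ ¬FinsetIndep (insert z X)).card ≤
    (siegel Set.univ ((dependentSet r S).indicator 1) L).toReal := by
  have hS : ∀ y ∈ Fintype.piFinset (fun _ : Fin (r + 1) => Z), ∀ i, y i ∈ S := fun y hy i => by
    have h1 : y i ∈ (Z : Set (Fin n → ℝ)) := Fintype.mem_piFinset.1 hy i
    rw [hZ] at h1
    exact h1.2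
  rw [siegel_univ_indicator_eq_card hZ fun y hy => hy.1, ENNReal.toReal_natCast]
  norm_cast
  set Q : Finset (Fin n → ℝ) → Prop := fun X => FinsetIndep X ∧
    ∃ z ∈ Z, z ∉ X ∧ ¬FinsetIndep (insert z X)
  rw [Finset.card_filter, ← smul_eq_mul, ← sum_injective_piFinset Z r fun T => if Q T then 1 else 0,
    ← Finset.card_filter]
  have hz : ∀ X : Finset (Fin n → ℝ), ∃ z, Q X → z ∈ Z ∧ z ∉ X ∧ ¬FinsetIndep (insert z X) := by
    intro X
    by_cases h : Q X
    · obtain ⟨z, hz⟩ := h.2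
      exact ⟨z, fun _ => hz⟩
    · exact ⟨0, fun h' => absurd h' h⟩
  choose z hz using hz
  refine Finset.card_le_card_of_injOn
    (fun x => (Fin.cons (z (Finset.univ.image x)) x : Fin (r + 1) → Fin n → ℝ)) ?_ ?_
  · intro x hx
    simp only [Finset.coe_filter, Set.mem_ofPred_eq, Finset.mem_filter] at hx
    obtain ⟨⟨hxZ, hinj⟩, hQ⟩ := hx
    obtain ⟨h1, h2, h3⟩ := hz _ hQ
    have hmem : (Fin.cons (z (Finset.univ.image x)) x : Fin (r + 1) → Fin n → ℝ) ∈
        Fintype.piFinset (fun _ : Fin (r + 1) => Z) := by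
      rw [Fintype.mem_piFinset]
      intro i
      refine Fin.cases h1 (fun j => ?_) i
      simpa using Fintype.mem_piFinset.1 hxZ j
    simp only [Finset.coe_filter, Set.mem_ofPred_eq]
    refine ⟨hmem, hS _ hmem, ?_, ?_, ?_⟩
    · rw [Fin.tail_cons, finsetIndep_image_iff]
      exact ⟨hinj, hQ.1⟩
    · rw [finsetIndep_image_iff]
      rintro ⟨-, h⟩
      refine h3 ?_
      convert h using 1
      ext w
      simp [Fin.exists_fin_succ, eq_comm]
    · intro i h
      rw [Fin.tail_cons, Fin.cons_zero] at h
      exact h2 (h ▸ Finset.mem_image_of_mem x (Finset.mem_univ i))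
  · intro x _ x' _ h
    exact (Fin.cons_inj.1 h).2

open Classical in
theorem abs_indicator_sub_sum_siegel_le {L : LatticeSpace n} (𝒜 : Set (Set (Fin n → ℝ)))
    (hL : (latticeOf L ∩ S).Finite) (K : ℕ) :
    |(if latticeOf L ∩ S ∈ 𝒜 then 1 else 0) - ∑ k ∈ Finset.range (K + 1),
      (k.factorial : ℝ)⁻¹ * ∑ s : Finset (Fin k), (-1) ^ (k - s.card) *
        (siegel Set.univ ((patternSet S 𝒜 s).indicator 1) L).toReal| ≤
      2 * (3 ^ K / K.factorial * (siegel Set.univ ((independentSet K S).indicator 1) L).toReal +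
        ∑ r ∈ Finset.range K, 3 ^ r / r.factorial *
          (siegel Set.univ ((dependentSet r S).indicator 1) L).toReal) := by
  obtain ⟨Z, hZ⟩ := hL.exists_finset_coe
  have hfac : ∀ k : ℕ, (k.factorial : ℝ) ≠ 0 := fun k => by positivity
  have h := abs_sub_sum_moebiusSum_le (I := FinsetIndep (n := n)) finsetIndep_empty
    (fun X Y hXY hY => FinsetIndep.mono hXY hY) (φ := collectionIndicator 𝒜)
    (fun A => by unfold collectionIndicator; split_ifs <;> simp) Z K
  have h0 : collectionIndicator 𝒜 Z = if latticeOf L ∩ S ∈ 𝒜 then 1 else 0 := by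
    rw [collectionIndicator, hZ]
  simp_rw [sum_siegel_patternSet hZ, siegel_independentSet hZ, inv_mul_cancel_left₀ (hfac _)]
  rw [← h0]
  refine h.trans ?_
  have h1 : ∀ r : ℕ, (3 : ℝ) ^ r * ((Finset.powersetCard r Z).filter fun X => FinsetIndep X ∧
      ∃ z ∈ Z, z ∉ X ∧ ¬FinsetIndep (insert z X)).card ≤ 3 ^ r / r.factorial *
          (siegel Set.univ ((dependentSet r S).indicator 1) L).toReal := fun r => by
    refine le_trans (le_of_eq ?_) (mul_le_mul_of_nonneg_left (le_siegel_dependentSet hZ r)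
      (by positivity : (0 : ℝ) ≤ 3 ^ r / r.factorial))
    have := hfac r
    field_simp
  have h2 : (3 : ℝ) ^ K / K.factorial * (K.factorial *
      ((Finset.powersetCard K Z).filter FinsetIndep).card) =
      3 ^ K * ((Finset.powersetCard K Z).filter FinsetIndep).card := by
    have := hfac K
    field_simp
  rw [h2]
  exact mul_le_mul_of_nonneg_left (add_le_add le_rfl (Finset.sum_le_sum fun r _ => h1 r))
    (by norm_num)

end LatticePoints

section PatternVolumes

variable {n k : ℕ} {S : Set (Fin n → ℝ)} {𝒜 : Set (Set (Fin n → ℝ))}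

lemma ae_linearIndependent (hk : k ≤ n) :
    ∀ᵐ x : Fin k → Fin n → ℝ, LinearIndependent ℝ x := by
  induction k with
  | zero => exact Filter.Eventually.of_forall fun x => linearIndependent_empty_type
  | succ k ih =>
    have e := volume_preserving_piFinSuccAbove (fun _ : Fin (k + 1) => Fin n → ℝ) 0
    set D : Set ((Fin n → ℝ) × (Fin k → Fin n → ℝ)) :=
      {p | ¬LinearIndependent ℝ (Fin.cons p.1 p.2 : Fin (k + 1) → Fin n → ℝ)}
    have hD : MeasurableSet D := by
      refine (measurableSet_linearIndependent.preimage (measurable_pi_iff.2 fun i => ?_)).compl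
      refine Fin.cases ?_ (fun j => ?_) i
      · exact measurable_fst
      · exact (measurable_pi_apply j).comp measurable_snd
    have h0 : volume D = 0 := by
      rw [Measure.volume_eq_prod, Measure.prod_apply_symm hD,
        lintegral_eq_zero_iff (measurable_measure_prodMk_right hD)]
      filter_upwards [ih (by omega)] with y hy
      refine measure_mono_null (t := (Submodule.span ℝ (Set.range y) : Set (Fin n → ℝ))) ?_
        (Measure.addHaar_submodule _ _ fun h => ?_)
      · intro x hx
        by_contra hxy
        exact hx (linearIndependent_finCons.2 ⟨hy, hxy⟩)
      · have h1 := finrank_span_eq_card hy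
        rw [h, finrank_top, Module.finrank_fin_fun, Fintype.card_fin] at h1
        omega
    rw [ae_iff, ← e.measure_preimage hD.nullMeasurableSet] at *
    convert h0 using 2
    ext x
    simp only [D, Set.mem_preimage, Set.mem_ofPred_eq]
    rw [show (Fin.cons (MeasurableEquiv.piFinSuccAbove (fun _ : Fin (k + 1) => Fin n → ℝ) 0 x).1
      (MeasurableEquiv.piFinSuccAbove (fun _ : Fin (k + 1) => Fin n → ℝ) 0 x).2 :
        Fin (k + 1) → Fin n → ℝ) = x from Fin.cons_self_tail x]

/-- The volume of the set of tuples of length `m` whose entries form a configuration in `𝒜`. -/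
def collectionVolume (𝒜 : Set (Set (Fin n → ℝ))) (m : ℕ) : ℝ≥0∞ :=
  volume {x : Fin m → Fin n → ℝ | Set.range x ∈ 𝒜}

lemma collectionVolume_le (h𝒜 : ∀ X ∈ 𝒜, X ⊆ S ∧ X.Finite) (m : ℕ) :
    collectionVolume 𝒜 m ≤ volume S ^ m := by
  rw [← volume_forall_mem]
  exact measure_mono fun x hx i => (h𝒜 _ hx).1 (Set.mem_range_self i)

lemma measurableSet_range_mem_of_fintype {ι : Type*} [Fintype ι]
    (h𝒜 : MeasurableSet {x : Fin (Fintype.card ι) → Fin n → ℝ | Set.range x ∈ 𝒜}) :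
    MeasurableSet {x : ι → Fin n → ℝ | Set.range x ∈ 𝒜} ∧
      volume {x : ι → Fin n → ℝ | Set.range x ∈ 𝒜} = collectionVolume 𝒜 (Fintype.card ι) := by
  have e := volume_measurePreserving_piCongrLeft (fun _ : Fin (Fintype.card ι) => Fin n → ℝ)
    (Fintype.equivFin ι)
  have h : {x : ι → Fin n → ℝ | Set.range x ∈ 𝒜} = MeasurableEquiv.piCongrLeft
      (fun _ : Fin (Fintype.card ι) => Fin n → ℝ) (Fintype.equivFin ι) ⁻¹'
        {x | Set.range x ∈ 𝒜} := by
    ext x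
    simp only [Set.mem_ofPred_eq, Set.mem_preimage]
    rw [← (Fintype.equivFin ι).surjective.range_comp]
    congr! 2
    ext i
    simp [MeasurableEquiv.piCongrLeft, Equiv.piCongrLeft_apply_apply]
  rw [h]
  exact ⟨e.measurable h𝒜, e.measure_preimage h𝒜.nullMeasurableSet⟩

lemma image_mem_eq_preimage (h𝒜 : ∀ X ∈ 𝒜, X ⊆ S ∧ X.Finite) (s : Finset (Fin k)) :
    {y : Fin k → Fin n → ℝ | (∀ i, y i ∈ S) ∧ y '' s ∈ 𝒜} =
      MeasurableEquiv.piEquivPiSubtypeProd (fun _ : Fin k => Fin n → ℝ) (· ∈ s) ⁻¹'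
        ({x | Set.range x ∈ 𝒜} ×ˢ (Set.univ.pi fun _ => S)) := by
  ext y
  have h1 : Set.range (MeasurableEquiv.piEquivPiSubtypeProd (fun _ : Fin k => Fin n → ℝ)
      (· ∈ s) y).1 = y '' s := by
    rw [Set.image_eq_range]
    rfl
  simp only [Set.mem_ofPred_eq, Set.mem_preimage, Set.mem_prod, h1, Set.mem_univ_pi]
  constructor
  · rintro ⟨h2, h3⟩
    exact ⟨h3, fun i => h2 i⟩
  · rintro ⟨h3, h2⟩
    refine ⟨fun i => ?_, h3⟩
    by_cases hi : i ∈ s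
    · exact (h𝒜 _ h3).1 (Set.mem_image_of_mem y hi)
    · exact h2 ⟨i, hi⟩

lemma measurableSet_image_mem (hS : MeasurableSet S) (h𝒜 : ∀ X ∈ 𝒜, X ⊆ S ∧ X.Finite)
    (hm : ∀ m : ℕ, MeasurableSet {x : Fin m → Fin n → ℝ | Set.range x ∈ 𝒜})
    (s : Finset (Fin k)) :
    MeasurableSet {y : Fin k → Fin n → ℝ | (∀ i, y i ∈ S) ∧ y '' s ∈ 𝒜} := by
  rw [image_mem_eq_preimage h𝒜]
  exact ((measurableSet_range_mem_of_fintype (hm _)).1.prod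
    (MeasurableSet.univ_pi fun _ => hS)).preimage (MeasurableEquiv.measurable _)

lemma volume_image_mem (hS : MeasurableSet S) (h𝒜 : ∀ X ∈ 𝒜, X ⊆ S ∧ X.Finite)
    (hm : ∀ m : ℕ, MeasurableSet {x : Fin m → Fin n → ℝ | Set.range x ∈ 𝒜})
    (s : Finset (Fin k)) :
    volume {y : Fin k → Fin n → ℝ | (∀ i, y i ∈ S) ∧ y '' s ∈ 𝒜} =
      collectionVolume 𝒜 s.card * volume S ^ (k - s.card) := by
  have h1 (I : Fintype {i // i ∈ s}) :=
    @measurableSet_range_mem_of_fintype n 𝒜 {i // i ∈ s} I (hm _)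
  have h2 (I : Fintype {i // i ∈ s}) : @Fintype.card _ I = s.card :=
    Fintype.card_of_subtype s fun _ => Iff.rfl
  rw [image_mem_eq_preimage h𝒜, (volume_preserving_piEquivPiSubtypeProd
    (fun _ : Fin k => Fin n → ℝ) (· ∈ s)).measure_preimage
      ((h1 inferInstance).1.prod (MeasurableSet.univ_pi fun _ => hS)).nullMeasurableSet,
    Measure.volume_eq_prod, Measure.prod_prod, (h1 _).2, volume_pi_pi, Finset.prod_const,
    h2]
  simp [Fintype.card_subtype_compl]

lemma measurableSet_patternSet (hS : MeasurableSet S) (h𝒜 : ∀ X ∈ 𝒜, X ⊆ S ∧ X.Finite)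
    (hm : ∀ m : ℕ, MeasurableSet {x : Fin m → Fin n → ℝ | Set.range x ∈ 𝒜})
    (s : Finset (Fin k)) : MeasurableSet (patternSet S 𝒜 s) := by
  have h : patternSet S 𝒜 s = {y | (∀ i, y i ∈ S) ∧ y '' s ∈ 𝒜} ∩ {y | LinearIndependent ℝ y} := by
    ext y
    simp only [patternSet, Set.mem_inter_iff, Set.mem_ofPred_eq]
    tauto
  rw [h]
  exact (measurableSet_image_mem hS h𝒜 hm s).inter measurableSet_linearIndependent

lemma volume_patternSet (hk : k ≤ n) (hS : MeasurableSet S) (h𝒜 : ∀ X ∈ 𝒜, X ⊆ S ∧ X.Finite)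
    (hm : ∀ m : ℕ, MeasurableSet {x : Fin m → Fin n → ℝ | Set.range x ∈ 𝒜})
    (s : Finset (Fin k)) :
    volume (patternSet S 𝒜 s) = collectionVolume 𝒜 s.card * volume S ^ (k - s.card) := by
  rw [← volume_image_mem hS h𝒜 hm s]
  refine measure_congr ?_
  filter_upwards [ae_linearIndependent hk] with y hy
  apply propext
  change _ ∧ _ ∧ _ ↔ _ ∧ _
  tauto

lemma measurableSet_independentSet (hS : MeasurableSet S) :
    MeasurableSet (independentSet k S) :=
  (measurableSet_forall_mem k hS).inter measurableSet_linearIndependent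

variable {μ : Measure (LatticeSpace n)} [IsProbabilityMeasure μ]
  (hμ : ∀ g : SLR n, Measure.map (fun x => g • x) μ = μ)
include hμ

lemma lintegral_siegel_patternSet (hk : k < n) (hS : MeasurableSet S)
    (h𝒜 : ∀ X ∈ 𝒜, X ⊆ S ∧ X.Finite)
    (hm : ∀ m : ℕ, MeasurableSet {x : Fin m → Fin n → ℝ | Set.range x ∈ 𝒜})
    (s : Finset (Fin k)) :
    ∫⁻ L, siegel Set.univ ((patternSet S 𝒜 s).indicator 1) L ∂μ =
      collectionVolume 𝒜 s.card * volume S ^ (k - s.card) := by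
  have h1 := measurableSet_patternSet hS h𝒜 hm s
  rw [lintegral_siegel_univ hμ (by simpa using hk) (measurable_one.indicator h1)
    fun x hx => Set.indicator_of_notMem (fun h => hx h.2.1) _, lintegral_indicator_one h1,
    volume_patternSet hk.le hS h𝒜 hm]

lemma lintegral_siegel_independentSet (hk : k < n) (hS : MeasurableSet S) :
    ∫⁻ L, siegel Set.univ ((independentSet k S).indicator 1) L ∂μ = volume S ^ k := by
  have h1 : MeasurableSet (independentSet k S) := measurableSet_independentSet hS
  rw [lintegral_siegel_univ hμ (by simpa using hk) (measurable_one.indicator h1)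
    fun x hx => Set.indicator_of_notMem (fun h => hx h.2) _, lintegral_indicator_one h1,
    ← volume_forall_mem]
  refine measure_congr ?_
  filter_upwards [ae_linearIndependent hk.le] with y hy
  exact propext (and_iff_left hy)

lemma ae_finite_latticeOf_inter (hn : 1 < n) (hS : MeasurableSet S) (hS0 : (0 : Fin n → ℝ) ∉ S)
    (hSfin : volume S ≠ ∞) : ∀ᵐ L ∂μ, (latticeOf L ∩ S).Finite := by
  have hmeas : Measurable (siegel Set.univ ((independentSet 1 S).indicator 1) :
      LatticeSpace n → ℝ≥0∞) :=
    measurable_siegel isSLZInvariant_univ (measurable_one.indicator (measurableSet_independentSet hS))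
  have h1 := ae_lt_top hmeas (by
    rw [lintegral_siegel_independentSet hμ hn hS, pow_one]
    exact hSfin)
  filter_upwards [h1] with L hL
  have h2 := ENNReal.finite_const_le_of_tsum_ne_top (ne_of_lt hL) one_ne_zero
  set g := Quotient.out (α := SLR n) L
  refine (h2.image fun v => tupleAct g (tupleCast v.1) 0).subset ?_
  rintro y ⟨⟨v, hv⟩, hy⟩
  refine ⟨⟨fun _ => v, Set.mem_univ _⟩, ?_, hv.symm⟩
  have h3 : tupleAct g (tupleCast fun _ : Fin 1 => v) = fun _ => y := funext fun _ => hv.symm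
  have h4 : tupleAct g (tupleCast fun _ : Fin 1 => v) ∈ independentSet 1 S := by
    rw [h3]
    refine ⟨fun _ => hy, ?_⟩
    exact LinearIndependent.of_subsingleton 0 (ne_of_mem_of_not_mem hy hS0)
  exact (Set.indicator_of_mem h4 (1 : (Fin 1 → Fin n → ℝ) → ℝ≥0∞)).ge

end PatternVolumes

section PoissonExpansion

open Finset

variable {a : ℕ → ℝ} {t : ℝ}

/-- The `k`-th term of the Cauchy product of `∑ aₘ / m!` and `exp (-t)`. -/
def poissonTerm (a : ℕ → ℝ) (t : ℝ) (k : ℕ) : ℝ :=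
  ∑ p ∈ antidiagonal k, a p.1 / p.1.factorial * ((-t) ^ p.2 / p.2.factorial)

lemma sum_finset_eq_poissonTerm (a : ℕ → ℝ) (t : ℝ) (k : ℕ) :
    (k.factorial : ℝ)⁻¹ * ∑ s : Finset (Fin k), (-1) ^ (k - #s) * (a #s * t ^ (k - #s)) =
      poissonTerm a t k := by
  have h := sum_powerset_apply_card (x := (univ : Finset (Fin k)))
    (fun m => (-1 : ℝ) ^ (k - m) * (a m * t ^ (k - m)))
  rw [powerset_univ, card_univ, Fintype.card_fin] at h
  rw [h, poissonTerm, Nat.sum_antidiagonal_eq_sum_range_succ_mk, mul_sum]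
  refine sum_congr rfl fun m hm => ?_
  have hmk : m ≤ k := Nat.lt_succ_iff.1 (mem_range.1 hm)
  rw [nsmul_eq_mul, Nat.cast_choose ℝ hmk, neg_pow t]
  have h1 : (k.factorial : ℝ) ≠ 0 := by positivity
  field_simp

lemma pow_div_factorial_le_exp {x : ℝ} (hx : 0 ≤ x) (K : ℕ) :
    x ^ K / K.factorial ≤ (2 ^ K)⁻¹ * Real.exp (2 * x) := by
  have h := Real.pow_div_factorial_le_exp (2 * x) (by positivity) K
  rw [mul_pow] at h
  rw [inv_mul_eq_div, le_div_iff₀ (by positivity)]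
  refine le_trans (le_of_eq ?_) h
  ring

variable (ha0 : ∀ m, 0 ≤ a m) (ha : ∀ m, a m ≤ t ^ m)
include ha0 ha

lemma summable_div_factorial_of_le_pow : Summable fun m => ‖a m / m.factorial‖ := by
  refine Summable.of_nonneg_of_le (fun m => norm_nonneg _) (fun m => ?_)
    (Real.summable_pow_div_factorial t)
  rw [Real.norm_of_nonneg (div_nonneg (ha0 m) (Nat.cast_nonneg _))]
  exact div_le_div_of_nonneg_right (ha m) (Nat.cast_nonneg _)

lemma hasSum_poissonTerm :
    HasSum (poissonTerm a t) (∑' m, Real.exp (-t) * (a m / m.factorial)) := by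
  have h1 := summable_div_factorial_of_le_pow ha0 ha
  have h2 : Summable fun m => ‖(-t) ^ m / m.factorial‖ :=
    (Real.summable_pow_div_factorial (-t)).norm
  have h3 := tsum_mul_tsum_eq_tsum_sum_antidiagonal_of_summable_norm h1 h2
  have h4 : Real.exp (-t) = ∑' m : ℕ, (-t) ^ m / m.factorial := by
    rw [Real.exp_eq_exp_ℝ, NormedSpace.exp_eq_tsum_div]
  rw [tsum_mul_left, mul_comm, h4, h3]
  exact (summable_norm_sum_mul_antidiagonal_of_summable_norm h1 h2).of_norm.hasSum

lemma abs_poissonTerm_le (ht : 0 ≤ t) (k : ℕ) :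
    |poissonTerm a t k| ≤ (2 * t) ^ k / k.factorial := by
  have h := sum_finset_eq_poissonTerm (fun m => t ^ m) (-t) k
  have h1 : (2 * t) ^ k / k.factorial = poissonTerm (fun m => t ^ m) (-t) k := by
    rw [← h]
    have h2 : ∀ s : Finset (Fin k), (-1) ^ (k - #s) * (t ^ #s * (-t) ^ (k - #s)) = t ^ k := by
      intro s
      rw [mul_left_comm, ← mul_pow, neg_one_mul, neg_neg, ← pow_add,
        Nat.add_sub_cancel' (by simpa using card_le_univ s)]
    simp only [h2, sum_const, card_univ, Fintype.card_finset, Fintype.card_fin, nsmul_eq_mul]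
    push_cast
    rw [mul_pow]
    ring
  rw [h1, poissonTerm, poissonTerm]
  refine (abs_sum_le_sum_abs _ _).trans (sum_le_sum fun p _ => ?_)
  rw [abs_mul, abs_div, abs_div, abs_pow, abs_neg, abs_of_nonneg ht, neg_neg, Nat.abs_cast,
    Nat.abs_cast, abs_of_nonneg (ha0 _)]
  gcongr
  exact ha _

lemma abs_tsum_sub_sum_poissonTerm_le (ht : 0 ≤ t) (K : ℕ) :
    |∑' m, Real.exp (-t) * (a m / m.factorial) - ∑ k ∈ range (K + 1), poissonTerm a t k| ≤
      (2 ^ K)⁻¹ * Real.exp (4 * t) := by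
  have h := hasSum_poissonTerm ha0 ha
  rw [← h.tsum_eq, ← h.summable.sum_add_tsum_nat_add (K + 1), add_sub_cancel_left]
  have hs : HasSum (fun k => (4 * t) ^ k / k.factorial) (Real.exp (4 * t)) := by
    rw [Real.exp_eq_exp_ℝ]
    exact NormedSpace.expSeries_div_hasSum_exp (4 * t)
  have hs1 := hs.summable
  have h1 : ∀ k, ‖poissonTerm a t (k + (K + 1))‖ ≤
      (2 ^ K)⁻¹ * ((4 * t) ^ (k + (K + 1)) / (k + (K + 1)).factorial) := fun k => by
    refine (abs_poissonTerm_le ha0 ha ht _).trans ?_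
    rw [show (4 : ℝ) * t = 2 * (2 * t) by ring, mul_pow 2 (2 * t), mul_div_assoc, ← mul_assoc]
    refine le_mul_of_one_le_left (by positivity) ?_
    rw [inv_mul_eq_div, one_le_div (by positivity)]
    exact pow_le_pow_right₀ (by norm_num) (by omega)
  have hs2 : Summable fun k => (2 ^ K : ℝ)⁻¹ *
      ((4 * t) ^ (k + (K + 1)) / (k + (K + 1)).factorial) :=
    ((summable_nat_add_iff (K + 1)).2 hs1).mul_left _
  refine (tsum_of_norm_bounded hs2.hasSum h1).trans ?_
  rw [tsum_mul_left]
  gcongr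
  rw [← hs.tsum_eq, ← hs1.sum_add_tsum_nat_add (K + 1)]
  exact le_add_of_nonneg_left (sum_nonneg fun k _ => by positivity)

lemma tsum_exp_mul_nonneg_and_le_one :
    0 ≤ ∑' m, Real.exp (-t) * (a m / m.factorial) ∧
      ∑' m, Real.exp (-t) * (a m / m.factorial) ≤ 1 := by
  refine ⟨tsum_nonneg fun m => mul_nonneg (Real.exp_pos _).le
    (div_nonneg (ha0 m) (Nat.cast_nonneg _)), ?_⟩
  have hs : HasSum (fun k => t ^ k / k.factorial) (Real.exp t) := by
    rw [Real.exp_eq_exp_ℝ]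
    exact NormedSpace.expSeries_div_hasSum_exp t
  rw [tsum_mul_left, ← Real.exp_zero, ← neg_add_cancel t, Real.exp_add, ← hs.tsum_eq]
  gcongr
  · exact (summable_div_factorial_of_le_pow ha0 ha).of_norm
  · exact hs.summable
  · exact ha _

end PoissonExpansion

section ExpectationBounds

variable {n K : ℕ} {S : Set (Fin n → ℝ)} {𝒜 : Set (Set (Fin n → ℝ))}
  {μ : Measure (LatticeSpace n)} [IsProbabilityMeasure μ]

omit [IsProbabilityMeasure μ] in
lemma integrable_toReal_siegel {k : ℕ} {A : Set (Fin k → Fin n → ℝ)} (hA : MeasurableSet A)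
    (h : ∫⁻ L, siegel Set.univ (A.indicator 1) L ∂μ ≠ ∞) :
    Integrable (fun L => (siegel Set.univ (A.indicator 1) L).toReal) μ ∧
      ∫ L, (siegel Set.univ (A.indicator 1) L).toReal ∂μ =
        (∫⁻ L, siegel Set.univ (A.indicator 1) L ∂μ).toReal := by
  have hm : Measurable (siegel Set.univ (A.indicator 1) : LatticeSpace n → ℝ≥0∞) :=
    measurable_siegel isSLZInvariant_univ (measurable_one.indicator hA)
  exact ⟨integrable_toReal_of_lintegral_ne_top hm.aemeasurable h,
    integral_toReal hm.aemeasurable (ae_lt_top hm h)⟩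

lemma relError_ne_top (n K : ℕ) : relError n K ≠ ∞ := by
  unfold relError
  exact ENNReal.add_ne_top.2 ⟨ENNReal.pow_ne_top ENNReal.ofReal_ne_top,
    ENNReal.inv_ne_top.2 (pow_ne_zero _ two_ne_zero)⟩

lemma abs_measure_sub_sum_poissonTerm_le (hμ : ∀ g : SLR n, Measure.map (fun x => g • x) μ = μ)
    (hn : 1 < n) (hK : 2 * K ≤ n) (hS : MeasurableSet S) (hSS : S ∩ (-S) = ∅)
    (hSfin : volume S ≠ ∞) (h𝒜 : ∀ X ∈ 𝒜, X ⊆ S ∧ X.Finite)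
    (hG : MeasurableSet {L : LatticeSpace n | (latticeOf L ∩ S).Finite ∧ latticeOf L ∩ S ∈ 𝒜})
    (hm : ∀ m : ℕ, MeasurableSet {x : Fin m → (Fin n → ℝ) | Set.range x ∈ 𝒜}) :
    |(μ {L : LatticeSpace n | (latticeOf L ∩ S).Finite ∧ latticeOf L ∩ S ∈ 𝒜}).toReal -
      ∑ k ∈ Finset.range (K + 1),
        poissonTerm (fun m => (collectionVolume 𝒜 m).toReal) (volume S).toReal k| ≤
      2 * (3 ^ K / K.factorial * (volume S).toReal ^ K +
        ∑ r ∈ Finset.range K, 3 ^ r / r.factorial *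
          ((relError n K).toReal * (volume S).toReal ^ r * relWeightSum.toReal ^ (r + 1))) := by
  classical
  have hS0 : (0 : Fin n → ℝ) ∉ S := fun h => by
    have : (0 : Fin n → ℝ) ∈ S ∩ (-S) := ⟨h, by simpa using h⟩
    rw [hSS] at this
    exact this
  set G := {L : LatticeSpace n | (latticeOf L ∩ S).Finite ∧ latticeOf L ∩ S ∈ 𝒜}
  set t := (volume S).toReal
  have hvol : ∀ m, collectionVolume 𝒜 m ≠ ∞ := fun m =>
    ne_top_of_le_ne_top (ENNReal.pow_ne_top hSfin) (collectionVolume_le h𝒜 m)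
  have hpat : ∀ k ∈ Finset.range (K + 1), ∀ s : Finset (Fin k),
      Integrable (fun L => (siegel Set.univ ((patternSet S 𝒜 s).indicator 1) L).toReal) μ ∧
      ∫ L, (siegel Set.univ ((patternSet S 𝒜 s).indicator 1) L).toReal ∂μ =
        (collectionVolume 𝒜 s.card).toReal * t ^ (k - s.card) := by
    intro k hk s
    have hkn : k < n := by
      have := Finset.mem_range.1 hk
      omega
    have h1 := lintegral_siegel_patternSet hμ hkn hS h𝒜 hm s
    have h2 := integrable_toReal_siegel (μ := μ) (measurableSet_patternSet hS h𝒜 hm s)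
      (by rw [h1]; exact ENNReal.mul_ne_top (hvol _) (ENNReal.pow_ne_top hSfin))
    refine ⟨h2.1, ?_⟩
    rw [h2.2, h1, ENNReal.toReal_mul, ENNReal.toReal_pow]
  have hind : Integrable (fun L => (siegel Set.univ ((independentSet K S).indicator 1) L).toReal) μ ∧
      ∫ L, (siegel Set.univ ((independentSet K S).indicator 1) L).toReal ∂μ = t ^ K := by
    have h1 := lintegral_siegel_independentSet (k := K) hμ (by omega) hS
    have h2 := integrable_toReal_siegel (μ := μ) (measurableSet_independentSet (k := K) hS)
      (by rw [h1]; exact ENNReal.pow_ne_top hSfin)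
    refine ⟨h2.1, ?_⟩
    rw [h2.2, h1, ENNReal.toReal_pow]
  have hdep : ∀ r ∈ Finset.range K,
      Integrable (fun L => (siegel Set.univ ((dependentSet r S).indicator 1) L).toReal) μ ∧
      ∫ L, (siegel Set.univ ((dependentSet r S).indicator 1) L).toReal ∂μ ≤
        (relError n K).toReal * t ^ r * relWeightSum.toReal ^ (r + 1) := by
    intro r hr
    have h1 := lintegral_siegel_dependentSet_le hμ (Nat.succ_le_of_lt (Finset.mem_range.1 hr))
      hK hS hSS
    have h3 : relError n K * volume S ^ r * relWeightSum ^ (r + 1) ≠ ∞ :=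
      ENNReal.mul_ne_top (ENNReal.mul_ne_top (relError_ne_top n K) (ENNReal.pow_ne_top hSfin))
        (ENNReal.pow_ne_top relWeightSum_ne_top)
    have h2 := integrable_toReal_siegel (μ := μ) (measurableSet_dependentSet (r := r) hS)
      (ne_top_of_le_ne_top h3 h1)
    refine ⟨h2.1, ?_⟩
    rw [h2.2, ← ENNReal.toReal_pow, ← ENNReal.toReal_pow, ← ENNReal.toReal_mul,
      ← ENNReal.toReal_mul]
    exact ENNReal.toReal_mono h3 h1
  set Φ : LatticeSpace n → ℝ := fun L => ∑ k ∈ Finset.range (K + 1),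
    (k.factorial : ℝ)⁻¹ * ∑ s : Finset (Fin k), (-1) ^ (k - s.card) *
      (siegel Set.univ ((patternSet S 𝒜 s).indicator 1) L).toReal
  have hΦi : ∀ k ∈ Finset.range (K + 1), Integrable (fun L => (k.factorial : ℝ)⁻¹ *
      ∑ s : Finset (Fin k), (-1) ^ (k - s.card) *
        (siegel Set.univ ((patternSet S 𝒜 s).indicator 1) L).toReal) μ := fun k hk =>
    (integrable_finsetSum _ fun s _ => (hpat k hk s).1.const_mul _).const_mul _
  have hΦint : Integrable Φ μ := integrable_finsetSum _ hΦi
  have hΦ : ∫ L, Φ L ∂μ = ∑ k ∈ Finset.range (K + 1),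
      poissonTerm (fun m => (collectionVolume 𝒜 m).toReal) t k := by
    rw [integral_finsetSum _ hΦi]
    refine Finset.sum_congr rfl fun k hk => ?_
    rw [← sum_finset_eq_poissonTerm, integral_const_mul,
      integral_finsetSum _ fun s _ => (hpat k hk s).1.const_mul _]
    congr 1
    refine Finset.sum_congr rfl fun s _ => ?_
    rw [integral_const_mul, (hpat k hk s).2]
  have hGi : Integrable (G.indicator (1 : LatticeSpace n → ℝ)) μ :=
    (integrable_const (1 : ℝ)).indicator hG
  have hGint : ∫ L, G.indicator (1 : LatticeSpace n → ℝ) L ∂μ = (μ G).toReal :=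
    integral_indicator_one hG
  set Ψ : LatticeSpace n → ℝ := fun L =>
    2 * (3 ^ K / K.factorial * (siegel Set.univ ((independentSet K S).indicator 1) L).toReal +
      ∑ r ∈ Finset.range K, 3 ^ r / r.factorial *
        (siegel Set.univ ((dependentSet r S).indicator 1) L).toReal)
  have hsumi : Integrable (fun L => ∑ r ∈ Finset.range K, 3 ^ r / (r.factorial : ℝ) *
      (siegel Set.univ ((dependentSet r S).indicator 1) L).toReal) μ :=
    integrable_finsetSum _ fun r hr => (hdep r hr).1.const_mul _
  have hΨi : Integrable Ψ μ := ((hind.1.const_mul _).add hsumi).const_mul _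
  rw [← hGint, ← hΦ, ← integral_sub hGi hΦint, ← Real.norm_eq_abs]
  refine (norm_integral_le_of_norm_le hΨi ?_).trans ?_
  · filter_upwards [ae_finite_latticeOf_inter hμ hn hS hS0 hSfin] with L hL
    have h1 : G.indicator (1 : LatticeSpace n → ℝ) L = if latticeOf L ∩ S ∈ 𝒜 then 1 else 0 := by
      simp only [Set.indicator_apply, G, Set.mem_ofPred_eq, hL, true_and, Pi.one_apply]
    rw [h1]
    exact abs_indicator_sub_sum_siegel_le 𝒜 hL K
  · rw [integral_const_mul, integral_add (hind.1.const_mul _) hsumi, integral_const_mul, hind.2,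
      integral_finsetSum _ fun r hr => (hdep r hr).1.const_mul _]
    gcongr with r hr
    rw [integral_const_mul]
    gcongr
    exact (hdep r hr).2

lemma poissonLaw_eq (hpos : volume S ≠ 0) (hSfin : volume S ≠ ∞)
    (h𝒜 : ∀ X ∈ 𝒜, X ⊆ S ∧ X.Finite)
    (hm : ∀ m : ℕ, MeasurableSet {x : Fin m → (Fin n → ℝ) | Set.range x ∈ 𝒜}) :
    poissonLaw n S 𝒜 = ∑' m : ℕ, Real.exp (-(volume S).toReal) *
      ((collectionVolume 𝒜 m).toReal / m.factorial) := by
  refine tsum_congr fun m => ?_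
  have h1 : ∫ x in Set.univ.pi (fun _ : Fin m => S),
      Set.indicator 𝒜 (fun _ => (1 : ℝ)) (Set.range x) = (collectionVolume 𝒜 m).toReal := by
    have h2 : (fun x : Fin m → Fin n → ℝ => Set.indicator 𝒜 (fun _ => (1 : ℝ)) (Set.range x)) =
        {x : Fin m → Fin n → ℝ | Set.range x ∈ 𝒜}.indicator 1 := by
      classical
      ext x
      simp [Set.indicator_apply]
    have h3 : {x : Fin m → Fin n → ℝ | Set.range x ∈ 𝒜} ⊆ Set.univ.pi fun _ => S :=
      fun x hx i _ => (h𝒜 _ hx).1 (Set.mem_range_self i)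
    rw [h2, integral_indicator_one (hm m), Measure.real, Measure.restrict_apply (hm m),
      Set.inter_eq_self_of_subset_left h3, collectionVolume]
  have h4 : (volume S).toReal ≠ 0 := (ENNReal.toReal_ne_zero).2 ⟨hpos, hSfin⟩
  rw [h1]
  field_simp

end ExpectationBounds

section FinalBounds

variable {n : ℕ}

lemma inv_two_pow_le_exp (m : ℕ) : ((2 : ℝ) ^ m)⁻¹ ≤ Real.exp (-(m / 2)) := by
  rw [Real.exp_neg]
  refine inv_anti₀ (Real.exp_pos _) ?_
  rw [show (m : ℝ) / 2 = m * (1 / 2) by ring, Real.exp_nat_mul]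
  refine pow_le_pow_left₀ (Real.exp_pos _).le ?_ m
  rw [← Real.le_log_iff_exp_le two_pos]
  linarith [Real.log_two_gt_d9]

lemma toReal_relError_le (n : ℕ) :
    (relError n (n / 8)).toReal ≤ 2 * Real.exp (-(n / 2000000)) := by
  rw [relError, ENNReal.toReal_add (ENNReal.pow_ne_top ENNReal.ofReal_ne_top)
    (ENNReal.inv_ne_top.2 (pow_ne_zero _ two_ne_zero)), ENNReal.toReal_pow,
    ENNReal.toReal_ofReal (by norm_num [youngConst]), ENNReal.toReal_inv, ENNReal.toReal_pow,
    ENNReal.toReal_ofNat]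
  have h1 : youngConst ^ n ≤ Real.exp (-(n / 2000000)) := by
    rw [show -((n : ℝ) / 2000000) = n * (-(1 / 2000000)) by ring, Real.exp_nat_mul]
    refine pow_le_pow_left₀ (by norm_num [youngConst]) ?_ n
    have := Real.add_one_le_exp (-(1 / 2000000) : ℝ)
    rw [youngConst]
    linarith
  have h2 : ((2 : ℝ) ^ (n - 2 * (n / 8)))⁻¹ ≤ Real.exp (-(n / 2000000)) := by
    refine (inv_two_pow_le_exp _).trans (Real.exp_le_exp.2 ?_)
    have h3 : (n : ℝ) ≤ 2 * ((n - 2 * (n / 8) : ℕ) : ℝ) := by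
      exact_mod_cast (by omega : n ≤ 2 * (n - 2 * (n / 8)))
    have h4 : (0 : ℝ) ≤ n := Nat.cast_nonneg n
    linarith
  linarith

lemma inv_two_pow_div_eight_le (n : ℕ) :
    ((2 : ℝ) ^ (n / 8))⁻¹ ≤ 3 * Real.exp (-(n / 16)) := by
  have h1 : (n : ℝ) ≤ 8 * ((n / 8 : ℕ) : ℝ) + 7 := by
    exact_mod_cast (by omega : n ≤ 8 * (n / 8) + 7)
  have h2 : Real.exp 1 ≤ 3 := by linarith [Real.exp_one_lt_d9]
  refine (inv_two_pow_le_exp _).trans ?_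
  calc Real.exp (-(((n / 8 : ℕ) : ℝ) / 2)) ≤ Real.exp (1 + -(n / 16)) :=
        Real.exp_le_exp.2 (by linarith)
    _ = Real.exp 1 * Real.exp (-(n / 16)) := Real.exp_add _ _
    _ ≤ 3 * Real.exp (-(n / 16)) := mul_le_mul_of_nonneg_right h2 (Real.exp_pos _).le

lemma sum_relation_terms_le {t ε B : ℝ} (ht : 0 ≤ t) (hε : 0 ≤ ε) (hB : 0 ≤ B) (K : ℕ) :
    ∑ r ∈ Finset.range K, 3 ^ r / r.factorial * (ε * t ^ r * B ^ (r + 1)) ≤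
      B * ε * Real.exp (3 * B * t) := by
  have h := Real.sum_le_exp_of_nonneg (by positivity : 0 ≤ 3 * B * t) K
  refine le_trans (le_of_eq ?_) (mul_le_mul_of_nonneg_left h (by positivity : 0 ≤ B * ε))
  rw [Finset.mul_sum]
  refine Finset.sum_congr rfl fun r _ => ?_
  rw [mul_pow, mul_pow]
  ring

lemma total_error_le {t B : ℝ} (ht : 0 ≤ t) (hB : 0 ≤ B)
    (htn : t ≤ 1 / (100000000 * (1 + B)) * n) :
    2 * (3 ^ (n / 8) / (n / 8).factorial * t ^ (n / 8) +
        ∑ r ∈ Finset.range (n / 8), 3 ^ r / r.factorial *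
          ((relError n (n / 8)).toReal * t ^ r * B ^ (r + 1))) +
      (2 ^ (n / 8))⁻¹ * Real.exp (4 * t) ≤
    (9 + 4 * B) * Real.exp (-(1 / 10000000 * n)) := by
  have hn : (0 : ℝ) ≤ n := Nat.cast_nonneg n
  have hB1 : (1 + B) * t ≤ n / 100000000 := by
    calc (1 + B) * t ≤ (1 + B) * (1 / (100000000 * (1 + B)) * n) := by gcongr
      _ = n / 100000000 := by field_simp
  have ht1 : t ≤ n / 100000000 := by nlinarith [mul_nonneg hB ht]
  have hBt : B * t ≤ n / 100000000 := by nlinarith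
  have h1 : 3 ^ (n / 8) / (n / 8).factorial * t ^ (n / 8) ≤
      (2 ^ (n / 8))⁻¹ * Real.exp (6 * t) := by
    have := pow_div_factorial_le_exp (by positivity : 0 ≤ 3 * t) (n / 8)
    rw [show 2 * (3 * t) = 6 * t by ring, mul_pow] at this
    refine le_trans (le_of_eq ?_) this
    ring
  have h2 : (2 ^ (n / 8))⁻¹ * Real.exp (6 * t) ≤ 3 * Real.exp (-(1 / 10000000 * n)) := by
    calc (2 ^ (n / 8))⁻¹ * Real.exp (6 * t) ≤ 3 * Real.exp (-(n / 16)) * Real.exp (6 * t) := by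
          gcongr
          exact inv_two_pow_div_eight_le n
      _ = 3 * Real.exp (-(n / 16) + 6 * t) := by rw [mul_assoc, Real.exp_add]
      _ ≤ 3 * Real.exp (-(1 / 10000000 * n)) := by
          gcongr
          linarith
  have h3 : (2 ^ (n / 8))⁻¹ * Real.exp (4 * t) ≤ (2 ^ (n / 8))⁻¹ * Real.exp (6 * t) := by
    gcongr
    norm_num
  have h4 := sum_relation_terms_le ht (ENNReal.toReal_nonneg (a := relError n (n / 8))) hB (n / 8)
  have h5 : B * (relError n (n / 8)).toReal * Real.exp (3 * B * t) ≤
      2 * B * Real.exp (-(1 / 10000000 * n)) := by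
    calc B * (relError n (n / 8)).toReal * Real.exp (3 * B * t) ≤
          B * (2 * Real.exp (-(n / 2000000))) * Real.exp (3 * B * t) := by
          gcongr
          exact toReal_relError_le n
      _ = 2 * B * Real.exp (-(n / 2000000) + 3 * B * t) := by
          rw [Real.exp_add]
          ring
      _ ≤ 2 * B * Real.exp (-(1 / 10000000 * n)) := by
          gcongr
          linarith
  linarith

end FinalBounds

/-- **Theorem 1.2.** There are universal constants `c, c', C > 0` such that whenever
`S ⊆ ℝⁿ` is a Borel set with `S ∩ (-S) = ∅` and `0 < Vol(S) < c·n`, and `μ` is an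
`SL(n,ℝ)`-invariant Borel probability measure on the space of covolume-one lattices,
then for every Borel collection `𝒜` of finite subsets of `S` we have
`|μ(L ∩ S ∈ 𝒜) - P_λ(𝒜)| ≤ C e^{-c' n}`; in particular the total variation distance
between the two point processes in `S` is at most `C e^{-c' n}`. -/
theorem poisson_approximation_of_random_lattices :
    ∃ c c' C : ℝ, 0 < c ∧ 0 < c' ∧ 0 < C ∧
      ∀ n : ℕ, 1 ≤ n →
      ∀ S : Set (Fin n → ℝ), MeasurableSet S → S ∩ (-S) = ∅ →
        0 < volume S → volume S < ENNReal.ofReal (c * n) →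
      ∀ μ : Measure (LatticeSpace n), IsProbabilityMeasure μ →
        (∀ g : SLR n, Measure.map (fun x => g • x) μ = μ) →
      ∀ 𝒜 : Set (Set (Fin n → ℝ)),
        (∀ X ∈ 𝒜, X ⊆ S ∧ X.Finite) →
        MeasurableSet {L : LatticeSpace n |
          (latticeOf L ∩ S).Finite ∧ latticeOf L ∩ S ∈ 𝒜} →
        (∀ m : ℕ, MeasurableSet {x : Fin m → (Fin n → ℝ) | Set.range x ∈ 𝒜}) →
        |(μ {L : LatticeSpace n |
            (latticeOf L ∩ S).Finite ∧ latticeOf L ∩ S ∈ 𝒜}).toReal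
          - poissonLaw n S 𝒜| ≤ C * Real.exp (-(c' * n)) := by
  set B := relWeightSum.toReal
  have hB : 0 ≤ B := ENNReal.toReal_nonneg
  refine ⟨1 / (100000000 * (1 + B)), 1 / 10000000, 9 + 4 * B, by positivity, by norm_num,
    by positivity, ?_⟩
  intro n hn S hS hSS hpos hlt μ hμp hμ 𝒜 h𝒜 hG hm
  have hSfin : volume S ≠ ∞ := ne_top_of_lt hlt
  have ht : 0 ≤ (volume S).toReal := ENNReal.toReal_nonneg
  have htn : (volume S).toReal ≤ 1 / (100000000 * (1 + B)) * n :=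
    ENNReal.toReal_le_of_le_ofReal (by positivity) hlt.le
  have ha0 : ∀ m, 0 ≤ (collectionVolume 𝒜 m).toReal := fun m => ENNReal.toReal_nonneg
  have ha : ∀ m, (collectionVolume 𝒜 m).toReal ≤ (volume S).toReal ^ m := fun m => by
    rw [← ENNReal.toReal_pow]
    exact ENNReal.toReal_mono (ENNReal.pow_ne_top hSfin) (collectionVolume_le h𝒜 m)
  rw [poissonLaw_eq hpos.ne' hSfin h𝒜 hm]
  rcases hn.eq_or_lt with rfl | hn1
  · obtain ⟨h1, h2⟩ := tsum_exp_mul_nonneg_and_le_one ha0 ha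
    have h3 : (μ {L : LatticeSpace 1 |
        (latticeOf L ∩ S).Finite ∧ latticeOf L ∩ S ∈ 𝒜}).toReal ≤ 1 :=
      ENNReal.toReal_le_of_le_ofReal zero_le_one (by simpa using prob_le_one)
    have h4 : (1 : ℝ) ≤ (9 + 4 * B) * Real.exp (-(1 / 10000000 * (1 : ℕ))) := by
      have := Real.add_one_le_exp (-(1 / 10000000 * (1 : ℕ)) : ℝ)
      norm_num at this ⊢
      nlinarith
    refine le_trans (abs_sub_le_iff.2 ⟨?_, ?_⟩) h4
    · linarith
    · linarith [ENNReal.toReal_nonneg (a := μ {L : LatticeSpace 1 |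
        (latticeOf L ∩ S).Finite ∧ latticeOf L ∩ S ∈ 𝒜})]
  · have h1 := abs_measure_sub_sum_poissonTerm_le (K := n / 8) hμ hn1 (by omega) hS hSS hSfin h𝒜
      hG hm
    have h2 := abs_tsum_sub_sum_poissonTerm_le ha0 ha ht (n / 8)
    rw [abs_sub_comm] at h2
    exact ((abs_sub_le _ _ _).trans (add_le_add h1 h2)).trans (total_error_le ht hB htn)
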